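/- Let (S,n) be a regular local ring, I a Cohen-Macaulay ideal of S (i.e., S/I is Cohen-Macaulay), and J = (a₁,...,a_d) an ideal such that the images of a₁,...,a_d form a system of parameters in S/I. Then Torⱼ^S(S/Jⁿ, S/I) = 0 for all j ≥ 1 and all n ≥ 1. -/

import Mathlib

open IsLocalRing Filter Function CategoryTheory

universe u

section Defs

variable (R : Type u) [CommRing R]

/-- The length of a module, as the Krull dimension of its lattice of submodules. -/
noncomputable def mlen (M : Type u) [AddCommGroup M] [Module R M] : WithBot ℕ∞ :=
  Order.krullDim (Submodule R M)

/-- The (Krull) dimension of a module. -/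
noncomputable def mdim (M : Type u) [AddCommGroup M] [Module R M] : WithBot ℕ∞ :=
  ringKrullDim (R ⧸ Module.annihilator R M)

/-- The depth of `M` with respect to an ideal `I`: the supremum of the lengths of
`M`-regular sequences consisting of elements of `I`. -/
noncomputable def idepth (I : Ideal R) (M : Type u) [AddCommGroup M] [Module R M] : ℕ∞ :=
  sSup {n : ℕ∞ | ∃ rs : List R, (rs.length : ℕ∞) = n ∧ (∀ r ∈ rs, r ∈ I) ∧
    RingTheory.Sequence.IsRegular M rs}

/-- The depth of a module over a local ring. -/
noncomputable def mdepth [IsLocalRing R] (M : Type u) [AddCommGroup M] [Module R M] : ℕ∞ :=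
  idepth R (maximalIdeal R) M

/-- A Cohen–Macaulay module over a local ring: depth = dimension. -/
def IsCMMod [IsLocalRing R] (M : Type u) [AddCommGroup M] [Module R M] : Prop :=
  (mdepth R M : WithBot ℕ∞) = mdim R M

/-- A Cohen–Macaulay local ring. -/
def IsCMRing [IsLocalRing R] : Prop := (mdepth R R : WithBot ℕ∞) = ringKrullDim R

/-- A maximal Cohen–Macaulay module: finite with depth = dim R. -/
def IsMCMMod [IsLocalRing R] (M : Type u) [AddCommGroup M] [Module R M] : Prop :=
  Module.Finite R M ∧ (mdepth R M : WithBot ℕ∞) = ringKrullDim R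

/-- `H⁰_m(M)`: the submodule of elements killed by a power of the maximal ideal. -/
def H0 [IsLocalRing R] (M : Type u) [AddCommGroup M] [Module R M] : Submodule R M :=
  ⨆ n : ℕ, Submodule.torsionBySet R M ((maximalIdeal R ^ n : Ideal R) : Set R)

/-- The `i`-th local cohomology of `M` with support in the maximal ideal. -/
noncomputable def lcoh [IsLocalRing R] (i : ℕ) (M : Type u) [AddCommGroup M] [Module R M] :
    ModuleCat.{u} R :=
  (localCohomology (maximalIdeal R) i).obj (ModuleCat.of R M)

/-- The value at `n` of the Hilbert–Samuel polynomial in dimension `d` with coefficients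
`e 0, …, e d`:  `∑ (-1)^i eᵢ C(n+d-1-i, d-i)`. -/
def hsPoly (d : ℕ) (e : ℕ → ℤ) (n : ℕ) : ℤ :=
  ∑ i ∈ Finset.range (d + 1), (-1 : ℤ) ^ i * e i * ((n + d - 1 - i).choose (d - i) : ℤ)

/-- `I` is a parameter ideal for `M` of dimension `d`: generated by `d` elements with
`M/IM` of finite length. -/
def IsParameterIdeal [IsLocalRing R] (I : Ideal R) (d : ℕ) (M : Type u) [AddCommGroup M]
    [Module R M] : Prop :=
  (∃ a : Fin d → R, I = Ideal.span (Set.range a)) ∧ mlen R (M ⧸ (I • (⊤ : Submodule R M))) < ⊤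

/-- `ℓ` records the Hilbert–Samuel function of `I` on `M`:  `ℓ n = λ(M/IⁿM)`. -/
def IsHilbSeq (I : Ideal R) (M : Type u) [AddCommGroup M] [Module R M] (ℓ : ℕ → ℕ) : Prop :=
  ∀ n : ℕ, mlen R (M ⧸ (I ^ n • (⊤ : Submodule R M))) = ((ℓ n : ℕ∞) : WithBot ℕ∞)

/-- `e 0, …, e d` are the Hilbert coefficients of `I` on `M`: the Hilbert–Samuel function
eventually agrees with the Hilbert–Samuel polynomial with these coefficients. -/
def HasHilbCoeffs (I : Ideal R) (M : Type u) [AddCommGroup M] [Module R M] (d : ℕ)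
    (e : ℕ → ℤ) : Prop :=
  ∃ ℓ : ℕ → ℕ, IsHilbSeq R I M ℓ ∧ ∀ᶠ n in atTop, (ℓ n : ℤ) = hsPoly d e n

/-- A local ring is unmixed if every associated prime of its completion has
dimension equal to `dim R`. -/
def Unmixed [IsLocalRing R] : Prop :=
  ∀ p ∈ associatedPrimes (AdicCompletion (maximalIdeal R) R)
      (AdicCompletion (maximalIdeal R) R),
    ringKrullDim ((AdicCompletion (maximalIdeal R) R) ⧸ p) = ringKrullDim R

/-- The height of an ideal: the infimum of the heights of the primes containing it. -/
noncomputable def idealHeight (I : Ideal R) : ℕ∞ :=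
  ⨅ p ∈ {p : PrimeSpectrum R | I ≤ p.asIdeal}, Order.height p

/-- A regular local ring: the maximal ideal is generated by `dim R` elements. -/
def IsRegularLocal [IsLocalRing R] : Prop :=
  ∃ s : Finset R, Ideal.span (s : Set R) = maximalIdeal R ∧
    ((s.card : ℕ∞) : WithBot ℕ∞) = ringKrullDim R

end Defs
section PartMF1

section RelLen
variable {R : Type*} [CommRing R]
variable {A : Type*} [AddCommGroup A] [Module R A] {A' : Type*} [AddCommGroup A'] [Module R A']

/-- relative length of `Q` over `P`. -/
noncomputable def rl (Q P : Submodule R A) : ℕ∞ := Module.length R (Q ⧸ P.submoduleOf Q)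

theorem rl_eq (f : A →ₗ[R] A') (Q P : Submodule R A) (Q' P' : Submodule R A')
    (h1 : ∀ x ∈ Q, f x ∈ Q') (h2 : ∀ x ∈ Q, (f x ∈ P' ↔ x ∈ P))
    (h3 : ∀ y ∈ Q', ∃ x ∈ Q, y - f x ∈ P') : rl Q P = rl Q' P' := by
  let g : Q →ₗ[R] (Q' ⧸ P'.submoduleOf Q') :=
    (P'.submoduleOf Q').mkQ ∘ₗ (f.restrict h1)
  have hg : LinearMap.ker g = P.submoduleOf Q := by
    ext ⟨x, hx⟩
    rw [LinearMap.mem_ker]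
    change Submodule.Quotient.mk _ = 0 ↔ _
    rw [Submodule.Quotient.mk_eq_zero]
    exact h2 x hx
  have hs : Function.Surjective g := by
    intro y
    obtain ⟨⟨y, hy⟩, rfl⟩ := Submodule.Quotient.mk_surjective _ y
    obtain ⟨x, hx, hxy⟩ := h3 y hy
    refine ⟨⟨x, hx⟩, ?_⟩
    simp only [g, LinearMap.comp_apply, Submodule.mkQ_apply]
    symm
    rw [Submodule.Quotient.eq]
    simpa [Submodule.submoduleOf, LinearMap.restrict_apply] using hxy
  exact ((Submodule.quotEquivOfEq _ _ hg.symm).trans (g.quotKerEquivOfSurjective hs)).length_eq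

theorem rl_add (W Q P : Submodule R A) (h1 : P ≤ Q) (h2 : Q ≤ W) : rl W P = rl Q P + rl W Q := by
  refine Module.length_eq_add_of_exact
    (Submodule.mapQ (P.submoduleOf Q) (P.submoduleOf W) (Submodule.inclusion h2) ?_)
    (Submodule.mapQ (P.submoduleOf W) (Q.submoduleOf W) LinearMap.id ?_) ?_ ?_ ?_
  · intro x hx; exact hx
  · intro x hx; exact h1 hx
  · rw [← LinearMap.ker_eq_bot, Submodule.eq_bot_iff]
    intro y hy
    obtain ⟨⟨y, hy'⟩, rfl⟩ := Submodule.Quotient.mk_surjective _ y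
    rw [LinearMap.mem_ker] at hy
    change Submodule.Quotient.mk _ = 0 at hy
    rw [Submodule.Quotient.mk_eq_zero] at hy ⊢
    exact hy
  · intro y
    obtain ⟨y, rfl⟩ := Submodule.Quotient.mk_surjective _ y
    exact ⟨Submodule.Quotient.mk y, rfl⟩
  · intro y
    obtain ⟨⟨y, hy'⟩, rfl⟩ := Submodule.Quotient.mk_surjective _ y
    constructor
    · intro h
      change Submodule.Quotient.mk _ = 0 at h
      rw [Submodule.Quotient.mk_eq_zero] at h
      have : y ∈ Q := h
      exact ⟨Submodule.Quotient.mk ⟨y, this⟩, rfl⟩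
    · rintro ⟨z, hz⟩
      obtain ⟨⟨z, hz'⟩, rfl⟩ := Submodule.Quotient.mk_surjective _ z
      rw [← hz]
      change Submodule.Quotient.mk _ = 0
      rw [Submodule.Quotient.mk_eq_zero]
      exact hz'

theorem rl_zero_iff (Q P : Submodule R A) : rl Q P = 0 ↔ Q ≤ P := by
  rw [rl, Module.length_eq_zero_iff, Submodule.Quotient.subsingleton_iff,
    Submodule.submoduleOf_eq_top]

end RelLen

section Hex
variable {R : Type*} [CommRing R]
variable {A₀ A₁ B₀ B₁ C₀ C₁ : Type*} [AddCommGroup A₀] [Module R A₀] [AddCommGroup A₁] [Module R A₁]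
  [AddCommGroup B₀] [Module R B₀] [AddCommGroup B₁] [Module R B₁]
  [AddCommGroup C₀] [Module R C₀] [AddCommGroup C₁] [Module R C₁]

/-- length of homology at the source of `f` -/
noncomputable def hl (f : A₀ →ₗ[R] A₁) (g : A₁ →ₗ[R] A₀) : ℕ∞ :=
  rl (LinearMap.ker f) (LinearMap.range g)

theorem hex_half (a₀ : A₀ →ₗ[R] A₁) (a₁ : A₁ →ₗ[R] A₀) (b₀ : B₀ →ₗ[R] B₁) (b₁ : B₁ →ₗ[R] B₀)
    (c₀ : C₀ →ₗ[R] C₁) (c₁ : C₁ →ₗ[R] C₀)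
    (i₀ : A₀ →ₗ[R] B₀) (i₁ : A₁ →ₗ[R] B₁) (q₀ : B₀ →ₗ[R] C₀) (q₁ : B₁ →ₗ[R] C₁)
    (hb : ∀ x, b₀ (b₁ x) = 0)
    (hi0 : ∀ x, i₁ (a₀ x) = b₀ (i₀ x)) (hi1 : ∀ x, i₀ (a₁ x) = b₁ (i₁ x))
    (hq0 : ∀ x, q₁ (b₀ x) = c₀ (q₀ x)) (hq1 : ∀ x, q₀ (b₁ x) = c₁ (q₁ x))
    (ii0 : Function.Injective i₀) (ii1 : Function.Injective i₁)
    (e0 : Function.Exact i₀ q₀) (e1 : Function.Exact i₁ q₁)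
    (s0 : Function.Surjective q₀) (s1 : Function.Surjective q₁) :
    hl a₀ a₁ + hl c₀ c₁ = hl b₀ b₁ +
      (rl (LinearMap.range b₁ ⊓ LinearMap.range i₀) (LinearMap.range (b₁ ∘ₗ i₁)) +
       rl (LinearMap.range b₀ ⊓ LinearMap.range i₁) (LinearMap.range (b₀ ∘ₗ i₀))) := by
  set Z := LinearMap.ker b₀
  set Bd := LinearMap.range b₁
  have hBZ : Bd ≤ Z := by rintro _ ⟨x, rfl⟩; exact hb x
  have h1 : hl a₀ a₁ = rl (Z ⊓ LinearMap.range i₀) (LinearMap.range (b₁ ∘ₗ i₁)) := by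
    refine rl_eq i₀ _ _ _ _ ?_ ?_ ?_
    · intro x hx
      refine ⟨?_, x, rfl⟩
      have hx : a₀ x = 0 := hx
      change b₀ (i₀ x) = 0
      rw [← hi0, hx, map_zero]
    · intro x hx
      constructor
      · rintro ⟨y, hy⟩
        refine ⟨y, ii0 ?_⟩
        rw [hi1]; exact hy
      · rintro ⟨y, rfl⟩
        exact ⟨y, (hi1 y).symm⟩
    · rintro _ ⟨hz, x, rfl⟩
      refine ⟨x, ?_, by simp⟩
      have hz : b₀ (i₀ x) = 0 := hz
      rw [← hi0] at hz
      exact ii1 (by simpa using hz)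
  have h2 : rl (Z ⊓ LinearMap.range i₀) (LinearMap.range (b₁ ∘ₗ i₁))
      = rl (Bd ⊓ LinearMap.range i₀) (LinearMap.range (b₁ ∘ₗ i₁)) +
        rl (Z ⊓ LinearMap.range i₀) (Bd ⊓ LinearMap.range i₀) := by
    apply rl_add
    · rintro _ ⟨x, rfl⟩
      exact ⟨⟨_, rfl⟩, a₁ x, hi1 x⟩
    · exact inf_le_inf_right _ hBZ
  have h3 : rl (Z ⊓ LinearMap.range i₀) (Bd ⊓ LinearMap.range i₀)
      = rl ((Z ⊓ LinearMap.range i₀) ⊔ Bd) Bd := by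
    refine rl_eq LinearMap.id _ _ _ _ ?_ ?_ ?_
    · intro x hx; exact Submodule.mem_sup_left hx
    · intro x hx; exact ⟨fun h => ⟨h, hx.2⟩, fun h => h.1⟩
    · intro y hy
      obtain ⟨x, hx, z, hz, rfl⟩ := Submodule.mem_sup.1 hy
      exact ⟨x, hx, by simpa using hz⟩
  have h4 : hl b₀ b₁ = rl ((Z ⊓ LinearMap.range i₀) ⊔ Bd) Bd + rl Z ((Z ⊓ LinearMap.range i₀) ⊔ Bd) :=
    rl_add _ _ _ le_sup_right (sup_le inf_le_left hBZ)
  have h5 : rl Z ((Z ⊓ LinearMap.range i₀) ⊔ Bd) = rl (Z.map q₀) (LinearMap.range c₁) := by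
    refine rl_eq q₀ _ _ _ _ ?_ ?_ ?_
    · intro x hx; exact ⟨x, hx, rfl⟩
    · intro x hx
      constructor
      · rintro ⟨y, hy⟩
        obtain ⟨y, rfl⟩ := s1 y
        rw [← hq1] at hy
        have : q₀ (x - b₁ y) = 0 := by rw [map_sub, hy, sub_self]
        obtain ⟨w, hw⟩ := (e0 _).1 this
        rw [show x = i₀ w + b₁ y by rw [hw]; abel]
        refine Submodule.add_mem_sup ⟨?_, w, rfl⟩ ⟨y, rfl⟩
        rw [hw]
        exact Z.sub_mem hx (hBZ ⟨y, rfl⟩)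
      · intro h
        obtain ⟨x, ⟨hx, w, rfl⟩, _, ⟨y, rfl⟩, rfl⟩ := Submodule.mem_sup.1 h
        refine ⟨q₁ y, ?_⟩
        rw [map_add, (e0 _).2 ⟨w, rfl⟩, hq1, zero_add]
    · rintro _ ⟨x, hx, rfl⟩
      exact ⟨x, hx, by simp⟩
  have h6 : hl c₀ c₁ = rl (Z.map q₀) (LinearMap.range c₁) + rl (LinearMap.ker c₀) (Z.map q₀) := by
    apply rl_add
    · rintro _ ⟨y, rfl⟩
      obtain ⟨y, rfl⟩ := s1 y
      exact ⟨b₁ y, hBZ ⟨y, rfl⟩, hq1 y⟩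
    · rintro _ ⟨x, hx, rfl⟩
      have hx : b₀ x = 0 := hx
      change c₀ (q₀ x) = 0
      rw [← hq0, hx, map_zero]
  have h7 : rl ((LinearMap.ker c₀).comap q₀) (Z ⊔ LinearMap.range i₀)
      = rl (LinearMap.ker c₀) (Z.map q₀) := by
    refine rl_eq q₀ _ _ _ _ ?_ ?_ ?_
    · intro x hx; exact hx
    · intro x hx
      constructor
      · rintro ⟨y, hy, hxy⟩
        have : q₀ (x - y) = 0 := by rw [map_sub, hxy, sub_self]
        obtain ⟨w, hw⟩ := (e0 _).1 this
        rw [show x = y + i₀ w by rw [hw]; abel]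
        exact Submodule.add_mem_sup hy ⟨w, rfl⟩
      · intro h
        obtain ⟨y, hy, _, ⟨w, rfl⟩, rfl⟩ := Submodule.mem_sup.1 h
        refine ⟨y, hy, ?_⟩
        rw [map_add, (e0 _).2 ⟨w, rfl⟩, add_zero]
    · intro y hy
      obtain ⟨y, rfl⟩ := s0 y
      exact ⟨y, hy, by simp⟩
  have h8 : rl ((LinearMap.ker c₀).comap q₀) (Z ⊔ LinearMap.range i₀)
      = rl (LinearMap.range b₀ ⊓ LinearMap.range i₁) (LinearMap.range (b₀ ∘ₗ i₀)) := by
    refine rl_eq b₀ _ _ _ _ ?_ ?_ ?_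
    · intro x hx
      refine ⟨⟨x, rfl⟩, ?_⟩
      have hx : c₀ (q₀ x) = 0 := hx
      rw [← hq0] at hx
      exact (e1 _).1 hx
    · intro x hx
      constructor
      · rintro ⟨w, hw⟩
        have hw : b₀ (i₀ w) = b₀ x := hw
        rw [show x = (x - i₀ w) + i₀ w by abel]
        refine Submodule.add_mem_sup ?_ ⟨w, rfl⟩
        change b₀ _ = 0
        rw [map_sub, hw, sub_self]
      · intro h
        obtain ⟨y, hy, _, ⟨w, rfl⟩, rfl⟩ := Submodule.mem_sup.1 h
        have hy : b₀ y = 0 := hy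
        exact ⟨w, by simp [hy]⟩
    · rintro _ ⟨⟨x, rfl⟩, w, hw⟩
      refine ⟨x, ?_, by simp⟩
      change c₀ (q₀ x) = 0
      rw [← hq0, ← hw]
      exact (e1 _).2 ⟨w, rfl⟩
  rw [h1, h2, h3, h6, ← h7, h8, h4, h5]
  abel

end Hex

end PartMF1

section PartMF2

section MFact
/-- even and odd index types -/
def mfI : ℕ → Type × Type
  | 0 => (Unit, Empty)
  | n + 1 => ((mfI n).1 ⊕ (mfI n).2, (mfI n).2 ⊕ (mfI n).1)

theorem mfI_fin (n : ℕ) : Finite (mfI n).1 ∧ Finite (mfI n).2 := by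
  induction n with
  | zero => exact ⟨inferInstanceAs (Finite Unit), inferInstanceAs (Finite Empty)⟩
  | succ n ih =>
    haveI := ih.1
    haveI := ih.2
    exact ⟨inferInstanceAs (Finite (_ ⊕ _)), inferInstanceAs (Finite (_ ⊕ _))⟩

instance (n : ℕ) : Finite (mfI n).1 := (mfI_fin n).1
instance (n : ℕ) : Finite (mfI n).2 := (mfI_fin n).2

variable {B : Type*} [CommRing B]

/-- one step of the cone construction -/
def coneMap {M : Type*} [AddCommGroup M] [Module B M] {α β : Type} (u g : B)
    (d0 : (α → M) →ₗ[B] (β → M)) (d1 : (β → M) →ₗ[B] (α → M)) :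
    (α ⊕ β → M) →ₗ[B] (β ⊕ α → M) where
  toFun x := Sum.elim (d0 (x ∘ Sum.inl) + u • (x ∘ Sum.inr)) (g • (x ∘ Sum.inl) - d1 (x ∘ Sum.inr))
  map_add' x y := by
    have h1 : (x + y) ∘ Sum.inl = (x ∘ Sum.inl : α → M) + (y ∘ Sum.inl) := rfl
    have h2 : (x + y) ∘ Sum.inr = (x ∘ Sum.inr : β → M) + (y ∘ Sum.inr) := rfl
    ext (i | i)
    · simp only [h1, h2, map_add, Sum.elim_inl, Pi.add_apply, smul_add]; abel
    · simp only [h1, h2, map_add, Sum.elim_inr, Pi.add_apply, Pi.sub_apply, smul_add]; abel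
  map_smul' r x := by
    have h1 : (r • x) ∘ Sum.inl = r • (x ∘ Sum.inl : α → M) := rfl
    have h2 : (r • x) ∘ Sum.inr = r • (x ∘ Sum.inr : β → M) := rfl
    ext (i | i)
    · simp only [h1, h2, map_smul, Sum.elim_inl, Pi.add_apply, Pi.smul_apply, smul_add,
        RingHom.id_apply, smul_comm r u]
    · simp only [h1, h2, map_smul, Sum.elim_inr, Pi.sub_apply, Pi.smul_apply, smul_sub,
        RingHom.id_apply, smul_comm r g]

/-- The Koszul matrix factorization. -/
def mfD (M : Type*) [AddCommGroup M] [Module B M] : (L : List (B × B)) →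
    (((mfI L.length).1 → M) →ₗ[B] ((mfI L.length).2 → M)) ×
    (((mfI L.length).2 → M) →ₗ[B] ((mfI L.length).1 → M))
  | [] => (0, 0)
  | (u, g) :: L => (coneMap u g (mfD M L).1 (mfD M L).2, coneMap u g (mfD M L).2 (mfD M L).1)

/-- the scalar of the factorization -/
def mfE (L : List (B × B)) : B := (L.map fun p => p.2 * p.1).sum

theorem cone_sq {M : Type*} [AddCommGroup M] [Module B M] {α β : Type} (u g e : B)
    (d0 : (α → M) →ₗ[B] (β → M)) (d1 : (β → M) →ₗ[B] (α → M))
    (h0 : ∀ x, d1 (d0 x) = e • x) (h1 : ∀ x, d0 (d1 x) = e • x) (x) :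
    coneMap u g d1 d0 (coneMap u g d0 d1 x) = (g * u + e) • x := by
  have k1 : (coneMap u g d0 d1 x) ∘ Sum.inl = d0 (x ∘ Sum.inl) + u • (x ∘ Sum.inr) := rfl
  have k2 : (coneMap u g d0 d1 x) ∘ Sum.inr = g • (x ∘ Sum.inl) - d1 (x ∘ Sum.inr) := rfl
  have k : coneMap u g d1 d0 (coneMap u g d0 d1 x) =
    Sum.elim (d1 (d0 (x ∘ Sum.inl) + u • (x ∘ Sum.inr)) + u • (g • (x ∘ Sum.inl) - d1 (x ∘ Sum.inr)))
      (g • (d0 (x ∘ Sum.inl) + u • (x ∘ Sum.inr)) - d0 (g • (x ∘ Sum.inl) - d1 (x ∘ Sum.inr))) := rfl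
  rw [k]
  ext (i | i)
  · simp only [Sum.elim_inl, map_add, map_smul, h0, Pi.add_apply, Pi.smul_apply, Function.comp,
      Pi.sub_apply]
    module
  · simp only [Sum.elim_inr, map_sub, map_smul, h1, Pi.add_apply, Pi.smul_apply, Function.comp,
      Pi.sub_apply]
    module

theorem mfD_sq (M : Type*) [AddCommGroup M] [Module B M] (L : List (B × B)) :
    (∀ x, (mfD M L).2 ((mfD M L).1 x) = mfE L • x) ∧
    (∀ x, (mfD M L).1 ((mfD M L).2 x) = mfE L • x) := by
  induction L with
  | nil => exact ⟨fun x => by simp [mfD, mfE], fun x => by simp [mfD, mfE]⟩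
  | cons p L ih =>
    obtain ⟨u, g⟩ := p
    have : mfE ((u, g) :: L) = g * u + mfE L := by simp [mfE]
    rw [this]
    exact ⟨cone_sq _ _ _ _ _ ih.1 ih.2, cone_sq _ _ _ _ _ ih.2 ih.1⟩

theorem cone_nat {M M' : Type*} [AddCommGroup M] [Module B M] [AddCommGroup M'] [Module B M']
    (f : M →ₗ[B] M') {α β : Type} (u g : B)
    (d0 : (α → M) →ₗ[B] (β → M)) (d1 : (β → M) →ₗ[B] (α → M))
    (d0' : (α → M') →ₗ[B] (β → M')) (d1' : (β → M') →ₗ[B] (α → M'))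
    (k0 : ∀ x, f ∘ (d0 x) = d0' (f ∘ x)) (k1 : ∀ x, f ∘ (d1 x) = d1' (f ∘ x)) (x) :
    f ∘ (coneMap u g d0 d1 x) = coneMap u g d0' d1' (f ∘ x) := by
  have e1 : (f ∘ x) ∘ Sum.inl = f ∘ (x ∘ (Sum.inl : α → α ⊕ β)) := rfl
  have e2 : (f ∘ x) ∘ Sum.inr = f ∘ (x ∘ (Sum.inr : β → α ⊕ β)) := rfl
  ext (i | i)
  · simp only [coneMap, LinearMap.coe_mk, AddHom.coe_mk, e1, e2, ← k0, ← k1]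
    simp
  · simp only [coneMap, LinearMap.coe_mk, AddHom.coe_mk, e1, e2, ← k0, ← k1]
    simp

theorem mfD_nat {M M' : Type*} [AddCommGroup M] [Module B M] [AddCommGroup M'] [Module B M']
    (f : M →ₗ[B] M') (L : List (B × B)) :
    (∀ x, f ∘ ((mfD M L).1 x) = (mfD M' L).1 (f ∘ x)) ∧
    (∀ x, f ∘ ((mfD M L).2 x) = (mfD M' L).2 (f ∘ x)) := by
  induction L with
  | nil => exact ⟨fun x => by ext i; exact i.elim, fun x => by ext i; simp [mfD]⟩
  | cons p L ih =>
    obtain ⟨u, g⟩ := p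
    exact ⟨cone_nat f u g _ _ _ _ ih.1 ih.2, cone_nat f u g _ _ _ _ ih.2 ih.1⟩

/-- homology lengths -/
noncomputable def h0 (L : List (B × B)) (M : Type*) [AddCommGroup M] [Module B M] : ℕ∞ :=
  hl (mfD M L).1 (mfD M L).2
noncomputable def h1 (L : List (B × B)) (M : Type*) [AddCommGroup M] [Module B M] : ℕ∞ :=
  hl (mfD M L).2 (mfD M L).1

theorem exact_pi {M M' M'' : Type*} [AddCommGroup M] [Module B M] [AddCommGroup M'] [Module B M']
    [AddCommGroup M''] [Module B M''] (i : M' →ₗ[B] M) (q : M →ₗ[B] M'') (α : Type)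
    (e : Function.Exact i q) : Function.Exact (i.compLeft α) (q.compLeft α) := by
  intro x
  constructor
  · intro h
    have : ∀ j, ∃ y, i y = x j := fun j => (e _).1 (congrFun h j)
    choose y hy using this
    exact ⟨y, funext hy⟩
  · rintro ⟨y, rfl⟩
    funext j
    exact (e _).2 ⟨y j, rfl⟩

theorem mf_hex (L : List (B × B)) {M M' M'' : Type*} [AddCommGroup M] [Module B M]
    [AddCommGroup M'] [Module B M']
    [AddCommGroup M''] [Module B M''] (i : M' →ₗ[B] M) (q : M →ₗ[B] M'')
    (hi : Function.Injective i) (e : Function.Exact i q) (hq : Function.Surjective q)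
    (hE : ∀ x : M, mfE L • x = 0) :
    ∃ X, h0 L M' + h0 L M'' = h0 L M + X ∧ h1 L M' + h1 L M'' = h1 L M + X := by
  have n1 := mfD_nat i L
  have n2 := mfD_nat q L
  have sq := mfD_sq M L
  have hE' : ∀ {α : Type} (x : α → M), mfE L • x = 0 := fun x => funext fun j => hE _
  have A := hex_half (mfD M' L).1 (mfD M' L).2 (mfD M L).1 (mfD M L).2 (mfD M'' L).1 (mfD M'' L).2
    (i.compLeft _) (i.compLeft _) (q.compLeft _) (q.compLeft _)
    (fun x => by rw [sq.2, hE']) n1.1 n1.2 n2.1 n2.2 (hi.comp_left) (hi.comp_left)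
    (exact_pi i q _ e) (exact_pi i q _ e) (hq.comp_left) (hq.comp_left)
  have A' := hex_half (mfD M' L).2 (mfD M' L).1 (mfD M L).2 (mfD M L).1 (mfD M'' L).2 (mfD M'' L).1
    (i.compLeft _) (i.compLeft _) (q.compLeft _) (q.compLeft _)
    (fun x => by rw [sq.1, hE']) n1.2 n1.1 n2.2 n2.1 (hi.comp_left) (hi.comp_left)
    (exact_pi i q _ e) (exact_pi i q _ e) (hq.comp_left) (hq.comp_left)
  refine ⟨_, A, ?_⟩
  rw [add_comm (rl _ _) (rl _ _)] at A'
  exact A'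

theorem h0_zero_iff (L : List (B × B)) {M : Type*} [AddCommGroup M] [Module B M] :
    h0 L M = 0 ↔ ∀ x, (mfD M L).1 x = 0 → ∃ y, (mfD M L).2 y = x := by
  rw [h0, hl, rl_zero_iff]; rfl

theorem h1_zero_iff (L : List (B × B)) {M : Type*} [AddCommGroup M] [Module B M] :
    h1 L M = 0 ↔ ∀ x, (mfD M L).2 x = 0 → ∃ y, (mfD M L).1 y = x := by
  rw [h1, hl, rl_zero_iff]; rfl

end MFact

end PartMF2

section PartMF3

section Theta
variable {B : Type*} [CommRing B]

theorem cone_regular {M M' : Type*} [AddCommGroup M] [Module B M] [AddCommGroup M'] [Module B M']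
    (q : M →ₗ[B] M') {α β : Type} (u g e : B)
    (d0 : (α → M) →ₗ[B] (β → M)) (d1 : (β → M) →ₗ[B] (α → M))
    (d0' : (α → M') →ₗ[B] (β → M')) (d1' : (β → M') →ₗ[B] (α → M'))
    (k0 : ∀ x, q ∘ (d0 x) = d0' (q ∘ x)) (k1 : ∀ x, q ∘ (d1 x) = d1' (q ∘ x))
    (s0 : ∀ x, d1 (d0 x) = e • x) (s1 : ∀ x, d0 (d1 x) = e • x)
    (hE : ∀ x : M, (g * u + e) • x = 0) (hu : ∀ x : M, u • x = 0 → x = 0)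
    (hq : Function.Surjective q) (hker : ∀ x, q x = 0 ↔ ∃ y, u • y = x) :
    hl (coneMap u g d0 d1) (coneMap u g d1 d0) = hl d0' d1' := by
  have hE' : ∀ {γ : Type} (x : γ → M), (g * u + e) • x = 0 := fun x => funext fun i => hE _
  have hu' : ∀ {γ : Type} (x y : γ → M), u • x = u • y → x = y := by
    intro γ x y h
    funext i
    have := congrFun h i
    simp only [Pi.smul_apply] at this
    rw [← sub_eq_zero]
    apply hu
    rw [smul_sub, this, sub_self]
  have hq' : ∀ {γ : Type} (x : γ → M'), ∃ y : γ → M, q ∘ y = x := fun x => hq.comp_left x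
  have hker' : ∀ {γ : Type} (x : γ → M), q ∘ x = 0 → ∃ y : γ → M, u • y = x := by
    intro γ x h
    have : ∀ i, ∃ y, u • y = x i := fun i => (hker _).1 (congrFun h i)
    choose y hy using this
    exact ⟨y, funext hy⟩
  have hqu : ∀ {γ : Type} (x : γ → M), q ∘ (u • x) = 0 := by
    intro γ x; funext i; exact (hker _).2 ⟨x i, rfl⟩
  have hadd : ∀ {γ : Type} (x y : γ → M), q ∘ (x + y) = q ∘ x + q ∘ y := by
    intro γ x y; funext i; simp
  have hsub : ∀ {γ : Type} (x y : γ → M), q ∘ (x - y) = q ∘ x - q ∘ y := by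
    intro γ x y; funext i; simp
  refine rl_eq ((q.compLeft α) ∘ₗ (LinearMap.funLeft B M (Sum.inl : α → α ⊕ β))) _ _ _ _ ?_ ?_ ?_
  · intro x hx
    have h1 : d0 (x ∘ Sum.inl) + u • (x ∘ Sum.inr) = 0 := congrArg (fun y => y ∘ Sum.inl) hx
    change d0' (q ∘ (x ∘ Sum.inl)) = 0
    rw [← k0, eq_neg_of_add_eq_zero_left h1, ← smul_neg, hqu]
  · intro x hx
    have h1 : d0 (x ∘ Sum.inl) + u • (x ∘ Sum.inr) = 0 := congrArg (fun y => y ∘ Sum.inl) hx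
    constructor
    · rintro ⟨b, hb⟩
      obtain ⟨b, rfl⟩ := hq' b
      have hb : d1' (q ∘ b) = q ∘ (x ∘ Sum.inl) := hb
      rw [← k1, ← sub_eq_zero, ← hsub] at hb
      obtain ⟨b0, hb0⟩ := hker' _ hb
      refine ⟨Sum.elim b (-b0), ?_⟩
      have h2 : d1 b + u • (-b0) = x ∘ Sum.inl := by rw [smul_neg, hb0]; abel
      have h3 : g • b - d0 (-b0) = x ∘ Sum.inr := by
        apply hu'
        have e1 : u • (g • b - d0 (-b0)) = u • g • b - d0 (u • (-b0)) := by
          rw [smul_sub, map_smul]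
        have e2 : u • (-b0) = x ∘ Sum.inl - d1 b := by rw [← h2]; abel
        rw [e1, e2, map_sub, s1]
        have e3 := hE' b
        rw [add_smul, mul_comm, mul_smul] at e3
        rw [eq_neg_of_add_eq_zero_right h1]
        rw [eq_neg_of_add_eq_zero_left e3]; abel
      change Sum.elim (d1 b + u • (-b0)) (g • b - d0 (-b0)) = x
      rw [h2, h3]
      exact Sum.elim_comp_inl_inr x
    · rintro ⟨b, rfl⟩
      refine ⟨q ∘ (b ∘ Sum.inl), ?_⟩
      change d1' (q ∘ (b ∘ Sum.inl)) = q ∘ (d1 (b ∘ Sum.inl) + u • (b ∘ Sum.inr))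
      rw [hadd, hqu, k1, add_zero]
  · intro y hy
    obtain ⟨a0, rfl⟩ := hq' y
    have hy : d0' (q ∘ a0) = 0 := hy
    rw [← k0] at hy
    obtain ⟨a1, ha1⟩ := hker' _ hy
    refine ⟨Sum.elim a0 (-a1), ?_, ?_⟩
    · change Sum.elim (d0 a0 + u • (-a1)) (g • a0 - d1 (-a1)) = 0
      have h2 : d0 a0 + u • (-a1) = 0 := by rw [← ha1, smul_neg]; abel
      have h3 : g • a0 - d1 (-a1) = 0 := by
        apply hu'
        rw [smul_sub, ← map_smul, smul_neg, ha1, map_neg, s0]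
        have e3 := hE' a0
        rw [add_smul, mul_comm, mul_smul] at e3
        rw [sub_neg_eq_add, e3, smul_zero]
      rw [h2, h3]
      ext (i | i) <;> rfl
    · change q ∘ a0 - q ∘ a0 ∈ _
      rw [sub_self]; exact zero_mem _

theorem hl_neg {A₀ A₁ : Type*} [AddCommGroup A₀] [Module B A₀] [AddCommGroup A₁] [Module B A₁]
    (f : A₀ →ₗ[B] A₁) (g : A₁ →ₗ[B] A₀) : hl (-f) (-g) = hl f g := by
  refine rl_eq LinearMap.id _ _ _ _ ?_ ?_ ?_
  · intro x hx
    have : - f x = 0 := hx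
    exact neg_eq_zero.1 this
  · intro x _
    constructor
    · rintro ⟨y, rfl⟩
      exact ⟨-y, by simp⟩
    · rintro ⟨y, rfl⟩
      exact ⟨-y, by simp⟩
  · intro y hy
    have : f y = 0 := hy
    exact ⟨y, by change - f y = 0; rw [this, neg_zero], by simp⟩

theorem cone_zero {M : Type*} [AddCommGroup M] [Module B M]
    {α β : Type} (u g : B)
    (d0 : (α → M) →ₗ[B] (β → M)) (d1 : (β → M) →ₗ[B] (α → M))
    (s0 : ∀ x, d1 (d0 x) = 0) (s1 : ∀ x, d0 (d1 x) = 0)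
    (hu : ∀ x : M, u • x = 0) :
    ∃ X, hl d1 d0 + hl d0 d1 = hl (coneMap u g d0 d1) (coneMap u g d1 d0) + X ∧
      hl d0 d1 + hl d1 d0 = hl (coneMap u g d1 d0) (coneMap u g d0 d1) + X := by
  have hu' : ∀ {γ : Type} (x : γ → M), u • x = 0 := fun x => funext fun i => hu _
  let i : ∀ (γ δ : Type), (δ → M) →ₗ[B] (γ ⊕ δ → M) := fun γ δ =>
    { toFun := fun x => Sum.elim 0 x
      map_add' := fun x y => by ext (i | i) <;> simp
      map_smul' := fun r x => by ext (i | i) <;> simp }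
  let q : ∀ (γ δ : Type), (γ ⊕ δ → M) →ₗ[B] (γ → M) := fun γ δ => LinearMap.funLeft B M Sum.inl
  have key : ∀ {α β : Type} (d0 : (α → M) →ₗ[B] (β → M)) (d1 : (β → M) →ₗ[B] (α → M))
      (s0 : ∀ x, d1 (d0 x) = 0) (s1 : ∀ x, d0 (d1 x) = 0), _ := fun {α β} d0 d1 s0 s1 =>
    hex_half (-d1) (-d0) (coneMap u g d0 d1) (coneMap u g d1 d0) d0 d1
    (i α β) (i β α) (q α β) (q β α)
    (fun x => by
      rw [cone_sq u g 0 d1 d0 (by simpa using s1) (by simpa using s0), add_zero, mul_smul, hu',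
        smul_zero])
    (fun x => by
      ext (j | j)
      · change 0 = ((d0 0 : β → M) + u • x) j
        simp [hu']
      · change - d1 x j = (g • (0 : α → M) - d1 x) j
        simp)
    (fun x => by
      ext (j | j)
      · change 0 = ((d1 0 : α → M) + u • x) j
        simp [hu']
      · change - d0 x j = (g • (0 : β → M) - d0 x) j
        simp)
    (fun x => by
      change d0 (x ∘ Sum.inl) + u • (x ∘ Sum.inr) = d0 (x ∘ Sum.inl)
      rw [hu', add_zero])
    (fun x => by
      change d1 (x ∘ Sum.inl) + u • (x ∘ Sum.inr) = d1 (x ∘ Sum.inl)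
      rw [hu', add_zero])
    (fun x y h => congrArg (fun z => z ∘ Sum.inr) h)
    (fun x y h => congrArg (fun z => z ∘ Sum.inr) h)
    (fun x => ⟨fun h => ⟨x ∘ Sum.inr, by
        have h : x ∘ Sum.inl = 0 := h
        refine Eq.trans ?_ (Sum.elim_comp_inl_inr x)
        rw [h]; rfl⟩, by rintro ⟨y, rfl⟩; rfl⟩)
    (fun x => ⟨fun h => ⟨x ∘ Sum.inr, by
        have h : x ∘ Sum.inl = 0 := h
        refine Eq.trans ?_ (Sum.elim_comp_inl_inr x)
        rw [h]; rfl⟩, by rintro ⟨y, rfl⟩; rfl⟩)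
    (fun x => ⟨Sum.elim x 0, rfl⟩) (fun x => ⟨Sum.elim x 0, rfl⟩)
  have A := key d0 d1 s0 s1
  have A' := key d1 d0 s1 s0
  rw [hl_neg] at A A'
  refine ⟨_, A, ?_⟩
  rw [add_comm (rl _ _) (rl _ _)] at A'
  exact A'

end Theta

end PartMF3

section PartMF4

open IsLocalRing

section Theta2

theorem withBot_enat_cancel {n : ℕ} {x : WithBot ℕ∞} (h : (n : WithBot ℕ∞) + 1 ≤ x + 1) : (n : WithBot ℕ∞) ≤ x := by
  induction x with
  | bot => simp at h
  | coe x =>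
    induction x with
    | top => exact le_top
    | coe x => norm_cast at *; omega

theorem enat_fin {a c m X : ℕ∞} (h : a + c = m + X) (ha : a ≠ ⊤) (hc : c ≠ ⊤) : m ≠ ⊤ ∧ X ≠ ⊤ := by
  have : m + X ≠ ⊤ := by rw [← h]; simp [ha, hc]
  simpa using this

theorem finlen_of_pow {B : Type*} [CommRing B] [IsLocalRing B] [IsNoetherianRing B] (M : Type*)
    [AddCommGroup M] [Module B M] [Module.Finite B M] (k : ℕ)
    (h : maximalIdeal B ^ k ≤ Module.annihilator B M) : Module.length B M ≠ ⊤ := by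
  rw [Module.length_ne_top_iff, isFiniteLength_iff_isNoetherian_isArtinian]
  refine ⟨inferInstance, ?_⟩
  by_cases hk : k = 0
  · subst hk
    have : Subsingleton M := by
      rw [← Module.annihilator_eq_top_iff (R := B)]
      simpa using h
    infer_instance
  have hne : maximalIdeal B ^ k ≠ ⊤ := fun h' =>
    (maximalIdeal.isMaximal B).ne_top (top_le_iff.1 (h'.ge.trans (Ideal.pow_le_self hk)))
  let R := B ⧸ (maximalIdeal B ^ k)
  have : Nontrivial R := Ideal.Quotient.nontrivial_iff.2 hne
  have : IsLocalRing R := .of_surjective' (Ideal.Quotient.mk _) Ideal.Quotient.mk_surjective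
  have : IsArtinianRing R := by
    rw [isArtinianRing_iff_isNilpotent_maximalIdeal]
    refine ⟨k, ?_⟩
    have e : (maximalIdeal B).map (Ideal.Quotient.mk (maximalIdeal B ^ k)) = maximalIdeal R :=
      IsLocalRing.map_maximalIdeal_of_surjective _ Ideal.Quotient.mk_surjective
    rw [← e, ← Ideal.map_pow, Ideal.map_quotient_self]
    rfl
  have ht : Module.IsTorsionBySet B M (maximalIdeal B ^ k : Ideal B) := by
    intro x r
    exact Module.mem_annihilator.1 (h r.2) x
  letI : Module R M := ht.module
  haveI : IsScalarTower B R M := ht.isScalarTower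
  haveI : Module.Finite R M := Module.Finite.of_restrictScalars_finite B R M
  haveI : IsArtinian R M := isArtinian_of_fg_of_artinian'
  exact isArtinian_of_surjective_algebraMap (R := R) (Ideal.Quotient.mk_surjective)

universe v
variable {B : Type v} [CommRing B] [IsLocalRing B] [IsNoetherianRing B]

theorem mfE_cons (u g : B) (L : List (B × B)) : mfE ((u, g) :: L) = g * u + mfE L := by simp [mfE]

/-- the conclusion of the theta lemma -/
def ThetaOK (L : List (B × B)) : Prop :=
  ∀ (M : Type v) [AddCommGroup M] [Module B M] [Module.Finite B M], (∀ x : M, mfE L • x = 0) →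
    (∃ k, maximalIdeal B ^ k ≤ Module.annihilator B M ⊔ Ideal.ofList (L.map Prod.fst)) →
    h0 L M ≠ ⊤ ∧ h1 L M ≠ ⊤ ∧ h1 L M ≤ h0 L M ∧
      ((L.length : WithBot ℕ∞) ≤ Module.supportDim B M → h1 L M < h0 L M)

theorem theta_nilp (L : List (B × B)) (ih : ThetaOK L) (u g : B) (s : ℕ) :
    ∀ (M : Type v) [AddCommGroup M] [Module B M] [Module.Finite B M],
    (∀ x : M, mfE ((u, g) :: L) • x = 0) →
    (∃ k, maximalIdeal B ^ k ≤ Module.annihilator B M ⊔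
      Ideal.ofList (((u, g) :: L).map Prod.fst)) → (∀ x : M, u ^ s • x = 0) →
    h0 ((u, g) :: L) M ≠ ⊤ ∧ h1 ((u, g) :: L) M = h0 ((u, g) :: L) M := by
  induction s with
  | zero =>
    intro M _ _ _ _ _ hs
    have : Subsingleton M := ⟨fun x y => by rw [← one_smul B x, ← one_smul B y, ← pow_zero u, hs, hs]⟩
    have e0 : h0 ((u, g) :: L) M = 0 := by
      rw [h0_zero_iff]; intro x _; exact ⟨0, Subsingleton.elim _ _⟩
    have e1 : h1 ((u, g) :: L) M = 0 := by
      rw [h1_zero_iff]; intro x _; exact ⟨0, Subsingleton.elim _ _⟩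
    rw [e0, e1]; simp
  | succ s ihs =>
    intro M _ _ _ hE hk hs
    let A : Submodule B M := LinearMap.range (LinearMap.lsmul B M u)
    obtain ⟨k, hk⟩ := hk
    have hA := ihs A (fun x => Subtype.ext (hE x))
      ⟨k, hk.trans (sup_le_sup_right (LinearMap.annihilator_le_of_injective A.subtype A.injective_subtype) _)⟩
      (by
        rintro ⟨_, y, rfl⟩
        apply Subtype.ext
        change u ^ s • (u • y) = 0
        rw [smul_smul, ← pow_succ, hs])
    let C := M ⧸ A
    have hEC : ∀ x : C, mfE ((u, g) :: L) • x = 0 := by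
      intro x
      obtain ⟨x, rfl⟩ := A.mkQ_surjective x
      rw [← map_smul, hE, map_zero]
    have huC : ∀ x : C, u • x = 0 := by
      intro x
      obtain ⟨x, rfl⟩ := A.mkQ_surjective x
      rw [← map_smul, Submodule.mkQ_apply, Submodule.Quotient.mk_eq_zero]
      exact ⟨x, rfl⟩
    have heC : ∀ x : C, mfE L • x = 0 := by
      intro x
      have := hEC x
      rwa [mfE_cons, add_smul, mul_smul, huC, smul_zero, zero_add] at this
    have hC := ih C heC ⟨k, by
      refine hk.trans (sup_le (le_sup_of_le_left
        (LinearMap.annihilator_le_of_surjective A.mkQ A.mkQ_surjective)) ?_)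
      rw [List.map_cons, Ideal.ofList_cons]
      refine sup_le (le_sup_of_le_left ?_) le_sup_right
      rw [Ideal.span_singleton_le_iff_mem, Module.mem_annihilator]
      exact huC⟩
    have sq := mfD_sq C L
    have heC' : ∀ {γ : Type} (x : γ → C), mfE L • x = 0 := fun x => funext fun i => heC _
    obtain ⟨X, hX0, hX1⟩ := cone_zero u g (mfD C L).1 (mfD C L).2
      (fun x => by rw [sq.1, heC']) (fun x => by rw [sq.2, heC']) huC
    obtain ⟨Y, hY0, hY1⟩ := mf_hex ((u, g) :: L) A.subtype A.mkQ A.injective_subtype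
      (by rw [LinearMap.exact_iff]; simp) A.mkQ_surjective hE
    change h1 L C + h0 L C = h0 ((u, g) :: L) C + X at hX0
    change h0 L C + h1 L C = h1 ((u, g) :: L) C + X at hX1
    have f0 := enat_fin hX0 hC.2.1 hC.1
    have f1 := enat_fin hX1 hC.1 hC.2.1
    have f2 := enat_fin hY0 hA.1 f0.1
    refine ⟨f2.1, ?_⟩
    have fA1 : h1 ((u, g) :: L) A ≠ ⊤ := by rw [hA.2]; exact hA.1
    have f3 := enat_fin hY1 fA1 f1.1
    have hA0 := hA.1
    have hA2 := hA.2
    obtain ⟨hC0, hC1, -⟩ := hC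
    obtain ⟨f0, fX⟩ := f0
    obtain ⟨f1, -⟩ := f1
    obtain ⟨f2, fY⟩ := f2
    obtain ⟨f3, -⟩ := f3
    generalize h0 ((u, g) :: L) M = a at *
    generalize h1 ((u, g) :: L) M = b at *
    generalize h0 ((u, g) :: L) C = a' at *
    generalize h1 ((u, g) :: L) C = b' at *
    generalize h0 ((u, g) :: L) A = a'' at *
    generalize h1 ((u, g) :: L) A = b'' at *
    generalize h0 L C = p at *
    generalize h1 L C = q at *
    lift a to ℕ using f2
    lift b to ℕ using f3
    lift a' to ℕ using f0
    lift b' to ℕ using f1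
    lift a'' to ℕ using hA0
    lift b'' to ℕ using fA1
    lift p to ℕ using hC0
    lift q to ℕ using hC1
    lift X to ℕ using fX
    lift Y to ℕ using fY
    norm_cast at *
    omega

theorem dim_le_of_ofList {R : Type*} [CommRing R] [IsLocalRing R] [IsNoetherianRing R]
    (l : List R) (hl : ∀ x ∈ l, x ∈ maximalIdeal R) (k : ℕ)
    (h : maximalIdeal R ^ k ≤ Ideal.ofList l) : ringKrullDim R ≤ l.length := by
  classical
  have hsub : (l.toFinset : Set R) ⊆ (Ring.jacobson R : Set R) := by
    intro x hx
    rw [IsLocalRing.ringJacobson_eq_maximalIdeal]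
    exact hl x (by simpa using hx)
  refine (ringKrullDim_le_ringKrullDim_quotient_add_card l.toFinset hsub).trans ?_
  have : ringKrullDim (R ⧸ Ideal.span (l.toFinset : Set R)) ≤ 0 := by
    rcases subsingleton_or_nontrivial (R ⧸ Ideal.span (l.toFinset : Set R)) with hs | hn
    · simp [ringKrullDim_eq_bot_of_subsingleton]
    · have : Ring.KrullDimLE 0 (R ⧸ Ideal.span (l.toFinset : Set R)) := by
        rw [Ring.krullDimLE_zero_iff]
        intro I hI
        have h1 : (I.comap (Ideal.Quotient.mk (Ideal.span (l.toFinset : Set R)))).IsPrime := inferInstance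
        have h2 : maximalIdeal R ≤ I.comap (Ideal.Quotient.mk (Ideal.span (l.toFinset : Set R))) := by
          by_cases hk : k = 0
          · subst hk
            rw [pow_zero, Ideal.one_eq_top, top_le_iff] at h
            exfalso
            have : Ideal.ofList l ≤ maximalIdeal R := Ideal.span_le.2 fun x hx => hl x hx
            exact (maximalIdeal.isMaximal R).ne_top (top_le_iff.1 (h ▸ this))
          rw [← h1.pow_le_iff hk]
          refine h.trans ?_
          intro x hx
          have hx' : x ∈ Ideal.span (l.toFinset : Set R) := by
            rw [Ideal.ofList] at hx
            convert hx using 2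
            ext; simp
          rw [Ideal.mem_comap, Ideal.Quotient.eq_zero_iff_mem.2 hx']
          exact zero_mem _
        have h3 := (maximalIdeal.isMaximal R).eq_of_le h1.ne_top h2
        have := Ideal.map_eq_top_or_isMaximal_of_surjective
          (Ideal.Quotient.mk (Ideal.span (l.toFinset : Set R))) Ideal.Quotient.mk_surjective
          (maximalIdeal.isMaximal R)
        rw [h3, Ideal.map_comap_of_surjective _ Ideal.Quotient.mk_surjective] at this
        exact this.resolve_left hI.ne_top
      exact Ring.krullDimLE_iff.1 this
  refine (add_le_add this le_rfl).trans ?_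
  rw [zero_add]
  exact_mod_cast List.toFinset_card_le l

theorem theta_main (L : List (B × B)) (hL : ∀ p ∈ L, p.1 ∈ maximalIdeal B) : ThetaOK L := by
  induction L with
  | nil =>
    intro M _ _ _ hE ⟨k, hk⟩
    rw [List.map_nil, Ideal.ofList_nil, sup_bot_eq] at hk
    have e1 : h1 ([] : List (B × B)) M = 0 := by
      rw [h1_zero_iff]; intro x _; exact ⟨0, by ext i; exact i.elim⟩
    have e0 : h0 ([] : List (B × B)) M = Module.length B M := by
      rw [h0, hl]
      have : Module.length B M = rl (⊤ : Submodule B M) ⊥ := by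
        rw [rl]
        refine LinearEquiv.length_eq ?_
        refine Submodule.topEquiv.symm.trans (Submodule.quotEquivOfEqBot _ ?_).symm
        rw [Submodule.eq_bot_iff]
        intro x hx
        exact Subtype.ext hx
      rw [this]
      refine rl_eq (LinearMap.proj () : (Unit → M) →ₗ[B] M) _ _ _ _ (fun _ _ => trivial) ?_ ?_
      · intro x _
        constructor
        · intro h
          have h : x () = 0 := h
          exact ⟨0, by funext i; rw [map_zero]; exact h.symm⟩
        · rintro ⟨y, rfl⟩
          rfl
      · intro y _
        exact ⟨fun _ => y, rfl, by simp⟩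
    have f := finlen_of_pow M k hk
    rw [e0, e1]
    refine ⟨f, by simp, by simp, fun h => ?_⟩
    rw [pos_iff_ne_zero, Ne, Module.length_eq_zero_iff, ← Module.supportDim_eq_bot_iff_subsingleton B]
    intro h'
    rw [h'] at h
    simp at h
  | cons p L ihL =>
    obtain ⟨u, g⟩ := p
    have ih := ihL (fun p hp => hL p (List.mem_cons_of_mem _ hp))
    have hu : u ∈ maximalIdeal B := hL (u, g) (List.mem_cons_self)
    intro M _ _ _ hE ⟨k, hk⟩
    obtain ⟨s, hs⟩ := monotone_stabilizes_iff_noetherian.2 (inferInstance : IsNoetherian B M)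
      ⟨fun n => Submodule.torsionBy B M (u ^ n), fun a b hab => Submodule.torsionBy_le_torsionBy_of_dvd _ _ (pow_dvd_pow u hab)⟩
    have hs1 := hs (s + 1) (Nat.le_succ s)
    change Submodule.torsionBy B M (u ^ s) = Submodule.torsionBy B M (u ^ (s + 1)) at hs1
    let A : Submodule B M := Submodule.torsionBy B M (u ^ s)
    have hA := theta_nilp L ih u g s A (fun x => Subtype.ext (hE x))
      ⟨k, hk.trans (sup_le_sup_right (LinearMap.annihilator_le_of_injective A.subtype A.injective_subtype) _)⟩
      (fun x => Subtype.ext ((Submodule.mem_torsionBy_iff _ _).1 x.2))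
    let C := M ⧸ A
    have hEC : ∀ x : C, mfE ((u, g) :: L) • x = 0 := by
      intro x
      obtain ⟨x, rfl⟩ := A.mkQ_surjective x
      rw [← map_smul, hE, map_zero]
    have huC : ∀ x : C, u • x = 0 → x = 0 := by
      intro x hx
      obtain ⟨x, rfl⟩ := A.mkQ_surjective x
      rw [← map_smul, Submodule.mkQ_apply, Submodule.Quotient.mk_eq_zero] at hx
      rw [Submodule.mkQ_apply, Submodule.Quotient.mk_eq_zero]
      have : x ∈ Submodule.torsionBy B M (u ^ (s + 1)) := by
        rw [Submodule.mem_torsionBy_iff, pow_succ, mul_smul]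
        exact (Submodule.mem_torsionBy_iff _ _).1 hx
      rw [← hs1] at this
      exact this
    have hreg : IsSMulRegular C u := by
      intro x y hxy
      rw [← sub_eq_zero]
      apply huC
      rw [smul_sub, sub_eq_zero]
      exact hxy
    let D := QuotSMulTop u C
    let q : C →ₗ[B] D := Submodule.mkQ _
    have hqs : Function.Surjective q := Submodule.mkQ_surjective _
    have hker : ∀ x, q x = 0 ↔ ∃ y, u • y = x := by
      intro x
      rw [Submodule.mkQ_apply, Submodule.Quotient.mk_eq_zero, Submodule.mem_smul_pointwise_iff_exists]
      simp
    have huD : ∀ x : D, u • x = 0 := by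
      intro x
      obtain ⟨x, rfl⟩ := hqs x
      rw [← map_smul, hker]
      exact ⟨x, rfl⟩
    have heD : ∀ x : D, mfE L • x = 0 := by
      intro x
      have : mfE ((u, g) :: L) • x = 0 := by
        obtain ⟨x, rfl⟩ := hqs x
        rw [← map_smul, hEC, map_zero]
      rwa [mfE_cons, add_smul, mul_smul, huD, smul_zero, zero_add] at this
    have hD := ih D heD ⟨k, by
      refine hk.trans (sup_le (le_sup_of_le_left
        ((LinearMap.annihilator_le_of_surjective A.mkQ A.mkQ_surjective).trans
        (LinearMap.annihilator_le_of_surjective q hqs))) ?_)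
      rw [List.map_cons, Ideal.ofList_cons]
      refine sup_le (le_sup_of_le_left ?_) le_sup_right
      rw [Ideal.span_singleton_le_iff_mem, Module.mem_annihilator]
      exact huD⟩
    have sq := mfD_sq C L
    have nt := mfD_nat q L
    have hEC' : ∀ x : C, (g * u + mfE L) • x = 0 := fun x => by rw [← mfE_cons]; exact hEC x
    have c0 : h0 ((u, g) :: L) C = h0 L D :=
      cone_regular q u g (mfE L) _ _ _ _ nt.1 nt.2 sq.1 sq.2 hEC' huC hqs hker
    have c1 : h1 ((u, g) :: L) C = h1 L D :=
      cone_regular q u g (mfE L) _ _ _ _ nt.2 nt.1 sq.2 sq.1 hEC' huC hqs hker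
    obtain ⟨Y, hY0, hY1⟩ := mf_hex ((u, g) :: L) A.subtype A.mkQ A.injective_subtype
      (by rw [LinearMap.exact_iff]; simp) A.mkQ_surjective hE
    have hdim : (((u, g) :: L).length : WithBot ℕ∞) ≤ Module.supportDim B M →
        (L.length : WithBot ℕ∞) ≤ Module.supportDim B D := by
      intro h
      have key : (((u, g) :: L).length : WithBot ℕ∞) ≤ Module.supportDim B C := by
        obtain ⟨l, hl⟩ := Order.le_krullDim_iff.1 h
        have hq0 : u ∉ (l 0).1.asIdeal := by
          intro hu0
          let P := (l 0).1.asIdeal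
          haveI : P.IsPrime := (l 0).1.2
          haveI : IsLocalRing (B ⧸ P) := .of_surjective' (Ideal.Quotient.mk _) Ideal.Quotient.mk_surjective
          have hann : Module.annihilator B M ≤ P := Module.annihilator_le_of_mem_support (l 0).2
          have := dim_le_of_ofList (R := B ⧸ P) ((L.map Prod.fst).map (Ideal.Quotient.mk P)) (by
            intro x hx
            simp only [List.map_map, List.mem_map] at hx
            obtain ⟨p, hp, rfl⟩ := hx
            have := hL p (List.mem_cons_of_mem _ hp)
            rw [← IsLocalRing.map_maximalIdeal_of_surjective (Ideal.Quotient.mk P) Ideal.Quotient.mk_surjective]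
            exact Ideal.mem_map_of_mem _ this) k (by
            rw [← IsLocalRing.map_maximalIdeal_of_surjective (Ideal.Quotient.mk P) Ideal.Quotient.mk_surjective,
              ← Ideal.map_pow, ← Ideal.map_ofList]
            refine (Ideal.map_mono hk).trans ?_
            rw [Ideal.map_sup, List.map_cons, Ideal.ofList_cons, Ideal.map_sup]
            refine sup_le ?_ (sup_le ?_ le_rfl)
            · rw [Ideal.map_le_iff_le_comap]
              intro x hx
              rw [Ideal.mem_comap, Ideal.Quotient.eq_zero_iff_mem.2 (hann hx)]
              exact zero_mem _
            · rw [Ideal.map_span, Set.image_singleton, Ideal.Quotient.eq_zero_iff_mem.2 hu0]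
              simp)
          have h2 : (((u, g) :: L).length : WithBot ℕ∞) ≤ ringKrullDim (B ⧸ P) := by
            rw [ringKrullDim_quotient]
            refine Order.le_krullDim_iff.2 ⟨⟨l.length, fun i => ⟨(l i).1, ?_⟩, fun i => ?_⟩, hl⟩
            · exact l.monotone (Fin.zero_le i)
            · exact l.step i
          have h3 := h2.trans this
          simp only [List.length_cons, List.length_map] at h3
          norm_cast at h3
          omega
        refine Order.le_krullDim_iff.2 ⟨⟨l.length, fun i => ⟨(l i).1, ?_⟩, fun i => l.step i⟩, hl⟩
        have h0C : (l 0).1 ∈ Module.support B C := by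
          rw [Module.mem_support_iff']
          obtain ⟨x, hx⟩ := Module.mem_support_iff'.1 (l 0).2
          refine ⟨A.mkQ x, fun r hr h0 => ?_⟩
          rw [← map_smul, Submodule.mkQ_apply, Submodule.Quotient.mk_eq_zero] at h0
          have h0 := (Submodule.mem_torsionBy_iff _ _).1 h0
          rw [smul_smul] at h0
          refine hx (u ^ s * r) ?_ h0
          intro hmem
          rcases (l 0).1.2.mem_or_mem hmem with h | h
          · exact hq0 ((l 0).1.2.mem_of_pow_mem _ h)
          · exact hr h
        exact Module.mem_support_mono (l.monotone (Fin.zero_le i)) h0C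
      rw [← Module.supportDim_quotSMulTop_succ_eq_supportDim hreg hu] at key
      rw [List.length_cons] at key
      push_cast at key
      exact withBot_enat_cancel key
    rw [c0] at hY0
    rw [c1] at hY1
    have hA0 := hA.1
    have hA2 := hA.2
    have fA1 : h1 ((u, g) :: L) A ≠ ⊤ := by rw [hA2]; exact hA0
    obtain ⟨hD0, hD1, hD2, hD3⟩ := hD
    obtain ⟨f2, fY⟩ := enat_fin hY0 hA0 hD0
    obtain ⟨f3, -⟩ := enat_fin hY1 fA1 hD1
    have hD4 := fun h => hD3 (hdim h)
    clear hD3 hdim c0 c1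
    generalize h0 ((u, g) :: L) M = a at *
    generalize h1 ((u, g) :: L) M = b at *
    generalize h0 ((u, g) :: L) A = a'' at *
    generalize h1 ((u, g) :: L) A = b'' at *
    generalize h0 L D = p at *
    generalize h1 L D = q at *
    lift a to ℕ using f2
    lift b to ℕ using f3
    lift a'' to ℕ using hA0
    lift b'' to ℕ using fA1
    lift p to ℕ using hD0
    lift q to ℕ using hD1
    lift Y to ℕ using fY
    refine ⟨by simp, by simp, ?_, fun h => ?_⟩
    · norm_cast at *
      omega
    · have := hD4 h
      norm_cast at *
      omega

end Theta2

end PartMF4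

section PartMF5

open IsLocalRing

section Exactness
variable {B : Type*} [CommRing B]

theorem mf_ses (L : List (B × B)) (b c d : Ideal B) (x : B) (hc : ∀ y, x * y ∈ b ↔ y ∈ c)
    (hd : d = b ⊔ Ideal.span {x}) (hE : mfE L ∈ b) :
    ∃ X, h0 L (B ⧸ c) + h0 L (B ⧸ d) = h0 L (B ⧸ b) + X ∧
      h1 L (B ⧸ c) + h1 L (B ⧸ d) = h1 L (B ⧸ b) + X := by
  let i : (B ⧸ c) →ₗ[B] (B ⧸ b) := Submodule.mapQ c b (LinearMap.lsmul B B x) (fun y hy => (hc y).2 hy)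
  let q : (B ⧸ b) →ₗ[B] (B ⧸ d) := Submodule.factor (hd ▸ le_sup_left)
  refine mf_hex L i q ?_ ?_ ?_ ?_
  · rw [injective_iff_map_eq_zero]
    intro y hy
    obtain ⟨y, rfl⟩ := Submodule.mkQ_surjective _ y
    change Submodule.Quotient.mk (x * y) = 0 at hy
    rw [Submodule.Quotient.mk_eq_zero] at hy
    rw [Submodule.mkQ_apply, Submodule.Quotient.mk_eq_zero]
    exact (hc y).1 hy
  · intro y
    obtain ⟨y, rfl⟩ := Submodule.mkQ_surjective _ y
    constructor
    · intro h
      change Submodule.Quotient.mk y = 0 at h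
      rw [Submodule.Quotient.mk_eq_zero, hd] at h
      obtain ⟨z, hz, w, hw, rfl⟩ := Submodule.mem_sup.1 h
      obtain ⟨w, rfl⟩ := Ideal.mem_span_singleton'.1 hw
      refine ⟨Submodule.Quotient.mk w, ?_⟩
      change Submodule.Quotient.mk (x * w) = Submodule.Quotient.mk (z + w * x)
      rw [eq_comm, Submodule.Quotient.eq]
      convert hz using 1
      ring
    · rintro ⟨z, hz⟩
      obtain ⟨z, rfl⟩ := Submodule.mkQ_surjective _ z
      rw [← hz]
      change Submodule.Quotient.mk (x * z) = 0
      rw [Submodule.Quotient.mk_eq_zero, hd]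
      exact Ideal.mul_mem_right _ _ (Ideal.mem_sup_right (Ideal.mem_span_singleton_self x))
  · exact Submodule.factor_surjective _
  · intro y
    obtain ⟨y, rfl⟩ := Submodule.mkQ_surjective _ y
    rw [← map_smul, Submodule.mkQ_apply, Submodule.Quotient.mk_eq_zero]
    exact Ideal.mul_mem_right _ _ hE

theorem nak_aux [IsLocalRing B] [IsNoetherianRing B] {M M' : Type*} [AddCommGroup M] [Module B M]
    [AddCommGroup M'] [Module B M'] [Module.Finite B M]
    (q : M →ₗ[B] M') {α β : Type} [Finite α] [Finite β] (x : B) (hx : x ∈ maximalIdeal B)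
    (d0 : (α → M) →ₗ[B] (β → M)) (d1 : (β → M) →ₗ[B] (α → M))
    (d0' : (α → M') →ₗ[B] (β → M')) (d1' : (β → M') →ₗ[B] (α → M'))
    (k0 : ∀ x, q ∘ (d0 x) = d0' (q ∘ x)) (k1 : ∀ x, q ∘ (d1 x) = d1' (q ∘ x))
    (s1 : ∀ x, d0 (d1 x) = 0) (hu : ∀ y : M, x • y = 0 → y = 0)
    (hq : Function.Surjective q) (hker : ∀ z, q z = 0 ↔ ∃ y, x • y = z)
    (h : LinearMap.ker d0' ≤ LinearMap.range d1') : LinearMap.ker d0 ≤ LinearMap.range d1 := by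
  refine Submodule.le_of_le_smul_of_le_jacobson_bot (I := maximalIdeal B) (IsNoetherian.noetherian _)
    (IsLocalRing.maximalIdeal_le_jacobson _) ?_
  intro z hz
  have hz : d0 z = 0 := hz
  have hz' : d0' (q ∘ z) = 0 := by rw [← k0, hz]; funext i; simp
  obtain ⟨w, hw⟩ := h hz'
  obtain ⟨w, rfl⟩ := hq.comp_left w
  simp only at hw
  rw [← k1] at hw
  have : ∀ i, ∃ y, x • y = z i - d1 w i := fun i => (hker _).1 (by
    rw [map_sub, sub_eq_zero]; exact (congrFun hw i).symm)
  choose y hy using this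
  have hy' : x • y = z - d1 w := funext hy
  have hz2 : z = d1 w + x • y := by rw [hy']; abel
  rw [hz2]
  refine Submodule.add_mem_sup ⟨w, rfl⟩ (Submodule.smul_mem_smul hx ?_)
  change d0 y = 0
  have h2 : x • d0 y = 0 := by rw [← map_smul, hy', map_sub, hz, s1, sub_zero]
  funext i
  exact hu _ (congrFun h2 i)

theorem mf_nak [IsLocalRing B] [IsNoetherianRing B] (L : List (B × B)) (b d : Ideal B) (x : B)
    (hx : x ∈ maximalIdeal B) (hb : ∀ y, x * y ∈ b → y ∈ b)
    (hd : d = b ⊔ Ideal.span {x}) (hE : mfE L ∈ b) (e0 : h0 L (B ⧸ d) = 0) (e1 : h1 L (B ⧸ d) = 0) :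
    h0 L (B ⧸ b) = 0 ∧ h1 L (B ⧸ b) = 0 := by
  let q : (B ⧸ b) →ₗ[B] (B ⧸ d) := Submodule.factor (hd ▸ le_sup_left)
  have hq : Function.Surjective q := Submodule.factor_surjective _
  have hEb : ∀ y : B ⧸ b, mfE L • y = 0 := by
    intro y
    obtain ⟨y, rfl⟩ := Submodule.mkQ_surjective _ y
    rw [← map_smul, Submodule.mkQ_apply, Submodule.Quotient.mk_eq_zero]
    exact Ideal.mul_mem_right _ _ hE
  have hEb' : ∀ {γ : Type} (y : γ → B ⧸ b), mfE L • y = 0 := fun y => funext fun i => hEb _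
  have hu : ∀ y : B ⧸ b, x • y = 0 → y = 0 := by
    intro y hy
    obtain ⟨y, rfl⟩ := Submodule.mkQ_surjective _ y
    rw [← map_smul, Submodule.mkQ_apply, Submodule.Quotient.mk_eq_zero] at hy
    rw [Submodule.mkQ_apply, Submodule.Quotient.mk_eq_zero]
    exact hb y hy
  have hker : ∀ z, q z = 0 ↔ ∃ y, x • y = z := by
    intro y
    obtain ⟨y, rfl⟩ := Submodule.mkQ_surjective _ y
    constructor
    · intro h
      change Submodule.Quotient.mk y = 0 at h
      rw [Submodule.Quotient.mk_eq_zero, hd] at h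
      obtain ⟨z, hz, w, hw, rfl⟩ := Submodule.mem_sup.1 h
      obtain ⟨w, rfl⟩ := Ideal.mem_span_singleton'.1 hw
      refine ⟨Submodule.Quotient.mk w, ?_⟩
      change Submodule.Quotient.mk (x * w) = Submodule.Quotient.mk (z + w * x)
      rw [eq_comm, Submodule.Quotient.eq]
      convert hz using 1
      ring
    · rintro ⟨z, hz⟩
      obtain ⟨z, rfl⟩ := Submodule.mkQ_surjective _ z
      rw [← hz]
      change Submodule.Quotient.mk (x * z) = 0
      rw [Submodule.Quotient.mk_eq_zero, hd]
      exact Ideal.mul_mem_right _ _ (Ideal.mem_sup_right (Ideal.mem_span_singleton_self x))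
  have nt := mfD_nat q L
  have sq := mfD_sq (B ⧸ b) L
  rw [h0, hl, rl_zero_iff] at e0
  rw [h1, hl, rl_zero_iff] at e1
  rw [h0, h1, hl, hl, rl_zero_iff, rl_zero_iff]
  exact ⟨nak_aux q x hx _ _ _ _ nt.1 nt.2 (fun y => by rw [sq.2, hEb']) hu hq hker e0,
    nak_aux q x hx _ _ _ _ nt.2 nt.1 (fun y => by rw [sq.1, hEb']) hu hq hker e1⟩

theorem flat_colon {T : Type*} [CommRing T] [Algebra T B] [Module.Flat T B] (a c : Ideal T) (x : T)
    (hc : ∀ y, x * y ∈ a → y ∈ c) (y : B) (hy : algebraMap T B x * y ∈ a.map (algebraMap T B)) :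
    y ∈ c.map (algebraMap T B) := by
  have hy' : algebraMap T B x * y ∈ Submodule.span B (algebraMap T B '' (a : Set T)) := hy
  rw [Finsupp.mem_span_image_iff_linearCombination] at hy'
  obtain ⟨l, hl, hly⟩ := hy'
  let f : Option l.support → T := fun o => o.elim x (fun i => - i.1)
  let z : Option l.support → B := fun o => o.elim y (fun i => l i.1)
  have hrel : ∑ i, f i • z i = 0 := by
    rw [Fintype.sum_option]
    simp only [f, z, Option.elim, neg_smul, Finset.sum_neg_distrib]
    rw [Algebra.smul_def, ← hly, Finsupp.linearCombination_apply, Finsupp.sum]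
    rw [Finset.sum_coe_sort l.support (fun i => i • l i), add_neg_eq_zero]
    refine Finset.sum_congr rfl fun i _ => ?_
    rw [smul_eq_mul, Algebra.smul_def, mul_comm]
  obtain ⟨k, c', w, h1, h2⟩ := Module.Flat.isTrivialRelation_of_sum_smul_eq_zero (R := T) (M := B) (f := f) (x := z) hrel
  have h3 := h1 none
  have h4 : y = ∑ j, c' none j • w j := h3
  rw [h4]
  refine Ideal.sum_mem _ fun j _ => ?_
  rw [Algebra.smul_def]
  refine Ideal.mul_mem_right _ _ (Ideal.mem_map_of_mem _ (hc _ ?_))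
  have h5 := h2 j
  rw [Fintype.sum_option] at h5
  simp only [f, Option.elim] at h5
  rw [eq_neg_of_add_eq_zero_left h5]
  refine neg_mem (Ideal.sum_mem _ fun i _ => ?_)
  exact Ideal.mul_mem_right _ _ (neg_mem (hl i.2))

theorem mf_exact {T : Type*} [CommRing T] [IsLocalRing T] [IsNoetherianRing T] [IsLocalRing B]
    [IsNoetherianRing B] [Algebra T B] [Module.Flat T B]
    (hloc : (maximalIdeal T).map (algebraMap T B) ≤ maximalIdeal B)
    (L : List (B × B)) (E : T) (hEL : mfE L = algebraMap T B E)
    (b0 : h0 L (B ⧸ (maximalIdeal T).map (algebraMap T B)) = 0)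
    (b1 : h1 L (B ⧸ (maximalIdeal T).map (algebraMap T B)) = 0) (a : Ideal T) :
    a ≠ ⊤ → E ∈ a → h0 L (B ⧸ Ideal.map (algebraMap T B) a) = 0 ∧ h1 L (B ⧸ Ideal.map (algebraMap T B) a) = 0 := by
  induction a using IsNoetherian.induction with
  | hgt a IH =>
  intro ha hE
  by_cases ham : a = maximalIdeal T
  · subst ham; exact ⟨b0, b1⟩
  have hEa : mfE L ∈ Ideal.map (algebraMap T B) a := by rw [hEL]; exact Ideal.mem_map_of_mem _ hE
  have hmap : ∀ x, Ideal.map (algebraMap T B) (a ⊔ Ideal.span {x}) =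
      Ideal.map (algebraMap T B) a ⊔ Ideal.span {algebraMap T B x} := by
    intro x
    rw [Ideal.map_sup, Ideal.map_span, Set.image_singleton]
  by_cases hp : Ideal.IsPrime a
  · obtain ⟨x, hxm, hxa⟩ := SetLike.exists_of_lt (lt_of_le_of_ne (le_maximalIdeal ha) ham)
    have hgt : a < a ⊔ Ideal.span {x} := by
      refine lt_of_le_of_ne le_sup_left fun h => hxa ?_
      rw [h]; exact Ideal.mem_sup_right (Ideal.mem_span_singleton_self x)
    have hne : a ⊔ Ideal.span {x} ≠ ⊤ := fun h => (maximalIdeal.isMaximal T).ne_top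
      (top_le_iff.1 (h ▸ sup_le (le_maximalIdeal ha) ((Ideal.span_singleton_le_iff_mem _).2 hxm)))
    obtain ⟨e0, e1⟩ := IH _ hgt hne (Ideal.mem_sup_left hE)
    exact mf_nak L _ _ (algebraMap T B x) (hloc (Ideal.mem_map_of_mem _ hxm))
      (fun y hy => flat_colon a a x (fun y hy => (hp.mem_or_mem hy).resolve_left hxa) y hy)
      (hmap x) hEa e0 e1
  · have : ∃ x y, x * y ∈ a ∧ x ∉ a ∧ y ∉ a := by
      by_contra! hcon
      exact hp ⟨ha, fun {x y} hxy => or_iff_not_imp_left.2 (hcon x y hxy)⟩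
    obtain ⟨x, y, hxy, hxa, hya⟩ := this
    have hxm : x ∈ maximalIdeal T := by
      rw [mem_maximalIdeal]
      intro hu
      exact hya ((Ideal.unit_mul_mem_iff_mem _ hu).1 hxy)
    have hgt : a < a ⊔ Ideal.span {x} := by
      refine lt_of_le_of_ne le_sup_left fun h => hxa ?_
      rw [h]; exact Ideal.mem_sup_right (Ideal.mem_span_singleton_self x)
    have hne : a ⊔ Ideal.span {x} ≠ ⊤ := fun h => (maximalIdeal.isMaximal T).ne_top
      (top_le_iff.1 (h ▸ sup_le (le_maximalIdeal ha) ((Ideal.span_singleton_le_iff_mem _).2 hxm)))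
    obtain ⟨e0, e1⟩ := IH _ hgt hne (Ideal.mem_sup_left hE)
    let c : Ideal T := Submodule.comap (LinearMap.lsmul T T x) a
    have hcm : ∀ z, z ∈ c ↔ x * z ∈ a := fun z => Iff.rfl
    have hac : a ≤ c := fun z hz => Ideal.mul_mem_left _ _ hz
    have hgt2 : a < c := lt_of_le_of_ne hac fun h => hya (h ▸ (hcm y).2 hxy)
    have hne2 : c ≠ ⊤ := fun h => hxa (by
      have : (1 : T) ∈ c := h ▸ trivial
      simpa using (hcm 1).1 this)
    obtain ⟨g0, g1⟩ := IH _ hgt2 hne2 (hac hE)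
    obtain ⟨X, hX0, hX1⟩ := mf_ses L (Ideal.map (algebraMap T B) a) (Ideal.map (algebraMap T B) c) _
      (algebraMap T B x) (fun y => ⟨fun hy => flat_colon a c x (fun z hz => hz) y hy, fun hy => by
        have : Ideal.map (algebraMap T B) c ≤ Submodule.comap (LinearMap.lsmul B B (algebraMap T B x)) (Ideal.map (algebraMap T B) a) := by
          rw [Ideal.map_le_iff_le_comap]
          intro z hz
          change algebraMap T B x * algebraMap T B z ∈ Ideal.map (algebraMap T B) a
          rw [← map_mul]
          exact Ideal.mem_map_of_mem _ hz
        exact this hy⟩) (hmap x) hEa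
    rw [g0, e0] at hX0
    rw [g1, e1] at hX1
    have A0 := hX0.symm
    have A1 := hX1.symm
    simp only [add_zero, add_eq_zero] at A0 A1
    exact ⟨A0.1, A1.1⟩
end Exactness

end PartMF5

section PartFL

open IsLocalRing

theorem triv_of_span {T B : Type*} [CommRing T] [CommRing B] [Algebra T B] {l : ℕ} (f : Fin l → T)
    (x : Fin l → B) (hx : x ∈ Submodule.span B {v : Fin l → B | ∃ a : Fin l → T,
      ∑ i, f i * a i = 0 ∧ v = fun i => algebraMap T B (a i)}) : Module.IsTrivialRelation f x := by
  obtain ⟨n, c, g, hg⟩ := Submodule.mem_span_set'.1 hx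
  choose a ha hga using fun i => (g i).2
  refine ⟨n, fun i j => a j i, c, fun i => ?_, fun j => ha j⟩
  rw [← hg, Finset.sum_apply]
  refine Finset.sum_congr rfl fun j _ => ?_
  rw [Pi.smul_apply, hga, smul_eq_mul, Algebra.smul_def, mul_comm]

theorem mem_of_pow_closed {B M : Type*} [CommRing B] [IsNoetherianRing B] [AddCommGroup M] [Module B M]
    [Module.Finite B M] (J : Ideal B) (hJ : J ≤ Ideal.jacobson ⊥) (K : Submodule B M) (x : M)
    (hx : ∀ t : ℕ, ∃ y ∈ K, x - y ∈ J ^ t • (⊤ : Submodule B M)) : x ∈ K := by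
  rw [← Submodule.Quotient.mk_eq_zero]
  have h := Ideal.iInf_pow_smul_eq_bot_of_le_jacobson (M := M ⧸ K) J hJ
  rw [← Submodule.mem_bot B, ← h, Submodule.mem_iInf]
  intro t
  obtain ⟨y, hy, hxy⟩ := hx t
  have h1 : (Submodule.Quotient.mk x : M ⧸ K) = K.mkQ (x - y) := by
    rw [map_sub, Submodule.mkQ_apply, Submodule.mkQ_apply, (Submodule.Quotient.mk_eq_zero K (x := y)).2 hy, sub_zero]
  rw [h1]
  have h2 := Submodule.mem_map_of_mem (f := K.mkQ) hxy
  rw [Submodule.map_smul''] at h2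
  exact Submodule.smul_mono le_rfl le_top h2

theorem artin_rees_fin {T : Type*} [CommRing T] [IsNoetherianRing T] (b : Ideal T) {l : ℕ} (f : Fin l → T)
    (t : ℕ) : ∃ s ≥ t, ∀ a : Fin l → T, ∑ i, f i * a i ∈ b ^ s → ∃ e : Fin l → T, (∀ i, e i ∈ b ^ t) ∧
      ∑ i, f i * a i = ∑ i, f i * e i := by
  obtain ⟨k, hk⟩ := Ideal.exists_pow_inf_eq_pow_smul b (Ideal.span (Set.range f) : Submodule T T)
  refine ⟨t + k, by omega, fun a ha => ?_⟩
  have h1 := hk (t + k) (by omega)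
  have h2 : ∑ i, f i * a i ∈ b ^ (t+k) • (⊤ : Submodule T T) ⊓ Ideal.span (Set.range f) := by
    refine ⟨by simpa using ha, Ideal.sum_mem _ fun i _ => Ideal.mul_mem_right _ _ (Ideal.subset_span ⟨i, rfl⟩)⟩
  rw [h1, Nat.add_sub_cancel] at h2
  have h3 : ∑ i, f i * a i ∈ b ^ t • Submodule.span T (Set.range f) :=
    Submodule.smul_mono le_rfl inf_le_right h2
  rw [Submodule.mem_ideal_smul_span_iff_exists_sum] at h3
  obtain ⟨c, hc, hs⟩ := h3
  refine ⟨c, hc, ?_⟩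
  rw [← hs, Finsupp.sum_fintype _ _ (by simp)]
  exact Finset.sum_congr rfl fun i _ => by rw [smul_eq_mul, mul_comm]

theorem flat_dense {P Q T B : Type*} [CommRing P] [CommRing Q] [CommRing T] [CommRing B]
    [Algebra P Q] [Module.Flat P Q] [Algebra T B] [IsNoetherianRing T] [IsNoetherianRing B]
    (φ : P →+* T) (ψ : Q →+* B) (hcomm : ∀ p, ψ (algebraMap P Q p) = algebraMap T B (φ p))
    (b : Ideal T) (c : Ideal P) (hcb : c.map φ ≤ b)
    (hjac : b.map (algebraMap T B) ≤ Ideal.jacobson ⊥)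
    (hT : ∀ (s : ℕ) (x : T), ∃ p, x - φ p ∈ b ^ s)
    (hB : ∀ (s : ℕ) (y : B), ∃ q, y - ψ q ∈ (b ^ s).map (algebraMap T B))
    (hQ : ∀ (s : ℕ) (q : Q), ψ q ∈ (b ^ s).map (algebraMap T B) → q ∈ (c ^ s).map (algebraMap P Q)) :
    Module.Flat T B := by
  rw [Module.Flat.iff_forall_isTrivialRelation]
  intro l f x hfx
  apply triv_of_span
  refine mem_of_pow_closed _ hjac _ _ fun t => ?_
  obtain ⟨s, hst, hs⟩ := artin_rees_fin b f t
  choose p hp using fun i => hT s (f i)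
  choose q hq using fun i => hB s (x i)
  have h1 : ψ (∑ i, p i • q i) ∈ (b ^ s).map (algebraMap T B) := by
    have : ψ (∑ i, p i • q i) = - ∑ i, ((algebraMap T B (f i - φ (p i))) * x i +
        algebraMap T B (φ (p i)) * (x i - ψ (q i))) := by
      rw [← sub_eq_zero, sub_neg_eq_add, map_sum, ← Finset.sum_add_distrib, ← hfx]
      refine Finset.sum_congr rfl fun i _ => ?_
      rw [Algebra.smul_def, map_mul, hcomm, map_sub, Algebra.smul_def]
      ring
    rw [this]
    exact neg_mem (Ideal.sum_mem _ fun i _ => add_mem (Ideal.mul_mem_right _ _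
      (Ideal.mem_map_of_mem _ (hp i))) (Ideal.mul_mem_left _ _ (hq i)))
  have h2 := hQ s _ h1
  have h3 : ∑ i, p i • q i ∈ Submodule.span Q (algebraMap P Q '' ((c ^ s : Ideal P) : Set P)) := h2
  rw [Finsupp.mem_span_image_iff_linearCombination] at h3
  obtain ⟨m, hm, hmy⟩ := h3
  let F : Fin l ⊕ m.support → P := Sum.elim p (fun i => - i.1)
  let Z : Fin l ⊕ m.support → Q := Sum.elim q (fun i => m i.1)
  have hrel : ∑ i, F i • Z i = 0 := by
    rw [Fintype.sum_sum_type]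
    simp only [F, Z, Sum.elim_inl, Sum.elim_inr, neg_smul, Finset.sum_neg_distrib]
    rw [← hmy, Finsupp.linearCombination_apply, Finsupp.sum]
    rw [Finset.sum_coe_sort m.support (fun i => i • m i), add_neg_eq_zero]
    refine Finset.sum_congr rfl fun i _ => ?_
    rw [smul_eq_mul, Algebra.smul_def, mul_comm]
  obtain ⟨k, c', w, e1, e2⟩ := Module.Flat.isTrivialRelation_of_sum_smul_eq_zero (R := P) (M := Q) (f := F) (x := Z) hrel
  have h4 : ∀ j, ∑ i, p i * c' (Sum.inl i) j ∈ c ^ s := by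
    intro j
    have h5 := e2 j
    rw [Fintype.sum_sum_type] at h5
    rw [show ∑ i, p i * c' (Sum.inl i) j = ∑ i, F (Sum.inl i) * c' (Sum.inl i) j from rfl, eq_neg_of_add_eq_zero_left h5]
    exact neg_mem (Ideal.sum_mem _ fun i _ => Ideal.mul_mem_right _ _ (neg_mem (hm i.2)))
  have h5 : ∀ j, ∃ e : Fin l → T, (∀ i, e i ∈ b ^ t) ∧
      ∑ i, f i * (φ (c' (Sum.inl i) j)) = ∑ i, f i * e i := by
    intro j
    apply hs
    have : ∑ i, f i * φ (c' (Sum.inl i) j) = ∑ i, (f i - φ (p i)) * φ (c' (Sum.inl i) j) +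
        φ (∑ i, p i * c' (Sum.inl i) j) := by
      rw [map_sum, ← Finset.sum_add_distrib]
      refine Finset.sum_congr rfl fun i _ => ?_
      rw [map_mul]; ring
    rw [this]
    refine add_mem (Ideal.sum_mem _ fun i _ => Ideal.mul_mem_right _ _ (hp i)) ?_
    have h6 := Ideal.mem_map_of_mem φ (h4 j)
    rw [Ideal.map_pow] at h6
    exact Ideal.pow_right_mono hcb s h6
  choose e he hse using h5
  refine ⟨∑ j, ψ (w j) • (fun i => algebraMap T B (φ (c' (Sum.inl i) j) - e j i)), ?_, ?_⟩
  · refine Submodule.sum_mem _ fun j _ => Submodule.smul_mem _ _ (Submodule.subset_span ⟨_, ?_, rfl⟩)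
    simp only [mul_sub, Finset.sum_sub_distrib]
    rw [hse, sub_self]
  · rw [← Ideal.map_pow]
    have h7 : ∀ v : Fin l → B, (∀ i, v i ∈ (b ^ t).map (algebraMap T B)) →
        v ∈ (b ^ t).map (algebraMap T B) • (⊤ : Submodule B (Fin l → B)) := by
      intro v hv
      rw [pi_eq_sum_univ v]
      exact Submodule.sum_mem _ fun i _ => Submodule.smul_mem_smul (hv i) trivial
    apply h7
    intro i
    have h8 : q i = ∑ j, c' (Sum.inl i) j • w j := e1 (Sum.inl i)
    rw [Pi.sub_apply, Finset.sum_apply]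
    have h9 : x i - ∑ j, (ψ (w j) • (fun i => algebraMap T B (φ (c' (Sum.inl i) j) - e j i))) i =
      (x i - ψ (q i)) + ∑ j, ψ (w j) * algebraMap T B (e j i) := by
      rw [h8, map_sum, sub_add, sub_right_inj, ← Finset.sum_sub_distrib]
      refine Finset.sum_congr rfl fun j _ => ?_
      rw [Pi.smul_apply, smul_eq_mul, map_sub, Algebra.smul_def, map_mul, hcomm]
      ring
    rw [h9]
    exact add_mem (Ideal.map_mono (Ideal.pow_le_pow_right hst) (hq i)) (Ideal.sum_mem _ fun j _ =>
      Ideal.mul_mem_left _ _ (Ideal.mem_map_of_mem _ (he j i)))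

end PartFL

section PartPS

open IsLocalRing

section PS
variable {σ : Type*} [Finite σ] {R : Type*} [CommRing R]

theorem mvps_map_vars : (MvPolynomial.idealOfVars σ R).map (algebraMap (MvPolynomial σ R) (MvPowerSeries σ R)) =
    Ideal.span (Set.range MvPowerSeries.X) := by
  rw [MvPolynomial.idealOfVars, Ideal.map_span, ← Set.range_comp]
  congr 2
  ext1 i
  rw [Function.comp_apply, MvPowerSeries.algebraMap_apply']
  simp

theorem mvps_mem_pow (f : MvPowerSeries σ R) (s : ℕ) :
    f ∈ (Ideal.span (Set.range MvPowerSeries.X) : Ideal (MvPowerSeries σ R)) ^ s ↔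
      ∀ x : σ →₀ ℕ, x.degree < s → MvPowerSeries.coeff x f = 0 := by
  set I := MvPolynomial.idealOfVars σ R with hI
  let e := (MvPowerSeries.toAdicCompletionAlgEquiv σ R).toLinearEquiv
  have h1 : f ∈ (Ideal.span (Set.range MvPowerSeries.X) : Ideal (MvPowerSeries σ R)) ^ s ↔
      f ∈ I ^ s • (⊤ : Submodule (MvPolynomial σ R) (MvPowerSeries σ R)) := by
    rw [← mvps_map_vars, ← Ideal.map_pow, Ideal.smul_top_eq_map]
    rfl
  have h2 : f ∈ I ^ s • (⊤ : Submodule (MvPolynomial σ R) (MvPowerSeries σ R)) ↔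
      e f ∈ I ^ s • (⊤ : Submodule (MvPolynomial σ R) (AdicCompletion I (MvPolynomial σ R))) := by
    have : I ^ s • (⊤ : Submodule (MvPolynomial σ R) (AdicCompletion I (MvPolynomial σ R))) =
      Submodule.map e.toLinearMap (I ^ s • (⊤ : Submodule (MvPolynomial σ R) (MvPowerSeries σ R))) := by
      rw [Submodule.map_smul'', Submodule.map_top, LinearMap.range_eq_top.2 e.surjective]
    rw [this]
    constructor
    · exact fun h => Submodule.mem_map_of_mem h
    · rintro ⟨y, hy, hye⟩
      rwa [← e.injective hye]
  rw [h1, h2, AdicCompletion.pow_smul_top_eq_ker_eval (MvPolynomial.idealOfVars_fg σ R), LinearMap.mem_ker]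
  change (MvPowerSeries.toAdicCompletion σ R f).val s = 0 ↔ _
  rw [MvPowerSeries.toAdicCompletion_apply_eq_mk_truncTotal]
  have h3 : ∀ p : MvPolynomial σ R, ((Ideal.Quotient.mk (I ^ s • (⊤ : Ideal (MvPolynomial σ R))) p) = 0 ↔ p ∈ I ^ s) := by
    intro p
    rw [Ideal.Quotient.eq_zero_iff_mem, smul_eq_mul, Ideal.mul_top]
  refine (h3 _).trans ?_
  rw [MvPolynomial.mem_pow_idealOfVars_iff']
  refine forall_congr' fun x => forall_congr' fun hx => ?_
  rw [MvPowerSeries.coeff_truncTotal _ hx]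

theorem mvps_trunc (f : MvPowerSeries σ R) (s : ℕ) :
    f - (MvPowerSeries.truncTotal s f : MvPolynomial σ R) ∈
      (Ideal.span (Set.range MvPowerSeries.X) : Ideal (MvPowerSeries σ R)) ^ s := by
  rw [mvps_mem_pow]
  intro x hx
  rw [map_sub, MvPolynomial.coeff_coe, MvPowerSeries.coeff_truncTotal _ hx, sub_self]

theorem mvps_coe_mem_pow (f : MvPolynomial σ R) (s : ℕ) (h : (f : MvPowerSeries σ R) ∈
    (Ideal.span (Set.range MvPowerSeries.X) : Ideal (MvPowerSeries σ R)) ^ s) :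
    f ∈ MvPolynomial.idealOfVars σ R ^ s := by
  rw [MvPolynomial.mem_pow_idealOfVars_iff']
  rw [mvps_mem_pow] at h
  intro x hx
  rw [← MvPolynomial.coeff_coe]
  exact h x hx

theorem mvps_ker_const (f : MvPowerSeries σ R) (h : MvPowerSeries.constantCoeff f = 0) :
    f ∈ (Ideal.span (Set.range MvPowerSeries.X) : Ideal (MvPowerSeries σ R)) := by
  rw [← pow_one (Ideal.span _), mvps_mem_pow]
  intro x hx
  rw [Nat.lt_one_iff, Finsupp.degree_eq_zero_iff] at hx
  rw [hx]; exact h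

theorem mvps_mem_max [IsLocalRing R] (f : MvPowerSeries σ R) :
    f ∈ maximalIdeal (MvPowerSeries σ R) ↔ MvPowerSeries.constantCoeff f ∈ maximalIdeal R := by
  rw [mem_maximalIdeal, mem_maximalIdeal, mem_nonunits_iff, mem_nonunits_iff, not_iff_not]
  exact MvPowerSeries.isUnit_iff_constantCoeff

theorem mvps_max [IsLocalRing R] : maximalIdeal (MvPowerSeries σ R) =
    (maximalIdeal R).map (MvPowerSeries.C) ⊔ Ideal.span (Set.range MvPowerSeries.X) := by
  apply le_antisymm
  · intro f hf
    rw [mvps_mem_max] at hf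
    rw [← add_sub_cancel (MvPowerSeries.C (MvPowerSeries.constantCoeff f)) f]
    exact add_mem (Ideal.mem_sup_left (Ideal.mem_map_of_mem _ hf))
      (Ideal.mem_sup_right (mvps_ker_const _ (by simp)))
  · refine sup_le (Ideal.map_le_iff_le_comap.2 fun x hx => ?_) (Ideal.span_le.2 ?_)
    · rw [Ideal.mem_comap, mvps_mem_max]; simpa using hx
    · rintro _ ⟨i, rfl⟩
      rw [SetLike.mem_coe, mvps_mem_max]; simp
end PS

theorem mvps_flat {σ : Type*} [Finite σ] {R A : Type*} [CommRing R] [CommRing A] [Algebra R A]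
    [Module.Flat R A] [IsNoetherianRing R] [IsNoetherianRing A] [IsLocalRing A] :
    Module.Flat (MvPowerSeries σ R) (MvPowerSeries σ A) := by
  letI : Algebra (MvPolynomial σ R) (MvPolynomial σ A) := MvPolynomial.algebraMvPolynomial
  have hfl : Module.Flat (MvPolynomial σ R) (MvPolynomial σ A) := Module.Flat.isBaseChange R (MvPolynomial σ R) A (MvPolynomial σ A)
      (Algebra.IsPushout.out (S := MvPolynomial σ R) (R' := A) (R := R))
  have hX : ∀ s, ((Ideal.span (Set.range MvPowerSeries.X) : Ideal (MvPowerSeries σ R)) ^ s).map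
      (algebraMap (MvPowerSeries σ R) (MvPowerSeries σ A)) = (Ideal.span (Set.range MvPowerSeries.X)) ^ s := by
    intro s
    rw [Ideal.map_pow, Ideal.map_span, ← Set.range_comp]
    congr 3
    ext1 i
    rw [Function.comp_apply, MvPowerSeries.algebraMap_apply'', MvPowerSeries.map_X]
  refine flat_dense (P := MvPolynomial σ R) (Q := MvPolynomial σ A) 
    (MvPolynomial.coeToMvPowerSeries.ringHom) (MvPolynomial.coeToMvPowerSeries.ringHom) ?_ 
    (Ideal.span (Set.range MvPowerSeries.X)) (MvPolynomial.idealOfVars σ R) ?_ ?_ ?_ ?_ ?_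
  · intro p
    ext x
    simp [RingHom.algebraMap_toAlgebra, MvPowerSeries.algebraMap_apply'']
    rfl
  · exact (mvps_map_vars (σ := σ) (R := R)).le
  · have := hX 1
    rw [pow_one, pow_one] at this
    rw [this]
    refine le_trans ?_ (maximalIdeal_le_jacobson _)
    rw [mvps_max]; exact le_sup_right
  · intro s x
    exact ⟨_, mvps_trunc x s⟩
  · intro s x
    rw [hX]
    exact ⟨_, mvps_trunc x s⟩
  · intro s q hq
    rw [hX] at hq
    have := mvps_coe_mem_pow q s hq
    have h2 : (MvPolynomial.idealOfVars σ R).map (algebraMap (MvPolynomial σ R) (MvPolynomial σ A)) = MvPolynomial.idealOfVars σ A := by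
      rw [MvPolynomial.idealOfVars, Ideal.map_span, ← Set.range_comp]
      congr 2
      ext1 i
      simp [RingHom.algebraMap_toAlgebra]
    rwa [Ideal.map_pow, h2]

end PartPS

section PartFD

open IsLocalRing

theorem flat_dim {T B : Type*} [CommRing T] [IsLocalRing T] [IsNoetherianRing T] [CommRing B]
    [IsLocalRing B] [IsNoetherianRing B] [Algebra T B] [Algebra.HasGoingDown T B]
    (hloc : (maximalIdeal T).map (algebraMap T B) ≤ maximalIdeal B) :
    ringKrullDim B = ringKrullDim T + ringKrullDim (B ⧸ (maximalIdeal T).map (algebraMap T B)) := by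
  have hlo : (maximalIdeal B).LiesOver (maximalIdeal T) := by
    constructor
    refine (Ideal.IsMaximal.eq_of_le (maximalIdeal.isMaximal T) ?_ ?_)
    · exact (Ideal.IsPrime.under T (maximalIdeal B)).ne_top
    · exact Ideal.map_le_iff_le_comap.1 hloc
  have h := Ideal.height_eq_height_add_of_liesOver_of_hasGoingDown (maximalIdeal T) (maximalIdeal B)
  haveI : Nontrivial (B ⧸ (maximalIdeal T).map (algebraMap T B)) :=
    Ideal.Quotient.nontrivial_iff.2 (fun h => (maximalIdeal.isMaximal B).ne_top (top_le_iff.1 (h ▸ hloc)))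
  haveI : IsLocalRing (B ⧸ (maximalIdeal T).map (algebraMap T B)) :=
    .of_surjective' _ Ideal.Quotient.mk_surjective
  have e : (maximalIdeal B).map (Ideal.Quotient.mk ((maximalIdeal T).map (algebraMap T B))) =
    maximalIdeal _ := IsLocalRing.map_maximalIdeal_of_surjective _ Ideal.Quotient.mk_surjective
  rw [e] at h
  rw [← maximalIdeal_height_eq_ringKrullDim, ← maximalIdeal_height_eq_ringKrullDim,
    ← maximalIdeal_height_eq_ringKrullDim, h]
  rfl

theorem goingDown_quot {T B : Type*} [CommRing T] [CommRing B] [Algebra T B] [Algebra.HasGoingDown T B]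
    (Q : Ideal T) : Algebra.HasGoingDown (T ⧸ Q) (B ⧸ Q.map (algebraMap T B)) := by
  constructor
  intro p hp P hP hlt
  let qT := Ideal.Quotient.mk Q
  let qB := Ideal.Quotient.mk (Q.map (algebraMap T B))
  have hcomm : ∀ x, algebraMap (T ⧸ Q) (B ⧸ Q.map (algebraMap T B)) (qT x) = qB (algebraMap T B x) := fun x => rfl
  haveI : (p.comap qT).IsPrime := Ideal.comap_isPrime _ _
  haveI : (P.comap qB).IsPrime := Ideal.comap_isPrime _ _
  have h1 : p.comap qT < (P.comap qB).under T := by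
    have : (P.comap qB).under T = (P.under (T ⧸ Q)).comap qT := rfl
    rw [this]
    exact lt_of_le_not_ge (Ideal.comap_mono hlt.le) fun h => hlt.not_ge
      ((Ideal.comap_le_comap_iff_of_surjective _ Ideal.Quotient.mk_surjective _ _).1 h)
  obtain ⟨P1, hle, hP1, hlo⟩ := Algebra.HasGoingDown.exists_ideal_le_liesOver_of_lt _ h1
  have hQP : Q.map (algebraMap T B) ≤ P1 := by
    rw [Ideal.map_le_iff_le_comap]
    have := hlo.over
    intro x hx
    have h2 : x ∈ p.comap qT := by
      rw [Ideal.mem_comap, Ideal.Quotient.eq_zero_iff_mem.2 hx]; exact zero_mem _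
    rw [this] at h2
    exact h2
  have hker : RingHom.ker qB ≤ P1 := by rw [Ideal.mk_ker]; exact hQP
  have hcm : (P1.map qB).comap qB = P1 := by
    rw [Ideal.comap_map_of_surjective _ Ideal.Quotient.mk_surjective]
    exact sup_eq_left.2 hker
  refine ⟨P1.map qB, ?_, Ideal.map_isPrime_of_surjective Ideal.Quotient.mk_surjective hker, ⟨?_⟩⟩
  · exact Ideal.map_le_iff_le_comap.2 hle
  · ext x
    obtain ⟨x, rfl⟩ := Ideal.Quotient.mk_surjective x
    have e := hlo.over
    have h3 : qT x ∈ p ↔ x ∈ P1.under T := by rw [← e]; rfl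
    rw [h3]
    have h4 : qT x ∈ (P1.map qB).under (T ⧸ Q) ↔ algebraMap T B x ∈ (P1.map qB).comap qB := Iff.rfl
    rw [h4, hcm]; rfl

theorem flat_dim_quot {T B : Type*} [CommRing T] [IsLocalRing T] [IsNoetherianRing T] [CommRing B]
    [IsLocalRing B] [IsNoetherianRing B] [Algebra T B] [Module.Flat T B]
    (hloc : (maximalIdeal T).map (algebraMap T B) ≤ maximalIdeal B) (Q : Ideal T) (hQ : Q ≠ ⊤) :
    ringKrullDim (B ⧸ Q.map (algebraMap T B)) =
      ringKrullDim (T ⧸ Q) + ringKrullDim (B ⧸ (maximalIdeal T).map (algebraMap T B)) := by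
  have hQB : Q.map (algebraMap T B) ≤ maximalIdeal B := le_trans (Ideal.map_mono (le_maximalIdeal hQ)) hloc
  haveI : Nontrivial (T ⧸ Q) := Ideal.Quotient.nontrivial_iff.2 hQ
  haveI : Nontrivial (B ⧸ Q.map (algebraMap T B)) := Ideal.Quotient.nontrivial_iff.2
    (fun h => (maximalIdeal.isMaximal B).ne_top (top_le_iff.1 (h ▸ hQB)))
  haveI : IsLocalRing (T ⧸ Q) := .of_surjective' _ Ideal.Quotient.mk_surjective
  haveI : IsLocalRing (B ⧸ Q.map (algebraMap T B)) := .of_surjective' _ Ideal.Quotient.mk_surjective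
  haveI := goingDown_quot (B := B) Q
  have e : (maximalIdeal T).map (Ideal.Quotient.mk Q) = maximalIdeal _ :=
    IsLocalRing.map_maximalIdeal_of_surjective _ Ideal.Quotient.mk_surjective
  have e2 : (maximalIdeal (T ⧸ Q)).map (algebraMap (T ⧸ Q) (B ⧸ Q.map (algebraMap T B))) =
      ((maximalIdeal T).map (algebraMap T B)).map (Ideal.Quotient.mk (Q.map (algebraMap T B))) := by
    rw [← e, Ideal.map_map, Ideal.map_map]; rfl
  have e3 : (maximalIdeal B).map (Ideal.Quotient.mk (Q.map (algebraMap T B))) = maximalIdeal _ :=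
    IsLocalRing.map_maximalIdeal_of_surjective _ Ideal.Quotient.mk_surjective
  rw [flat_dim (T := T ⧸ Q) (B := B ⧸ Q.map (algebraMap T B)), e2]
  · congr 1
    exact ringKrullDim_eq_of_ringEquiv (DoubleQuot.quotQuotEquivQuotOfLE (Ideal.map_mono (le_maximalIdeal hQ)))
  · rw [e2, ← e3]; exact Ideal.map_mono hloc

end PartFD

section PartCore1

open IsLocalRing

theorem base_aux {B : Type*} [CommRing B] {M M' : Type*} [AddCommGroup M] [Module B M]
    [AddCommGroup M'] [Module B M']
    (q : M →ₗ[B] M') {α β : Type} (x : B)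
    (d0 : (α → M) →ₗ[B] (β → M)) (d1 : (β → M) →ₗ[B] (α → M))
    (d0' : (α → M') →ₗ[B] (β → M')) (d1' : (β → M') →ₗ[B] (α → M'))
    (k0 : ∀ x, q ∘ (d0 x) = d0' (q ∘ x)) (k1 : ∀ x, q ∘ (d1 x) = d1' (q ∘ x))
    (s1 : ∀ z, d1 (d0 z) = x • z) (hu : ∀ y : M, x • y = 0 → y = 0)
    (hq : Function.Surjective q) (hker : ∀ z, q z = 0 ↔ ∃ y, x • y = z) (z' : α → M')
    (hz' : d0' z' = 0) : ∃ w', d1' w' = z' := by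
  obtain ⟨z, rfl⟩ := hq.comp_left z'
  simp only at hz'
  rw [← k0] at hz'
  have : ∀ i, ∃ y, x • y = d0 z i := fun i => (hker _).1 (congrFun hz' i)
  choose w hw using this
  have hw' : x • w = d0 z := funext hw
  refine ⟨q ∘ w, ?_⟩
  rw [← k1]
  have : d1 w = z := by
    have h : x • (d1 w - z) = 0 := by rw [smul_sub, ← map_smul, hw', s1, sub_self]
    rw [← sub_eq_zero]
    funext i
    exact hu _ (congrFun h i)
  rw [this]

theorem mf_base {B : Type*} [CommRing B] (L : List (B × B)) (b d : Ideal B)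
    (hb : ∀ y, mfE L * y ∈ b → y ∈ b)
    (hd : d = b ⊔ Ideal.span {mfE L}) : h0 L (B ⧸ d) = 0 ∧ h1 L (B ⧸ d) = 0 := by
  set x := mfE L with hxL
  let q : (B ⧸ b) →ₗ[B] (B ⧸ d) := Submodule.factor (hd ▸ le_sup_left)
  have hq : Function.Surjective q := Submodule.factor_surjective _
  have hu : ∀ y : B ⧸ b, x • y = 0 → y = 0 := by
    intro y hy
    obtain ⟨y, rfl⟩ := Submodule.mkQ_surjective _ y
    rw [← map_smul, Submodule.mkQ_apply, Submodule.Quotient.mk_eq_zero] at hy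
    rw [Submodule.mkQ_apply, Submodule.Quotient.mk_eq_zero]
    exact hb y hy
  have hker : ∀ z, q z = 0 ↔ ∃ y, x • y = z := by
    intro y
    obtain ⟨y, rfl⟩ := Submodule.mkQ_surjective _ y
    constructor
    · intro h
      change Submodule.Quotient.mk y = 0 at h
      rw [Submodule.Quotient.mk_eq_zero, hd] at h
      obtain ⟨z, hz, w, hw, rfl⟩ := Submodule.mem_sup.1 h
      obtain ⟨w, rfl⟩ := Ideal.mem_span_singleton'.1 hw
      refine ⟨Submodule.Quotient.mk w, ?_⟩
      change Submodule.Quotient.mk (x * w) = Submodule.Quotient.mk (z + w * x)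
      rw [eq_comm, Submodule.Quotient.eq]
      convert hz using 1
      ring
    · rintro ⟨z, hz⟩
      obtain ⟨z, rfl⟩ := Submodule.mkQ_surjective _ z
      rw [← hz]
      change Submodule.Quotient.mk (x * z) = 0
      rw [Submodule.Quotient.mk_eq_zero, hd]
      exact Ideal.mul_mem_right _ _ (Ideal.mem_sup_right (Ideal.mem_span_singleton_self x))
  have nt := mfD_nat q L
  have sq := mfD_sq (B ⧸ b) L
  rw [h0_zero_iff, h1_zero_iff]
  exact ⟨base_aux q x _ _ _ _ nt.1 nt.2 sq.1 hu hq hker,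
    base_aux q x _ _ _ _ nt.2 nt.1 sq.2 hu hq hker⟩

theorem ideal_sup_pow {R : Type*} [CommRing R] (I K : Ideal R) (k : ℕ) : (I ⊔ K) ^ k ≤ I ^ k ⊔ K := by
  have h : ((I ⊔ K) ^ k).map (Ideal.Quotient.mk K) = (I ^ k).map (Ideal.Quotient.mk K) := by
    rw [Ideal.map_pow, Ideal.map_pow, Ideal.map_sup, Ideal.map_quotient_self, sup_bot_eq]
  intro x hx
  have hx' := Ideal.mem_map_of_mem (Ideal.Quotient.mk K) hx
  rw [h] at hx'
  obtain ⟨y, hy, hxy⟩ := (Ideal.mem_map_iff_of_surjective _ Ideal.Quotient.mk_surjective).1 hx'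
  have := Ideal.Quotient.eq.1 hxy
  rw [← sub_sub_cancel y x]
  exact sub_mem (Ideal.mem_sup_left hy) (Ideal.mem_sup_right this)

section Core
variable {n : ℕ} {Λ N : Type*} [CommRing Λ] [IsLocalRing Λ] [CommRing N] [IsLocalRing N]
  [IsNoetherianRing N] [Algebra Λ N]
  (π : MvPowerSeries (Fin n) Λ →+* N)

/-- The diagonal elements. -/
noncomputable def diagU {n : ℕ} {Λ N : Type*} [CommRing Λ] [CommRing N]
    (π : MvPowerSeries (Fin n) Λ →+* N) (i : Fin n) : MvPowerSeries (Fin n) N :=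
  MvPowerSeries.X i - MvPowerSeries.C (π (MvPowerSeries.X i))

theorem surj_max_map {R R' : Type*} [CommRing R] [CommRing R'] [IsLocalRing R] [IsLocalRing R']
    (f : R →+* R') (hf : Function.Surjective f) {x : R} (hx : x ∈ maximalIdeal R) : f x ∈ maximalIdeal R' := by
  rw [← IsLocalRing.map_maximalIdeal_of_surjective f hf]
  exact Ideal.mem_map_of_mem _ hx

theorem diag_mem (hπ : Function.Surjective π)
    (hC : ∀ x, π (MvPowerSeries.C x) = algebraMap Λ N x)
    (f : MvPowerSeries (Fin n) Λ) : MvPowerSeries.map (algebraMap Λ N) f -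
    MvPowerSeries.C (π f) ∈ Ideal.span (Set.range (diagU π)) := by
  refine mem_of_pow_closed (maximalIdeal (MvPowerSeries (Fin n) N)) (maximalIdeal_le_jacobson _) _ _ fun t => ?_
  refine ⟨MvPowerSeries.map (algebraMap Λ N) (MvPowerSeries.truncTotal t f : MvPolynomial _ _) -
    MvPowerSeries.C (π (MvPowerSeries.truncTotal t f : MvPolynomial _ _)), ?_, ?_⟩
  · generalize (MvPowerSeries.truncTotal t f : MvPolynomial _ _) = p
    induction p using MvPolynomial.induction_on with
    | C a => 
      rw [MvPolynomial.coe_C, hC, MvPowerSeries.map_C, sub_self]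
      exact zero_mem _
    | add p q hp hq =>
      rw [MvPolynomial.coe_add, map_add, map_add, map_add]
      convert add_mem hp hq using 1
      ring
    | mul_X p i hp =>
      rw [MvPolynomial.coe_mul, MvPolynomial.coe_X, map_mul, map_mul, map_mul, MvPowerSeries.map_X]
      have h1 : (MvPowerSeries.X i - MvPowerSeries.C (π (MvPowerSeries.X i)) : MvPowerSeries (Fin n) N) ∈
        Ideal.span (Set.range (diagU π)) := Ideal.subset_span ⟨i, rfl⟩
      convert add_mem (Ideal.mul_mem_right (MvPowerSeries.X i) _ hp) (Ideal.mul_mem_left _ (MvPowerSeries.C (π (p : MvPowerSeries (Fin n) Λ))) h1) using 1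
      ring
  · have h1 := mvps_trunc f t
    set r := f - (MvPowerSeries.truncTotal t f : MvPolynomial _ _) with hr
    have e : MvPowerSeries.map (algebraMap Λ N) f - MvPowerSeries.C (π f) - (MvPowerSeries.map (algebraMap Λ N) (MvPowerSeries.truncTotal t f : MvPolynomial _ _) -
      MvPowerSeries.C (π (MvPowerSeries.truncTotal t f : MvPolynomial _ _))) = MvPowerSeries.map (algebraMap Λ N) r - MvPowerSeries.C (π r) := by
      rw [hr, map_sub, map_sub, map_sub]; ring
    rw [e, smul_eq_mul, Ideal.mul_top]
    refine sub_mem ?_ ?_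
    · have h2 := Ideal.mem_map_of_mem (MvPowerSeries.map (algebraMap Λ N)) h1
      rw [Ideal.map_pow] at h2
      refine Ideal.pow_right_mono ?_ t h2
      rw [Ideal.map_span, Ideal.span_le]
      rintro _ ⟨_, ⟨i, rfl⟩, rfl⟩
      rw [SetLike.mem_coe, mvps_mem_max]; simp
    · have h2 := Ideal.mem_map_of_mem ((MvPowerSeries.C (σ := Fin n) (R := N)).comp π) h1
      rw [Ideal.map_pow] at h2
      refine Ideal.pow_right_mono ?_ t h2
      rw [Ideal.map_span, Ideal.span_le]
      rintro _ ⟨_, ⟨i, rfl⟩, rfl⟩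
      rw [SetLike.mem_coe, mvps_mem_max]
      rw [RingHom.comp_apply, MvPowerSeries.constantCoeff_C]
      exact surj_max_map π hπ ((mvps_mem_max _).2 (by simp))

theorem diag_max (hπ : Function.Surjective π) (i : Fin n) :
    diagU π i ∈ maximalIdeal (MvPowerSeries (Fin n) N) := by
  rw [mvps_mem_max, diagU, map_sub, MvPowerSeries.constantCoeff_X, MvPowerSeries.constantCoeff_C, zero_sub]
  exact neg_mem (surj_max_map π hπ ((mvps_mem_max _).2 (by simp)))

theorem diag_primary (hπ : Function.Surjective π)
    (hC : ∀ x, π (MvPowerSeries.C x) = algebraMap Λ N x)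
    (Q : Ideal (MvPowerSeries (Fin n) Λ)) (k : ℕ)
    (hk : maximalIdeal (MvPowerSeries (Fin n) Λ) ^ k ≤ RingHom.ker π ⊔ Q) :
    maximalIdeal (MvPowerSeries (Fin n) N) ^ k ≤ Q.map (MvPowerSeries.map (algebraMap Λ N)) ⊔
      Ideal.span (Set.range (diagU π)) := by
  have h1 : maximalIdeal (MvPowerSeries (Fin n) N) ≤ 
      (maximalIdeal (MvPowerSeries (Fin n) Λ)).map ((MvPowerSeries.C).comp π) ⊔ Ideal.span (Set.range (diagU π)) := by
    rw [mvps_max, ← Ideal.map_map, IsLocalRing.map_maximalIdeal_of_surjective π hπ]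
    refine sup_le le_sup_left (Ideal.span_le.2 ?_)
    rintro _ ⟨i, rfl⟩
    rw [← sub_add_cancel (MvPowerSeries.X i : MvPowerSeries (Fin n) N) (MvPowerSeries.C (π (MvPowerSeries.X i)))]
    refine add_mem (Ideal.mem_sup_right (Ideal.subset_span ⟨i, rfl⟩)) (Ideal.mem_sup_left (Ideal.mem_map_of_mem _ ?_))
    exact surj_max_map π hπ ((mvps_mem_max _).2 (by simp))
  refine (Ideal.pow_right_mono h1 k).trans ((ideal_sup_pow _ _ _).trans (sup_le ?_ le_sup_right))
  rw [← Ideal.map_pow, Ideal.map_le_iff_le_comap]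
  intro f hf
  obtain ⟨a, ha, q, hq, rfl⟩ := Submodule.mem_sup.1 (hk hf)
  rw [Ideal.mem_comap, RingHom.comp_apply, map_add, (RingHom.mem_ker).1 ha, zero_add]
  rw [← sub_sub_cancel (MvPowerSeries.map (algebraMap Λ N) q) (MvPowerSeries.C (π q))]
  exact sub_mem (Ideal.mem_sup_left (Ideal.mem_map_of_mem _ hq)) (Ideal.mem_sup_right (diag_mem π hπ hC q))

theorem mvps_map_max : (maximalIdeal (MvPowerSeries (Fin n) Λ)).map
    (algebraMap (MvPowerSeries (Fin n) Λ) (MvPowerSeries (Fin n) N)) =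
    ((maximalIdeal Λ).map (algebraMap Λ N)).comap MvPowerSeries.constantCoeff := by
  have hX : (Ideal.span (Set.range MvPowerSeries.X) : Ideal (MvPowerSeries (Fin n) Λ)).map
      (algebraMap (MvPowerSeries (Fin n) Λ) (MvPowerSeries (Fin n) N)) = Ideal.span (Set.range MvPowerSeries.X) := by
    rw [Ideal.map_span, ← Set.range_comp]
    congr 2
    ext1 i
    rw [Function.comp_apply, MvPowerSeries.algebraMap_apply'', MvPowerSeries.map_X]
  have hCC : ((maximalIdeal Λ).map (MvPowerSeries.C)).map
      (algebraMap (MvPowerSeries (Fin n) Λ) (MvPowerSeries (Fin n) N)) =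
        ((maximalIdeal Λ).map (algebraMap Λ N)).map MvPowerSeries.C := by
    rw [Ideal.map_map, Ideal.map_map]
    congr 1
    ext1 x
    rw [RingHom.comp_apply, MvPowerSeries.algebraMap_apply'', MvPowerSeries.map_C]; rfl
  rw [mvps_max, Ideal.map_sup, hX, hCC]
  apply le_antisymm
  · refine sup_le (Ideal.map_le_iff_le_comap.2 fun x hx => ?_) (Ideal.span_le.2 ?_)
    · simpa using hx
    · rintro _ ⟨i, rfl⟩
      simp
  · intro f hf
    rw [← add_sub_cancel (MvPowerSeries.C (MvPowerSeries.constantCoeff f)) f]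
    exact add_mem (Ideal.mem_sup_left (Ideal.mem_map_of_mem _ hf))
      (Ideal.mem_sup_right (mvps_ker_const _ (by simp)))

theorem mvps_fiber_dim : ringKrullDim (MvPowerSeries (Fin n) N ⧸ (maximalIdeal (MvPowerSeries (Fin n) Λ)).map
    (algebraMap (MvPowerSeries (Fin n) Λ) (MvPowerSeries (Fin n) N))) =
    ringKrullDim (N ⧸ (maximalIdeal Λ).map (algebraMap Λ N)) := by
  rw [mvps_map_max]
  let f := (Ideal.Quotient.mk ((maximalIdeal Λ).map (algebraMap Λ N))).comp
    (MvPowerSeries.constantCoeff (σ := Fin n) (R := N))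
  have hf : Function.Surjective f := Ideal.Quotient.mk_surjective.comp fun x => ⟨MvPowerSeries.C x, by simp⟩
  have hk : RingHom.ker f = ((maximalIdeal Λ).map (algebraMap Λ N)).comap MvPowerSeries.constantCoeff := by
    rw [← RingHom.comap_ker, Ideal.mk_ker]
  rw [← hk]
  exact ringKrullDim_eq_of_ringEquiv (RingHom.quotientKerEquivOfSurjective hf)

theorem local_of_local (h : ∀ x ∈ maximalIdeal Λ, algebraMap Λ N x ∈ maximalIdeal N) :
  (maximalIdeal (MvPowerSeries (Fin n) Λ)).map
    (algebraMap (MvPowerSeries (Fin n) Λ) (MvPowerSeries (Fin n) N)) ≤ maximalIdeal _ := by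
  rw [mvps_map_max]
  intro f hf
  rw [mvps_mem_max]
  exact (Ideal.map_le_iff_le_comap.2 h) hf
end Core

end PartCore1

section PartCore2

open IsLocalRing

theorem span_range_ofList {R : Type*} [CommRing R] {n : ℕ} (u : Fin n → R) :
    Ideal.ofList (List.ofFn u) = Ideal.span (Set.range u) := by
  rw [Ideal.ofList]
  congr 1
  ext x
  simp [List.mem_ofFn]

theorem dim_quot_le_of {R : Type*} [CommRing R] [IsLocalRing R] [IsNoetherianRing R] {n : ℕ}
    (u : Fin n → R) (hu : ∀ i, u i ∈ maximalIdeal R) (Q : Ideal R) (hQ : Q ≠ ⊤) (k : ℕ)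
    (h : maximalIdeal R ^ k ≤ Q ⊔ Ideal.span (Set.range u)) : ringKrullDim (R ⧸ Q) ≤ n := by
  haveI : Nontrivial (R ⧸ Q) := Ideal.Quotient.nontrivial_iff.2 hQ
  haveI : IsLocalRing (R ⧸ Q) := IsLocalRing.of_surjective' (Ideal.Quotient.mk Q) Ideal.Quotient.mk_surjective
  have := dim_le_of_ofList (List.ofFn fun i => Ideal.Quotient.mk Q (u i)) ?_ k ?_
  · simpa using this
  · intro x hx
    obtain ⟨i, rfl⟩ := (List.mem_ofFn' _ _).1 hx
    exact surj_max_map _ Ideal.Quotient.mk_surjective (hu i)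
  · rw [span_range_ofList, ← IsLocalRing.map_maximalIdeal_of_surjective _ (Ideal.Quotient.mk_surjective (I := Q)),
      ← Ideal.map_pow]
    refine (Ideal.map_mono h).trans ?_
    rw [Ideal.map_sup, Ideal.map_quotient_self, bot_sup_eq, Ideal.map_span, ← Set.range_comp]
    rfl

theorem core_field {n : ℕ} {Λ N : Type*} [Field Λ] [CommRing N] [IsLocalRing N]
    [IsNoetherianRing N] [Algebra Λ N]
    (π : MvPowerSeries (Fin n) Λ →+* N) (hπ : Function.Surjective π)
    (hC : ∀ x, π (MvPowerSeries.C x) = algebraMap Λ N x)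
    (Q : Ideal (MvPowerSeries (Fin n) Λ)) (hQ : Q ≠ ⊤) (k : ℕ)
    (hk : maximalIdeal (MvPowerSeries (Fin n) Λ) ^ k ≤ RingHom.ker π ⊔ Q) :
    ringKrullDim N + ringKrullDim (MvPowerSeries (Fin n) Λ ⧸ Q) ≤ n := by
  haveI : Module.Flat (MvPowerSeries (Fin n) Λ) (MvPowerSeries (Fin n) N) := mvps_flat
  have hm : maximalIdeal Λ = ⊥ := IsLocalRing.maximalIdeal_eq_bot
  have hloc := local_of_local (n := n) (Λ := Λ) (N := N) (by
    intro x hx; rw [hm] at hx; rw [(Ideal.mem_bot).1 hx, map_zero]; exact zero_mem _)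
  have h1 := flat_dim_quot hloc Q hQ
  rw [mvps_fiber_dim, hm, Ideal.map_bot, ringKrullDim_eq_of_ringEquiv (RingEquiv.quotientBot N)] at h1
  rw [add_comm, ← h1]
  have h2 := diag_primary π hπ hC Q k hk
  refine dim_quot_le_of (diagU π) (diag_max π hπ) _ ?_ k h2
  intro h
  exact (maximalIdeal.isMaximal _).ne_top (top_le_iff.1 (h ▸ (Ideal.map_mono (le_maximalIdeal hQ)).trans hloc))

theorem mfE_ofFn {B : Type*} [CommRing B] {n : ℕ} (u g : Fin n → B) :
    mfE (List.ofFn fun i => (u i, g i)) = ∑ i, g i * u i := by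
  rw [mfE, List.map_ofFn, List.sum_ofFn]; rfl

theorem withBot_lt_arith {n : ℕ} {a b c : WithBot ℕ∞} (h1 : b + c < n) (h2 : a ≤ c + 1) : a + b ≤ n := by
  induction a with
  | bot => simp
  | coe a =>
  induction b with
  | bot => simp
  | coe b =>
  induction c with
  | bot => simp at h2
  | coe c =>
  induction c with
  | top => 
    have : ((b : WithBot ℕ∞) + (⊤ : ℕ∞)) = ((b + ⊤ : ℕ∞) : WithBot ℕ∞) := rfl
    rw [this] at h1
    simp at h1
  | coe c => 
  induction b with
  | top => 
    have : (((⊤ : ℕ∞) : WithBot ℕ∞) + ((c : ℕ∞))) = ((⊤ + c : ℕ∞) : WithBot ℕ∞) := rfl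
    rw [this] at h1
    simp at h1
  | coe b =>
  induction a with
  | top => 
    exfalso
    norm_cast at h2
  | coe a => norm_cast at *; omega

theorem core_dvr {n : ℕ} {Λ N : Type*} [CommRing Λ] [IsDomain Λ] [IsDiscreteValuationRing Λ]
    [CommRing N] [IsLocalRing N]
    [IsNoetherianRing N] [Algebra Λ N] (p : Λ) (hp : maximalIdeal Λ = Ideal.span {p})
    (hpN : ∀ y, algebraMap Λ N p * y = 0 → y = 0)
    (π : MvPowerSeries (Fin n) Λ →+* N) (hπ : Function.Surjective π)
    (hC : ∀ x, π (MvPowerSeries.C x) = algebraMap Λ N x)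
    (Q : Ideal (MvPowerSeries (Fin n) Λ)) (hQ : Q ≠ ⊤) (k : ℕ)
    (hk : maximalIdeal (MvPowerSeries (Fin n) Λ) ^ k ≤ RingHom.ker π ⊔ Q)
    (E : MvPowerSeries (Fin n) Λ) (hE0 : MvPowerSeries.constantCoeff E = p)
    (hE1 : π E = 0) (hE2 : E ∈ Q) :
    ringKrullDim N + ringKrullDim (MvPowerSeries (Fin n) Λ ⧸ Q) ≤ n := by
  have hpm : p ∈ maximalIdeal Λ := hp ▸ Ideal.mem_span_singleton_self p
  have hpm' : algebraMap Λ N p ∈ maximalIdeal N := by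
    rw [← hC]
    exact surj_max_map π hπ ((mvps_mem_max _).2 (by simpa using hpm))
  haveI : Module.IsTorsionFree Λ N := by
    refine ⟨fun r hr => ?_⟩
    have hr0 : r ≠ 0 := hr.ne_zero
    have hirr : Irreducible p := (IsDiscreteValuationRing.irreducible_iff_uniformizer p).2 hp
    obtain ⟨m, u, rfl⟩ := IsDiscreteValuationRing.eq_unit_mul_pow_irreducible hr0 hirr
    intro x y hxy
    have h1 : (u.1 * p ^ m) • (x - y) = 0 := by
      rw [smul_sub]; exact sub_eq_zero.2 hxy
    rw [mul_smul, ← Units.smul_def, smul_eq_zero_iff_eq] at h1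
    rw [← sub_eq_zero]
    clear hxy hr hr0
    induction m with
    | zero => simpa using h1
    | succ m ih =>
      rw [pow_succ', mul_smul, Algebra.smul_def p] at h1
      exact ih (hpN _ h1)
  haveI : Module.Flat Λ N := inferInstance
  haveI : Module.Flat (MvPowerSeries (Fin n) Λ) (MvPowerSeries (Fin n) N) := mvps_flat
  have hloc := local_of_local (n := n) (Λ := Λ) (N := N) (by
    intro x hx; rw [hp] at hx
    obtain ⟨y, rfl⟩ := Ideal.mem_span_singleton'.1 hx
    rw [map_mul]; exact Ideal.mul_mem_left _ _ hpm')
  have h1 := flat_dim_quot hloc Q hQ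
  rw [mvps_fiber_dim] at h1
  have h2 := diag_primary π hπ hC Q k hk
  have hEd := diag_mem π hπ hC E
  rw [hE1, map_zero, sub_zero] at hEd
  obtain ⟨g, hg⟩ := (Ideal.mem_span_range_iff_exists_fun).1 hEd
  set L := List.ofFn fun i => (diagU π i, g i) with hL
  have hEL : mfE L = MvPowerSeries.map (algebraMap Λ N) E := by rw [hL, mfE_ofFn, hg]
  have hQB : Q.map (algebraMap (MvPowerSeries (Fin n) Λ) (MvPowerSeries (Fin n) N)) ≠ ⊤ := by
    intro h
    exact (maximalIdeal.isMaximal _).ne_top (top_le_iff.1 (h ▸ (Ideal.map_mono (le_maximalIdeal hQ)).trans hloc))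
  have hcE : MvPowerSeries.constantCoeff (mfE L) = algebraMap Λ N p := by
    rw [hEL, MvPowerSeries.constantCoeff_map, hE0]
  have hb := mf_base L (RingHom.ker (MvPowerSeries.constantCoeff (σ := Fin n) (R := N)))
    ((maximalIdeal (MvPowerSeries (Fin n) Λ)).map
    (algebraMap (MvPowerSeries (Fin n) Λ) (MvPowerSeries (Fin n) N))) (by
      intro y hy
      rw [RingHom.mem_ker, map_mul, hcE] at hy
      exact hpN _ hy) (by
      rw [mvps_map_max, hp, Ideal.map_span, Set.image_singleton, ← hcE]
      ext x
      rw [Ideal.mem_comap, Ideal.mem_span_singleton']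
      constructor
      · rintro ⟨y, hy⟩
        rw [← sub_add_cancel x (MvPowerSeries.C y * mfE L)]
        refine add_mem (Ideal.mem_sup_left ?_) (Ideal.mem_sup_right (Ideal.mul_mem_left _ _ (Ideal.mem_span_singleton_self _)))
        rw [RingHom.mem_ker, map_sub, map_mul, MvPowerSeries.constantCoeff_C, hy, sub_self]
      · intro hx
        obtain ⟨z, hz, w, hw, rfl⟩ := Submodule.mem_sup.1 hx
        obtain ⟨w, rfl⟩ := Ideal.mem_span_singleton'.1 hw
        refine ⟨MvPowerSeries.constantCoeff w, ?_⟩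
        rw [map_add, map_mul, (RingHom.mem_ker).1 hz, zero_add])
  have hex := mf_exact hloc L E hEL hb.1 hb.2 Q hQ hE2
  have hth := theta_main L (by
    intro x hx
    obtain ⟨i, rfl⟩ := (List.mem_ofFn' _ _).1 hx
    exact diag_max π hπ i) (MvPowerSeries (Fin n) N ⧸ Q.map (algebraMap (MvPowerSeries (Fin n) Λ) (MvPowerSeries (Fin n) N)))
    (by
      intro x
      obtain ⟨x, rfl⟩ := Submodule.mkQ_surjective _ x
      rw [← map_smul, Submodule.mkQ_apply, Submodule.Quotient.mk_eq_zero, hEL]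
      exact Ideal.mul_mem_right _ _ (Ideal.mem_map_of_mem _ hE2))
    ⟨k, by
      rw [Ideal.annihilator_quotient]
      have : List.map Prod.fst L = List.ofFn (diagU π) := by rw [hL, List.map_ofFn]; rfl
      rw [this, span_range_ofList]
      exact h2⟩
  have h4 : ¬ ((L.length : WithBot ℕ∞) ≤ ringKrullDim (MvPowerSeries (Fin n) N ⧸ Q.map (algebraMap (MvPowerSeries (Fin n) Λ) (MvPowerSeries (Fin n) N)))) := by
    intro h
    have := hth.2.2.2 (by rw [Module.supportDim_quotient_eq_ringKrullDim]; exact h)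
    rw [hex.1, hex.2] at this
    exact lt_irrefl _ this
  rw [not_le, h1, hL, List.length_ofFn] at h4
  refine withBot_lt_arith h4 ?_
  have h5 := ringKrullDim_le_ringKrullDim_quotient_add_card ({algebraMap Λ N p} : Finset N) (by
    intro x hx
    rw [IsLocalRing.ringJacobson_eq_maximalIdeal]
    have : x = algebraMap Λ N p := by simpa using hx
    rw [this]; exact hpm')
  rw [hp, Ideal.map_span, Set.image_singleton]
  rw [Finset.coe_singleton] at h5
  simpa using h5

end PartCore2

section PartRed1

open IsLocalRing

theorem mvps_lift {n : ℕ} {Λ S : Type*} [CommRing Λ] [CommRing S] (I : Ideal S) [IsAdicComplete I S]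
    (θ : Λ →+* S) (x : Fin n → S) (hx : ∀ i, x i ∈ I) :
    ∃ φ : MvPowerSeries (Fin n) Λ →+* S, (∀ a, φ (MvPowerSeries.C a) = θ a) ∧
      ∀ i, φ (MvPowerSeries.X i) = x i := by
  let e : MvPolynomial (Fin n) Λ →+* S := MvPolynomial.eval₂Hom θ x
  let J := MvPolynomial.idealOfVars (Fin n) Λ
  have hJ : J ≤ I.comap e := by
    change Ideal.span (Set.range MvPolynomial.X) ≤ _
    rw [Ideal.span_le]
    rintro _ ⟨i, rfl⟩
    rw [SetLike.mem_coe, Ideal.mem_comap, MvPolynomial.coe_eval₂Hom, MvPolynomial.eval₂_X]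
    exact hx i
  have hJk : ∀ k, J ^ k ≤ (I ^ k).comap e := fun k =>
    (Ideal.pow_right_mono hJ k).trans (Ideal.le_comap_pow e k)
  let f : ∀ k, AdicCompletion J (MvPolynomial (Fin n) Λ) →+* S ⧸ I ^ k := fun k =>
    (Ideal.quotientMap (I ^ k) e (hJk k)).comp (AdicCompletion.evalₐ J k : _ →+* _)
  have hf : ∀ {m k : ℕ} (hle : m ≤ k), (Ideal.Quotient.factorPow I hle).comp (f k) = f m := by
    intro m k hle
    ext1 y
    obtain ⟨y, rfl⟩ := AdicCompletion.mk_surjective J _ y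
    have hev : ∀ j, f j (AdicCompletion.mk J _ y) = Ideal.Quotient.mk (I ^ j) (e (y.1 j)) := fun j => by
      change Ideal.quotientMap (I ^ j) e (hJk j) (AdicCompletion.evalₐ J j (AdicCompletion.mk J _ y)) = _
      exact (congrArg _ (AdicCompletion.evalₐ_mk (I := J) j y)).trans (Ideal.quotientMap_mk)
    rw [RingHom.comp_apply]
    refine (congrArg _ (hev k)).trans (Eq.trans ?_ (hev m).symm)
    change Ideal.Quotient.mk (I ^ m) (e (y.1 k)) = _
    refine Ideal.Quotient.eq.2 ?_
    rw [← map_sub]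
    refine hJk m ?_
    have h := y.2 hle
    rw [SModEq.sub_mem] at h
    have h' := neg_mem h
    rw [neg_sub] at h'
    simpa using h'
  let g := IsAdicComplete.liftRingHom I f hf
  have hg : ∀ q : MvPolynomial (Fin n) Λ, g (MvPowerSeries.toAdicCompletionAlgEquiv (Fin n) Λ (q : MvPowerSeries (Fin n) Λ)) = e q := by
    intro q
    rw [IsHausdorff.eq_iff_smodEq (I := I)]
    intro k
    rw [SModEq.sub_mem, smul_eq_mul, Ideal.mul_top, ← Ideal.Quotient.eq]
    rw [IsAdicComplete.mk_liftRingHom, MvPowerSeries.toAdicCompletionAlgEquiv_apply,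
      MvPowerSeries.toAdicCompletion_coe]
    simp only [f, RingHom.comp_apply, RingHom.coe_coe]
    rw [AdicCompletion.evalₐ_of, Ideal.quotientMap_mk]
  refine ⟨g.comp ((MvPowerSeries.toAdicCompletionAlgEquiv (Fin n) Λ) : _ →+* _), fun a => ?_, fun i => ?_⟩
  · rw [RingHom.comp_apply, ← MvPolynomial.coe_C]
    refine (hg _).trans (by simp [e])
  · rw [RingHom.comp_apply, ← MvPolynomial.coe_X]
    refine (hg _).trans (by simp [e])

theorem mvps_lift_surj {n : ℕ} {Λ S : Type*} [CommRing Λ] [CommRing S] (I : Ideal S) [IsAdicComplete I S]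
    (θ : Λ →+* S) (x : Fin n → S) (hx : Ideal.span (Set.range x) = I)
    (hθ : ∀ y, ∃ a, y - θ a ∈ I) :
    ∃ φ : MvPowerSeries (Fin n) Λ →+* S, (∀ a, φ (MvPowerSeries.C a) = θ a) ∧
      (∀ i, φ (MvPowerSeries.X i) = x i) ∧ Function.Surjective φ := by
  obtain ⟨φ, h1, h2⟩ := mvps_lift I θ x (fun i => hx ▸ Ideal.subset_span ⟨i, rfl⟩)
  refine ⟨φ, h1, h2, ?_⟩
  have hm : (Ideal.span (Set.range MvPowerSeries.X) : Ideal (MvPowerSeries (Fin n) Λ)).map φ = I := by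
    rw [Ideal.map_span, ← Set.range_comp, ← hx]
    congr 2
    exact funext h2
  haveI : IsHausdorff ((Ideal.span (Set.range MvPowerSeries.X) : Ideal (MvPowerSeries (Fin n) Λ)).map φ) S := by
    rw [hm]; infer_instance
  refine surjective_of_mk_map_comp_surjective (I := Ideal.span (Set.range MvPowerSeries.X)) φ ?_
  intro y
  obtain ⟨y, rfl⟩ := Ideal.Quotient.mk_surjective y
  obtain ⟨a, ha⟩ := hθ y
  refine ⟨MvPowerSeries.C a, ?_⟩
  rw [RingHom.comp_apply, h1, eq_comm, Ideal.Quotient.eq, hm]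
  exact ha

theorem ker_sup_aux {T S : Type*} [CommRing T] [CommRing S] (φ : T →+* S) (hφ : Function.Surjective φ)
    (P Q : Ideal S) (a : Ideal T) (h : a.map φ ≤ P ⊔ Q) :
    a ≤ P.comap φ ⊔ Q.comap φ := by
  intro x hx
  obtain ⟨y, hy, z, hz, hyz⟩ := Submodule.mem_sup.1 (h (Ideal.mem_map_of_mem φ hx))
  obtain ⟨z, rfl⟩ := hφ z
  rw [← sub_add_cancel x z]
  refine add_mem (Ideal.mem_sup_left ?_) (Ideal.mem_sup_right hz)
  rw [Ideal.mem_comap, map_sub, ← hyz, add_sub_cancel_right]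
  exact hy

theorem quot_comap_dim {T S : Type*} [CommRing T] [CommRing S] (φ : T →+* S) (hφ : Function.Surjective φ)
    (Q : Ideal S) : ringKrullDim (T ⧸ Q.comap φ) = ringKrullDim (S ⧸ Q) := by
  have hs : Function.Surjective ((Ideal.Quotient.mk Q).comp φ) := Ideal.Quotient.mk_surjective.comp hφ
  have hk : RingHom.ker ((Ideal.Quotient.mk Q).comp φ) = Q.comap φ := by
    rw [← RingHom.comap_ker, Ideal.mk_ker]
  rw [← hk]
  exact ringKrullDim_eq_of_ringEquiv (RingHom.quotientKerEquivOfSurjective hs)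

theorem serre_field {n : ℕ} {Λ S : Type*} [Field Λ] [CommRing S] [IsLocalRing S] [IsNoetherianRing S]
    (φ : MvPowerSeries (Fin n) Λ →+* S) (hφ : Function.Surjective φ)
    (P Q : Ideal S) (hP : P ≠ ⊤) (hQ : Q ≠ ⊤) (k : ℕ) (hk : maximalIdeal S ^ k ≤ P ⊔ Q) :
    ringKrullDim (S ⧸ P) + ringKrullDim (S ⧸ Q) ≤ n := by
  haveI : Nontrivial (S ⧸ P) := Ideal.Quotient.nontrivial_iff.2 hP
  haveI : IsLocalRing (S ⧸ P) := IsLocalRing.of_surjective' (Ideal.Quotient.mk P) Ideal.Quotient.mk_surjective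
  letI : Algebra Λ (S ⧸ P) := (((Ideal.Quotient.mk P).comp φ).comp MvPowerSeries.C).toAlgebra
  have := core_field ((Ideal.Quotient.mk P).comp φ) (Ideal.Quotient.mk_surjective.comp hφ)
    (fun x => rfl) (Q.comap φ) (fun h => hQ ((Ideal.comap_eq_top_iff).1 h)) k (by
      rw [← RingHom.comap_ker, Ideal.mk_ker]
      refine ker_sup_aux φ hφ _ _ _ ?_
      rw [Ideal.map_pow, IsLocalRing.map_maximalIdeal_of_surjective φ hφ]
      exact hk)
  rwa [quot_comap_dim φ hφ] at this

theorem serre_dvr {n : ℕ} {Λ S : Type*} [CommRing Λ] [IsDomain Λ] [IsDiscreteValuationRing Λ] [CommRing S] [IsLocalRing S]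
    [IsNoetherianRing S] (p : Λ) (hp : maximalIdeal Λ = Ideal.span {p})
    (φ : MvPowerSeries (Fin n) Λ →+* S) (hφ : Function.Surjective φ)
    (hX : maximalIdeal S = Ideal.span (Set.range fun i => φ (MvPowerSeries.X i)))
    (P Q : Ideal S) (hP : P ≠ ⊤) (hQ : Q ≠ ⊤) (k : ℕ) (hk : maximalIdeal S ^ k ≤ P ⊔ Q)
    (hpP : ∀ y, φ (MvPowerSeries.C p) * y ∈ P → y ∈ P) :
    ringKrullDim (S ⧸ P) + ringKrullDim (S ⧸ Q) ≤ n := by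
  haveI : Nontrivial (S ⧸ P) := Ideal.Quotient.nontrivial_iff.2 hP
  haveI : IsLocalRing (S ⧸ P) := IsLocalRing.of_surjective' (Ideal.Quotient.mk P) Ideal.Quotient.mk_surjective
  letI : Algebra Λ (S ⧸ P) := (((Ideal.Quotient.mk P).comp φ).comp MvPowerSeries.C).toAlgebra
  have hpm : φ (MvPowerSeries.C p) ∈ maximalIdeal S := surj_max_map φ hφ ((mvps_mem_max _).2 (by
    rw [MvPowerSeries.constantCoeff_C, hp]; exact Ideal.mem_span_singleton_self p))
  rw [hX] at hpm
  obtain ⟨g, hg⟩ := (Ideal.mem_span_range_iff_exists_fun).1 hpm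
  choose G hG using fun i => hφ (g i)
  set E : MvPowerSeries (Fin n) Λ := MvPowerSeries.C p - ∑ i, G i * MvPowerSeries.X i with hE
  have hE0 : φ E = 0 := by
    rw [hE, map_sub, map_sum, sub_eq_zero, ← hg]
    exact Finset.sum_congr rfl fun i _ => by rw [map_mul, hG]
  have := core_dvr p hp (by
      intro y hy
      obtain ⟨y, rfl⟩ := Ideal.Quotient.mk_surjective y
      have e : algebraMap Λ (S ⧸ P) p = Ideal.Quotient.mk P (φ (MvPowerSeries.C p)) := rfl
      rw [e, ← map_mul, Ideal.Quotient.eq_zero_iff_mem] at hy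
      rw [Ideal.Quotient.eq_zero_iff_mem]
      exact hpP y hy)
    ((Ideal.Quotient.mk P).comp φ) (Ideal.Quotient.mk_surjective.comp hφ)
    (fun x => rfl) (Q.comap φ) (fun h => hQ ((Ideal.comap_eq_top_iff).1 h)) k (by
      rw [← RingHom.comap_ker, Ideal.mk_ker]
      refine ker_sup_aux φ hφ _ _ _ ?_
      rw [Ideal.map_pow, IsLocalRing.map_maximalIdeal_of_surjective φ hφ]
      exact hk) E (by simp [hE]) (by rw [RingHom.comp_apply, hE0, map_zero])
      (by rw [Ideal.mem_comap, hE0]; exact zero_mem _)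
  rwa [quot_comap_dim φ hφ] at this

end PartRed1

section PartRed2

open WittVector in
theorem wt_gh_ker {S E : Type*} [CommRing S] [CommRing E] (p : ℕ) [Fact p.Prime] [CharP E p] (π : S →+* E)
    (n : ℕ) : RingHom.ker (WittVector.map (p := p) π) ≤
    RingHom.ker ((Ideal.Quotient.mk ((RingHom.ker π) ^ (n + 1))).comp
      (WittVector.ghostComponent (p := p) n)) := by
  intro x hx
  have hc : ∀ i, x.coeff i ∈ RingHom.ker π := by
    intro i
    have := congrArg (fun y => WittVector.coeff y i) (RingHom.mem_ker.1 hx)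
    simpa [WittVector.map_coeff] using this
  have hp : (p : S) ∈ RingHom.ker π := by
    rw [RingHom.mem_ker, map_natCast, CharP.cast_eq_zero]
  rw [RingHom.mem_ker, RingHom.comp_apply, Ideal.Quotient.eq_zero_iff_mem, ghostComponent_apply,
    aeval_wittPolynomial]
  refine Ideal.sum_mem _ fun i hi => ?_
  have hi' : i ≤ n := by simpa [Nat.lt_succ_iff] using hi
  have h1 : (p : S) ^ i * x.coeff i ^ p ^ (n - i) ∈ (RingHom.ker π) ^ (i + p ^ (n - i)) := by
    rw [pow_add]
    exact Ideal.mul_mem_mul (Ideal.pow_mem_pow hp _) (Ideal.pow_mem_pow (hc i) _)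
  refine Ideal.pow_le_pow_right ?_ h1
  have : n - i < p ^ (n - i) := Nat.lt_pow_self (Fact.out : p.Prime).one_lt
  omega

open WittVector in
noncomputable def wt_gh {S E : Type*} [CommRing S] [CommRing E] (p : ℕ) [Fact p.Prime] [CharP E p]
    (π : S →+* E) (hπ : Function.Surjective π) (n : ℕ) :
    WittVector p E →+* S ⧸ (RingHom.ker π) ^ (n + 1) :=
  RingHom.liftOfSurjective (WittVector.map π) (WittVector.map_surjective _ hπ)
    ⟨(Ideal.Quotient.mk ((RingHom.ker π) ^ (n + 1))).comp (WittVector.ghostComponent n),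
      wt_gh_ker p π n⟩

theorem wt_gh_map {S E : Type*} [CommRing S] [CommRing E] (p : ℕ) [Fact p.Prime] [CharP E p]
    (π : S →+* E) (hπ : Function.Surjective π) (n : ℕ) (x : WittVector p S) :
    wt_gh p π hπ n (WittVector.map π x) =
      Ideal.Quotient.mk ((RingHom.ker π) ^ (n + 1)) (WittVector.ghostComponent n x) :=
  RingHom.liftOfSurjective_comp_apply ..

noncomputable def wt_th {S E : Type*} [CommRing S] [CommRing E] (p : ℕ) [Fact p.Prime] [CharP E p]
    [PerfectRing E p] (π : S →+* E) (hπ : Function.Surjective π) (n : ℕ) :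
    WittVector p E →+* S ⧸ (RingHom.ker π) ^ (n + 1) :=
  (wt_gh p π hπ n).comp (WittVector.map ((frobeniusEquiv E p).symm ^ n : E →+* E))

theorem wt_th_teich {S E : Type*} [CommRing S] [CommRing E] (p : ℕ) [Fact p.Prime] [CharP E p]
    [PerfectRing E p] (π : S →+* E) (hπ : Function.Surjective π) (n : ℕ) (e : E) (y : S)
    (hy : π y ^ p ^ n = e) :
    wt_th p π hπ n (WittVector.teichmuller p e) = Ideal.Quotient.mk _ (y ^ p ^ n) := by
  have h1 : ((frobeniusEquiv E p).symm ^ n : E →+* E) e = π y := by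
    have : ((frobeniusEquiv E p).symm ^ n : E →+* E) e = ((frobeniusEquiv E p).symm)^[n] e := by
      rw [RingHom.coe_pow]; rfl
    rw [this, ← hy]
    clear this hy
    induction n with
    | zero => simp
    | succ n ih =>
      rw [Function.iterate_succ_apply, pow_succ, pow_mul, frobeniusEquiv_symm_pow, ih]
  rw [wt_th, RingHom.comp_apply, WittVector.map_teichmuller, h1, ← WittVector.map_teichmuller,
    wt_gh_map, WittVector.ghostComponent_teichmuller]

theorem wt_compat {S E : Type*} [CommRing S] [CommRing E] (p : ℕ) [Fact p.Prime] [CharP E p]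
    [PerfectRing E p] (π : S →+* E) (hπ : Function.Surjective π) (n : ℕ) :
    (Ideal.Quotient.factorPowSucc _ _).comp (wt_th p π hπ (n + 1)) = wt_th p π hπ n := by
  have hp : (p : S) ∈ RingHom.ker π := by
    rw [RingHom.mem_ker, map_natCast, CharP.cast_eq_zero]
  apply WittVector.eq_of_apply_teichmuller_eq (p := p)
  · use n + 1
    rw [← map_natCast (Ideal.Quotient.mk (RingHom.ker π ^ (n + 1))), ← map_pow,
      Ideal.Quotient.eq_zero_iff_mem]
    exact Ideal.pow_mem_pow hp _
  · intro e
    obtain ⟨z, hz⟩ := hπ (((frobeniusEquiv E p).symm)^[n+1] e)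
    have key : ∀ m, ∀ e : E, (((frobeniusEquiv E p).symm)^[m] e) ^ p ^ m = e := by
      intro m
      induction m with
      | zero => simp
      | succ m ih =>
        intro e
        rw [Function.iterate_succ_apply', pow_succ', pow_mul, frobeniusEquiv_symm_pow_p, ih]
    rw [RingHom.comp_apply, wt_th_teich p π hπ (n + 1) e z (by rw [hz, key]),
      wt_th_teich p π hπ n e (z ^ p) (by rw [map_pow, hz, ← pow_mul, ← pow_succ', key])]
    rw [← pow_mul, ← pow_succ']
    rfl

open IsAdicComplete in
theorem witt_theta {S E : Type*} [CommRing S] [CommRing E] (p : ℕ) [Fact p.Prime] [CharP E p]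
    [PerfectRing E p] (π : S →+* E) (hπ : Function.Surjective π) [IsAdicComplete (RingHom.ker π) S] :
    ∃ θ : WittVector p E →+* S, ∀ x, π (θ x) = x.coeff 0 := by
  refine ⟨Order.succ_strictMono.liftRingHom (RingHom.ker π) _ (fun {n} => wt_compat p π hπ n),
    fun x => ?_⟩
  have := Order.succ_strictMono.mk_liftRingHom (RingHom.ker π) _ (fun {n} => wt_compat p π hπ n)
    (n := 0) x
  obtain ⟨y, rfl⟩ := WittVector.map_surjective π hπ x
  have h2 : wt_th p π hπ 0 (WittVector.map π y) = Ideal.Quotient.mk _ (y.coeff 0) := by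
    have : WittVector.map ((frobeniusEquiv E p).symm ^ 0 : E →+* E) (WittVector.map (p := p) π y)
       = WittVector.map (p := p) π y := by
      ext i
      simp [WittVector.map_coeff]
    rw [wt_th, RingHom.comp_apply, this, wt_gh_map]
    congr 1
    simp [WittVector.ghostComponent_apply]
  replace this := this.trans h2
  rw [WittVector.map_coeff]
  have h3 := Ideal.Quotient.eq.1 this
  have h4 : _ ∈ RingHom.ker π := Ideal.pow_le_self (by simp) h3
  rw [RingHom.mem_ker, map_sub, sub_eq_zero] at h4
  exact h4

end PartRed2

section PartRed3a

open IsLocalRing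
theorem unit_of_pi {S E : Type*} [CommRing S] [Field E] (π : S →+* E)
    (hπ : Function.Surjective π) [IsAdicComplete (RingHom.ker π) S] (y : S) (hy : π y ≠ 0) : IsUnit y := by
  haveI : (RingHom.ker π).IsMaximal := RingHom.ker_isMaximal_of_surjective π hπ
  haveI := isLocalRing_of_isAdicComplete_maximal (RingHom.ker π)
  by_contra h
  have h2 : y ∈ maximalIdeal S := (mem_maximalIdeal y).2 h
  rw [← IsLocalRing.eq_maximalIdeal (I := RingHom.ker π) inferInstance] at h2
  exact hy h2

theorem zero_theta {S E : Type*} [CommRing S] [Field E] [CharZero E] (π : S →+* E)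
    (hπ : Function.Surjective π) [IsAdicComplete (RingHom.ker π) S] :
    ∃ θ : E →+* S, ∀ x, π (θ x) = x := by
  have hu : ∀ y : nonZeroDivisors ℤ, IsUnit (Int.castRingHom S y) := by
    intro y
    refine unit_of_pi π hπ _ ?_
    rw [eq_intCast, map_intCast]
    exact Int.cast_ne_zero.2 (nonZeroDivisors.coe_ne_zero y)
  letI : Algebra ℚ S := (IsLocalization.lift (M := nonZeroDivisors ℤ) (S := ℚ) hu).toAlgebra
  haveI : Algebra.FormallySmooth ℚ E := by
    obtain ⟨s, hs⟩ := exists_isTranscendenceBasis ℚ E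
    haveI : Algebra.IsAlgebraic (IntermediateField.adjoin ℚ (Set.range ((↑) : s → E))) E := by
      have := hs.isAlgebraic_field
      simpa using this
    exact Algebra.FormallySmooth.of_algebraicIndependent_of_isSeparable hs.1
  let e : S ⧸ RingHom.ker π ≃+* E := RingHom.quotientKerEquivOfSurjective hπ
  let f : E →ₐ[ℚ] S ⧸ RingHom.ker π := RingHom.toRatAlgHom e.symm.toRingHom
  obtain ⟨g, hg⟩ := Algebra.FormallySmooth.exists_mkₐ_comp_eq_of_isAdicComplete f
  refine ⟨g.toRingHom, fun x => ?_⟩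
  have h1 : Ideal.Quotient.mk (RingHom.ker π) (g x) = e.symm x := congrArg (fun h => h x) hg
  have h2 := congrArg e h1
  rw [RingEquiv.apply_symm_apply] at h2
  exact h2

theorem compl_data {B : Type*} [CommRing B] (b : Ideal B) (hb : b.FG) :
    IsAdicComplete (b.map (algebraMap B (AdicCompletion b B))) (AdicCompletion b B) ∧
    (∀ (s : ℕ) (y : AdicCompletion b B), ∃ q, y - algebraMap B (AdicCompletion b B) q ∈
      (b ^ s).map (algebraMap B (AdicCompletion b B))) ∧
    (∀ (s : ℕ) (q : B), algebraMap B (AdicCompletion b B) q ∈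
      (b ^ s).map (algebraMap B (AdicCompletion b B)) → q ∈ b ^ s) := by
  have key : ∀ (s : ℕ) (y : AdicCompletion b B), y ∈ (b ^ s).map (algebraMap B (AdicCompletion b B)) ↔
      AdicCompletion.eval b B s y = 0 := by
    intro s y
    rw [← LinearMap.mem_ker, ← AdicCompletion.pow_smul_top_eq_ker_eval hb, Ideal.smul_top_eq_map]
    rfl
  refine ⟨AdicCompletion.isAdicComplete_self _ hb, fun s y => ?_, fun s q hq => ?_⟩
  · obtain ⟨q, hq⟩ := Submodule.Quotient.mk_surjective _ (AdicCompletion.eval b B s y)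
    refine ⟨q, (key _ _).2 ?_⟩
    rw [map_sub, sub_eq_zero, ← hq]
    rfl
  · have := (key _ _).1 hq
    have h2 : Submodule.Quotient.mk (p := (b ^ s • ⊤ : Submodule B B)) q = 0 := this
    rw [Submodule.Quotient.mk_eq_zero] at h2
    simpa using h2

end PartRed3a

section PartRed3b

open IsLocalRing

/-- the complete statement: `S'` complete local with residue map `π` -/
theorem serre_red_p {n : ℕ} {Λ E S : Type*} [CommRing Λ] [Field E] [CommRing S] [IsLocalRing S]
    [IsNoetherianRing S] (p : Λ) (c : Λ →+* E) (hc : Function.Surjective c) (hcp : ∀ x, c x = 0 → p ∣ x)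
    (φ : MvPowerSeries (Fin n) Λ →+* S) (hφ : Function.Surjective φ)
    (P Q : Ideal S) (hP : P ≠ ⊤) (hQ : Q ≠ ⊤) (k : ℕ) (hk : maximalIdeal S ^ k ≤ P ⊔ Q)
    (hpP : φ (MvPowerSeries.C p) ∈ P) (hpQ : φ (MvPowerSeries.C p) ∈ Q) :
    ringKrullDim (S ⧸ P) + ringKrullDim (S ⧸ Q) ≤ n := by
  let a : Ideal S := Ideal.span {φ (MvPowerSeries.C p)}
  have haP : a ≤ P := (Ideal.span_singleton_le_iff_mem _).2 hpP
  have haQ : a ≤ Q := (Ideal.span_singleton_le_iff_mem _).2 hpQ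
  have ha : a ≠ ⊤ := fun h => hP (top_le_iff.1 (h ▸ haP))
  haveI : Nontrivial (S ⧸ a) := Ideal.Quotient.nontrivial_iff.2 ha
  haveI : IsLocalRing (S ⧸ a) := IsLocalRing.of_surjective' (Ideal.Quotient.mk a) Ideal.Quotient.mk_surjective
  have hs : Function.Surjective (MvPowerSeries.map (σ := Fin n) c) := by
    intro f
    choose g hg using hc
    let F : MvPowerSeries (Fin n) Λ := fun m => g (MvPowerSeries.coeff m f)
    refine ⟨F, ?_⟩
    ext m
    rw [MvPowerSeries.coeff_map]
    exact hg _
  have hker : RingHom.ker (MvPowerSeries.map (σ := Fin n) c) ≤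
      RingHom.ker ((Ideal.Quotient.mk a).comp φ) := by
    intro f hf
    have h1 : ∀ m, p ∣ MvPowerSeries.coeff m f := by
      intro m
      apply hcp
      rw [← MvPowerSeries.coeff_map, RingHom.mem_ker.1 hf, map_zero]
    choose g hg using h1
    let G : MvPowerSeries (Fin n) Λ := fun m => g m
    have h2 : f = MvPowerSeries.C p * G := by
      ext m
      rw [MvPowerSeries.coeff_C_mul, hg m]
      rfl
    rw [RingHom.mem_ker, RingHom.comp_apply, Ideal.Quotient.eq_zero_iff_mem, h2, map_mul]
    exact Ideal.mul_mem_right _ _ (Ideal.mem_span_singleton_self _)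
  let ψ : MvPowerSeries (Fin n) E →+* S ⧸ a :=
    RingHom.liftOfSurjective _ hs ⟨(Ideal.Quotient.mk a).comp φ, hker⟩
  have hψ : Function.Surjective ψ := by
    intro y
    obtain ⟨y, rfl⟩ := Ideal.Quotient.mk_surjective y
    obtain ⟨f, rfl⟩ := hφ y
    exact ⟨MvPowerSeries.map c f, RingHom.liftOfSurjective_comp_apply ..⟩
  have hcm : ∀ P : Ideal S, a ≤ P → (P.map (Ideal.Quotient.mk a)).comap (Ideal.Quotient.mk a) = P := by
    intro P hP
    rw [Ideal.comap_map_of_surjective' _ Ideal.Quotient.mk_surjective, Ideal.mk_ker]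
    exact sup_eq_left.2 hP
  have hnt : ∀ P : Ideal S, a ≤ P → P ≠ ⊤ → P.map (Ideal.Quotient.mk a) ≠ ⊤ := by
    intro P h1 h2 h3
    rw [← hcm P h1, h3, Ideal.comap_top] at h2
    exact h2 rfl
  have := serre_field ψ hψ (P.map (Ideal.Quotient.mk a)) (Q.map (Ideal.Quotient.mk a)) (hnt P haP hP)
    (hnt Q haQ hQ) k (by
      rw [← Ideal.map_sup, ← IsLocalRing.map_maximalIdeal_of_surjective (Ideal.Quotient.mk a) Ideal.Quotient.mk_surjective, ← Ideal.map_pow]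
      exact Ideal.map_mono hk)
  rwa [← quot_comap_dim (Ideal.Quotient.mk a) Ideal.Quotient.mk_surjective, hcm P haP,
    ← quot_comap_dim (Ideal.Quotient.mk a) Ideal.Quotient.mk_surjective, hcm Q haQ] at this

theorem serre_dims {S S' : Type*} [CommRing S] [IsLocalRing S] [IsNoetherianRing S]
    [CommRing S'] [IsLocalRing S'] [IsNoetherianRing S'] [Algebra S S'] [Module.Flat S S']
    (hm : maximalIdeal S' = (maximalIdeal S).map (algebraMap S S')) (P : Ideal S) (hP : P ≠ ⊤) :
    P.map (algebraMap S S') ≠ ⊤ ∧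
    ringKrullDim (S' ⧸ P.map (algebraMap S S')) = ringKrullDim (S ⧸ P) := by
  constructor
  · intro h
    have := Ideal.map_mono (f := algebraMap S S') (le_maximalIdeal hP)
    rw [h, ← hm, top_le_iff] at this
    exact (maximalIdeal.isMaximal S').ne_top this
  · rw [flat_dim_quot hm.ge P hP, ← hm]
    haveI : IsField (S' ⧸ maximalIdeal S') := (Ideal.Quotient.maximal_ideal_iff_isField_quotient _).1 inferInstance
    rw [ringKrullDim_eq_zero_of_isField this, add_zero]

theorem serre_level2 {n : ℕ} {S S' E : Type*} [CommRing S] [IsLocalRing S] [IsNoetherianRing S]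
    [CommRing S'] [Algebra S S'] [Field E] (π : S' →+* E)
    (hπ : Function.Surjective π) (hker : RingHom.ker π = (maximalIdeal S).map (algebraMap S S'))
    [IsAdicComplete (RingHom.ker π) S'] (hflat : IsNoetherianRing S' → IsLocalRing S' → Module.Flat S S')
    (hE : CharZero E ∨ ∃ (p : ℕ) (_ : Fact p.Prime) (_ : CharP E p), PerfectRing E p)
    (x : Fin n → S) (hx : Ideal.span (Set.range x) = maximalIdeal S) (P Q : Ideal S) [P.IsPrime] [Q.IsPrime]
    (k : ℕ) (hk : maximalIdeal S ^ k ≤ P ⊔ Q) :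
    ringKrullDim (S ⧸ P) + ringKrullDim (S ⧸ Q) ≤ n := by
  haveI hmax : (RingHom.ker π).IsMaximal := RingHom.ker_isMaximal_of_surjective π hπ
  haveI := isLocalRing_of_isAdicComplete_maximal (RingHom.ker π)
  have hm : RingHom.ker π = maximalIdeal S' := IsLocalRing.eq_maximalIdeal hmax
  have hx' : Ideal.span (Set.range (fun i => algebraMap S S' (x i))) = RingHom.ker π := by
    rw [hker, ← hx, Ideal.map_span, ← Set.range_comp]
    rfl
  have hk' : maximalIdeal S' ^ k ≤ P.map (algebraMap S S') ⊔ Q.map (algebraMap S S') := by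
    rw [← Ideal.map_sup, ← hm, hker, ← Ideal.map_pow]
    exact Ideal.map_mono hk
  rcases hE with hE | ⟨p, hp, hchar, hperf⟩
  · obtain ⟨θ, hθ⟩ := zero_theta π hπ
    obtain ⟨φ, -, -, hφ⟩ := mvps_lift_surj (RingHom.ker π) θ _ hx' (fun y => ⟨π y, by
      rw [RingHom.mem_ker, map_sub, hθ, sub_self]⟩)
    haveI : IsNoetherianRing S' := isNoetherianRing_of_surjective _ _ φ hφ
    haveI := hflat inferInstance inferInstance
    obtain ⟨hP, hP'⟩ := serre_dims (hm.symm.trans hker) P ‹P.IsPrime›.ne_top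
    obtain ⟨hQ, hQ'⟩ := serre_dims (hm.symm.trans hker) Q ‹Q.IsPrime›.ne_top
    rw [← hP', ← hQ']
    exact serre_field φ hφ _ _ hP hQ k hk'
  · obtain ⟨θ, hθ⟩ := witt_theta p π hπ
    obtain ⟨φ, hφC, hφX, hφ⟩ := mvps_lift_surj (RingHom.ker π) θ _ hx' (fun y =>
      ⟨WittVector.teichmuller p (π y), by
        rw [RingHom.mem_ker, map_sub, hθ, WittVector.teichmuller_coeff_zero, sub_self]⟩)
    have hmW : maximalIdeal (WittVector p E) = Ideal.span {(p : WittVector p E)} :=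
      Irreducible.maximalIdeal_eq (WittVector.irreducible p)
    haveI : IsNoetherianRing S' := isNoetherianRing_of_surjective _ _ φ hφ
    haveI := hflat inferInstance inferInstance
    obtain ⟨hP, hP'⟩ := serre_dims (hm.symm.trans hker) P ‹P.IsPrime›.ne_top
    obtain ⟨hQ, hQ'⟩ := serre_dims (hm.symm.trans hker) Q ‹Q.IsPrime›.ne_top
    have hX : maximalIdeal S' = Ideal.span (Set.range fun i => φ (MvPowerSeries.X i)) := by
      rw [← hm, ← hx']
      congr 2
      funext i
      rw [hφX]
    have hpp : φ (MvPowerSeries.C (p : WittVector p E)) = algebraMap S S' (p : S) := by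
      rw [hφC, map_natCast, map_natCast]
    have hreg : ∀ P : Ideal S, P.IsPrime → (p : S) ∉ P →
        ∀ y, φ (MvPowerSeries.C (p : WittVector p E)) * y ∈ P.map (algebraMap S S') →
          y ∈ P.map (algebraMap S S') := by
      intro P hP hpP y hy
      rw [hpp] at hy
      exact flat_colon P P (p : S) (fun y hy => (hP.mem_or_mem hy).resolve_left hpP) y hy
    rw [← hP', ← hQ']
    by_cases hpP : (p : S) ∈ P
    · by_cases hpQ : (p : S) ∈ Q
      · refine serre_red_p (p : WittVector p E) WittVector.constantCoeff
          (fun e => ⟨WittVector.teichmuller p e, WittVector.teichmuller_coeff_zero p e⟩) ?_ φ hφ _ _ hP hQ k hk'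
          (hpp ▸ Ideal.mem_map_of_mem _ hpP) (hpp ▸ Ideal.mem_map_of_mem _ hpQ)
        intro w hw
        rw [← Ideal.mem_span_singleton, ← hmW, mem_maximalIdeal]
        intro hu
        have := hu.map WittVector.constantCoeff
        rw [hw] at this
        exact not_isUnit_zero this
      · rw [add_comm]
        exact serre_dvr _ hmW φ hφ hX _ _ hQ hP k (sup_comm (P.map (algebraMap S S')) _ ▸ hk') (hreg Q inferInstance hpQ)
    · exact serre_dvr _ hmW φ hφ hX _ _ hP hQ k hk' (hreg P inferInstance hpP)

theorem serre_of_compl {n : ℕ} {S B S' E : Type*} [CommRing S] [IsLocalRing S] [IsNoetherianRing S]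
    [CommRing B] [Algebra S B] [Module.Flat S B] [CommRing S'] [Algebra B S'] [Algebra S S']
    [IsScalarTower S B S'] [Field E] (π : B →+* E)
    (hπ : Function.Surjective π) (b : Ideal B) (hb : RingHom.ker π = b)
    (hker : b = (maximalIdeal S).map (algebraMap S B))
    (c1 : IsAdicComplete (b.map (algebraMap B S')) S')
    (c2 : ∀ (s : ℕ) (y : S'), ∃ q, y - algebraMap B S' q ∈ (b ^ s).map (algebraMap B S'))
    (c3 : ∀ (s : ℕ) (q : B), algebraMap B S' q ∈ (b ^ s).map (algebraMap B S') → q ∈ b ^ s)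
    (hE : CharZero E ∨ ∃ (p : ℕ) (_ : Fact p.Prime) (_ : CharP E p), PerfectRing E p)
    (x : Fin n → S) (hx : Ideal.span (Set.range x) = maximalIdeal S) (P Q : Ideal S) [P.IsPrime] [Q.IsPrime]
    (k : ℕ) (hk : maximalIdeal S ^ k ≤ P ⊔ Q) :
    ringKrullDim (S ⧸ P) + ringKrullDim (S ⧸ Q) ≤ n := by
  let b' := b.map (algebraMap B S')
  let q : B ⧸ b →+* S' ⧸ b' := Ideal.quotientMap b' (algebraMap B S') Ideal.le_comap_map
  have hq : Function.Bijective q := by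
    constructor
    · refine Ideal.quotientMap_injective' ?_
      intro y hy
      have := c3 1 y (by simpa using hy)
      simpa using this
    · intro y
      obtain ⟨y, rfl⟩ := Ideal.Quotient.mk_surjective y
      obtain ⟨z, hz⟩ := c2 1 y
      refine ⟨Ideal.Quotient.mk b z, ?_⟩
      rw [Ideal.quotientMap_mk]
      symm
      exact Ideal.Quotient.eq.2 (by simpa using hz)
  let e : S' ⧸ b' ≃+* E := (RingEquiv.ofBijective q hq).symm.trans
    ((Ideal.quotEquivOfEq hb.symm).trans (RingHom.quotientKerEquivOfSurjective hπ))
  let π' : S' →+* E := e.toRingHom.comp (Ideal.Quotient.mk b')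
  have hπ' : Function.Surjective π' := e.surjective.comp Ideal.Quotient.mk_surjective
  have hk' : RingHom.ker π' = b' := by
    ext y
    rw [RingHom.mem_ker, ← Ideal.Quotient.eq_zero_iff_mem]
    exact map_eq_zero_iff e e.injective
  have hmb : ∀ s, ((maximalIdeal S) ^ s).map (algebraMap S S') = (b ^ s).map (algebraMap B S') := by
    intro s
    rw [hker, ← Ideal.map_pow, Ideal.map_map, ← IsScalarTower.algebraMap_eq]
  have hb' : b' = (maximalIdeal S).map (algebraMap S S') := by
    have := hmb 1
    simpa using this.symm
  haveI : IsAdicComplete (RingHom.ker π') S' := by rw [hk']; exact c1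
  refine serre_level2 π' hπ' (hk'.trans hb') ?_ hE x hx P Q k hk
  intro _ _
  refine flat_dense (RingHom.id S) (algebraMap B S') (fun p => ?_) (maximalIdeal S) (maximalIdeal S)
    (Ideal.map_id _).le ?_ (fun s x => ⟨x, by simp⟩) ?_ ?_
  · exact (IsScalarTower.algebraMap_apply S B S' p).symm
  · rw [← hb']
    exact IsAdicComplete.le_jacobson_bot b'
  · intro s y
    rw [hmb]
    exact c2 s y
  · intro s y hy
    rw [hmb] at hy
    have := c3 s y hy
    rwa [hker, ← Ideal.map_pow] at this

theorem serre_of_ext {n : ℕ} {S B E : Type*} [CommRing S] [IsLocalRing S] [IsNoetherianRing S]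
    [CommRing B] [Algebra S B] [Module.Flat S B] [Field E] (π : B →+* E)
    (hπ : Function.Surjective π) (hker : RingHom.ker π = (maximalIdeal S).map (algebraMap S B))
    (hE : CharZero E ∨ ∃ (p : ℕ) (_ : Fact p.Prime) (_ : CharP E p), PerfectRing E p)
    (x : Fin n → S) (hx : Ideal.span (Set.range x) = maximalIdeal S) (P Q : Ideal S) [P.IsPrime] [Q.IsPrime]
    (k : ℕ) (hk : maximalIdeal S ^ k ≤ P ⊔ Q) :
    ringKrullDim (S ⧸ P) + ringKrullDim (S ⧸ Q) ≤ n := by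
  have hfg : (RingHom.ker π).FG := by
    rw [hker]
    exact Ideal.FG.map (IsNoetherian.noetherian _) _
  obtain ⟨c1, c2, c3⟩ := compl_data (RingHom.ker π) hfg
  exact serre_of_compl (S' := AdicCompletion (RingHom.ker π) B) π hπ _ rfl hker c1 c2 c3 hE x hx P Q k hk

end PartRed3b

section PartRed4a

open Polynomial

def pind (p : ℕ) {k : Type*} [Field k] (H : Subgroup kˣ) : Prop :=
  ∀ (s : Finset kˣ) (c : kˣ → k), (∀ h ∈ s, h ∈ H) →
    (∀ h ∈ s, ∀ h' ∈ s, ∀ w ∈ H, h = h' * w ^ p → h = h') →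
    ∑ h ∈ s, c h ^ p * (h : k) = 0 → ∀ h ∈ s, c h = 0

theorem pind_family {p : ℕ} {k ι : Type*} [Field k] {H : Subgroup kˣ} (hH : pind p H)
    (s : Finset ι) (g : ι → kˣ) (c : ι → k) (h1 : ∀ i ∈ s, g i ∈ H)
    (h2 : ∀ i ∈ s, ∀ j ∈ s, ∀ w ∈ H, g i = g j * w ^ p → i = j)
    (h3 : ∑ i ∈ s, c i ^ p * (g i : k) = 0) : ∀ i ∈ s, c i = 0 := by
  classical
  have hinj : Set.InjOn g s := fun i hi j hj hij => h2 i hi j hj 1 H.one_mem (by rw [hij]; simp)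
  rcases s.eq_empty_or_nonempty with rfl | ⟨i0, hi0⟩
  · simp
  haveI : Nonempty ι := ⟨i0⟩
  let gi := Function.invFunOn g s
  have hgi : ∀ i ∈ s, gi (g i) = i := fun i hi => hinj.leftInvOn_invFunOn hi
  have := hH (s.image g) (fun h => c (gi h)) (by
      intro h hh
      obtain ⟨i, hi, rfl⟩ := Finset.mem_image.1 hh
      exact h1 i hi) (by
      intro h hh h' hh' w hw e
      obtain ⟨i, hi, rfl⟩ := Finset.mem_image.1 hh
      obtain ⟨j, hj, rfl⟩ := Finset.mem_image.1 hh'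
      rw [h2 i hi j hj w hw e]) (by
      rw [Finset.sum_image hinj, ← h3]
      exact Finset.sum_congr rfl fun i hi => by rw [hgi i hi])
  intro i hi
  have h := this (g i) (Finset.mem_image_of_mem _ hi)
  rwa [hgi i hi] at h

theorem pfield {p : ℕ} [Fact p.Prime] {k : Type*} [Field k] [CharP k p] (H : Subgroup kˣ) :
    ∃ L : Subfield k, (∀ c : k, c ^ p ∈ L) ∧ (∀ h ∈ H, (h : k) ∈ L) ∧
      ∀ y ∈ L, ∃ (n : ℕ) (f : Fin n → k) (g : Fin n → kˣ), (∀ i, g i ∈ H) ∧ y = ∑ i, f i ^ p * (g i : k) := by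
  let R : Subfield k := (frobenius k p).fieldRange
  let HM : Submonoid k := H.toSubmonoid.map (Units.coeHom k)
  have hR : ∀ c : k, c ^ p ∈ R := fun c => ⟨c, rfl⟩
  have halg : ∀ x ∈ (HM : Set k), IsAlgebraic R x := by
    intro x _
    refine ⟨X ^ p - C (⟨x ^ p, hR x⟩ : R), X_pow_sub_C_ne_zero (Fact.out : p.Prime).pos _, ?_⟩
    simp [Algebra.algebraMap_ofSubsemiring_apply, Subfield.algebraMap_ofSubfield]
  let L := IntermediateField.adjoin R (HM : Set k)
  have hL : L.toSubalgebra = Algebra.adjoin R (HM : Set k) :=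
    IntermediateField.adjoin_toSubalgebra_of_isAlgebraic halg
  refine ⟨L.toSubfield, fun c => ?_, fun h hh => ?_, fun y hy => ?_⟩
  · exact L.algebraMap_mem ⟨c ^ p, hR c⟩
  · exact IntermediateField.subset_adjoin R _ ⟨h, hh, rfl⟩
  · have h1 : y ∈ L.toSubalgebra := hy
    rw [hL, ← Subalgebra.mem_toSubmodule, Algebra.adjoin_eq_span, Submonoid.closure_eq,
      Submodule.mem_span_set'] at h1
    obtain ⟨n, f, g, hfg⟩ := h1
    choose f' hf' using fun i => (f i).2
    choose g' hg' using fun i => (g i).2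
    refine ⟨n, f', g', fun i => (hg' i).1, ?_⟩
    rw [← hfg]
    refine Finset.sum_congr rfl fun i _ => ?_
    rw [Subfield.smul_def, smul_eq_mul, ← hf' i, ← (hg' i).2]
    rfl

theorem pow_indep {p : ℕ} [Fact p.Prime] {k : Type*} [Field k] [CharP k p] (L : Subfield k) (c : k)
    (hcp : c ^ p ∈ L) (hc : c ∉ L) (l : ℕ → k) (hl : ∀ r, l r ∈ L)
    (hs : ∑ r ∈ Finset.range p, l r * c ^ r = 0) : ∀ r < p, l r = 0 := by
  have hirr : Irreducible (X ^ p - C (⟨c ^ p, hcp⟩ : L)) := by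
    apply X_pow_sub_C_irreducible_of_prime Fact.out
    intro b hb
    have h1 : (b : k) ^ p = c ^ p := congrArg Subtype.val hb
    have h2 : (b : k) = c := frobenius_inj k p h1
    exact hc (h2 ▸ b.2)
  have hmin : X ^ p - C (⟨c ^ p, hcp⟩ : L) = minpoly L c := by
    apply minpoly.eq_of_irreducible_of_monic hirr
    · simp [Subfield.algebraMap_ofSubfield]
    · exact monic_X_pow_sub_C _ (Fact.out : p.Prime).ne_zero
  let q : L[X] := ∑ r ∈ Finset.range p, monomial r ⟨l r, hl r⟩
  have hq : aeval c q = 0 := by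
    rw [map_sum, ← hs]
    refine Finset.sum_congr rfl fun r _ => ?_
    rw [aeval_monomial]
    rfl
  have hq0 : q = 0 := by
    by_contra h
    have h1 := minpoly.degree_le_of_ne_zero L c h hq
    rw [← hmin, degree_X_pow_sub_C (Fact.out : p.Prime).pos] at h1
    have h2 : q.degree < p := by
      refine (degree_sum_le _ _).trans_lt ?_
      rw [Finset.sup_lt_iff (WithBot.bot_lt_coe _)]
      intro r hr
      refine (degree_monomial_le _ _).trans_lt ?_
      exact_mod_cast Finset.mem_range.1 hr
    exact absurd h1 (not_le.2 h2)
  intro r hr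
  have h3 : q.coeff r = ⟨l r, hl r⟩ := by
    simp only [q, finset_sum_coeff, coeff_monomial]
    rw [Finset.sum_ite_eq' ]
    simp [hr]
  rw [hq0, coeff_zero] at h3
  exact (congrArg Subtype.val h3).symm

theorem pind_ext {p : ℕ} [Fact p.Prime] {k : Type*} [Field k] [CharP k p] (H : Subgroup kˣ) (hH : pind p H)
    (L : Subfield k) (h1 : ∀ c : k, c ^ p ∈ L) (h2 : ∀ h ∈ H, (h : k) ∈ L) (c : kˣ) (hc : (c : k) ∉ L) :
    pind p (H ⊔ Subgroup.zpowers c) := by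
  classical
  intro s d hs hd hsum
  have hp0 : (p : ℤ) ≠ 0 := by exact_mod_cast (Fact.out : p.Prime).ne_zero
  have hy : ∀ h : kˣ, ∃ y ∈ H, ∃ n : ℤ, h ∈ s → h = y * c ^ n := by
    intro h
    by_cases hh : h ∈ s
    · obtain ⟨y, hy, z, hz, e⟩ := Subgroup.mem_sup.1 (hs h hh)
      obtain ⟨n, rfl⟩ := Subgroup.mem_zpowers_iff.1 hz
      exact ⟨y, hy, n, fun _ => e.symm⟩
    · exact ⟨1, H.one_mem, 0, fun h => absurd h hh⟩
  choose y hyH n hn using hy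
  let r : kˣ → ℕ := fun h => (n h % p).toNat
  have hr : ∀ h, ((r h : ℕ) : ℤ) = n h % p := fun h => Int.toNat_of_nonneg (Int.emod_nonneg _ hp0)
  have hrp : ∀ h, r h < p := by
    intro h
    have := Int.emod_lt_of_pos (n h) (b := p) (by exact_mod_cast (Fact.out : p.Prime).pos)
    rw [← hr] at this
    exact_mod_cast this
  let q : kˣ → ℤ := fun h => n h / p
  have hn2 : ∀ h ∈ s, h = y h * (c ^ (q h)) ^ p * c ^ (r h) := by
    intro h hh
    conv_lhs => rw [hn h hh]
    rw [mul_assoc, ← zpow_natCast, ← zpow_natCast, ← zpow_mul, ← zpow_add, hr]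
    congr 2
    rw [mul_comm]
    exact (Int.mul_ediv_add_emod _ _).symm
  let inner : ℕ → k := fun j => ∑ h ∈ s with r h = j, (d h * ((c ^ (q h) : kˣ) : k)) ^ p * (y h : k)
  have hin : ∀ j, inner j ∈ L := fun j =>
    sum_mem fun h _ => mul_mem (h1 _) (h2 _ (hyH h))
  have hz : ∑ j ∈ Finset.range p, inner j * (c : k) ^ j = 0 := by
    rw [← hsum, ← Finset.sum_fiberwise_of_maps_to (s := s) (t := Finset.range p) (g := r)
      (fun h _ => Finset.mem_range.2 (hrp h))]
    refine Finset.sum_congr rfl fun j _ => ?_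
    rw [Finset.sum_mul]
    refine Finset.sum_congr rfl fun h hh => ?_
    obtain ⟨hh1, rfl⟩ := Finset.mem_filter.1 hh
    have e : (h : k) = (y h : k) * ((c ^ (q h) : kˣ) : k) ^ p * (c : k) ^ (r h) := by
      have := congrArg Units.val (hn2 h hh1)
      simpa using this
    rw [mul_pow]
    conv_rhs => rw [e]
    ring
  have hall := pow_indep L (c : k) (h1 _) hc inner hin hz
  intro h hh
  have := pind_family hH (s.filter (fun h' => r h' = r h)) y (fun h' => d h' * ((c ^ (q h') : kˣ) : k))
    (fun i _ => hyH i) (by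
      intro i hi j hj w hw e
      obtain ⟨hi, hi'⟩ := Finset.mem_filter.1 hi
      obtain ⟨hj, hj'⟩ := Finset.mem_filter.1 hj
      refine hd i hi j hj (w * c ^ (q i) * (c ^ (q j))⁻¹) ?_ ?_
      · refine mul_mem (mul_mem (Subgroup.mem_sup_left hw) ?_) (inv_mem ?_)
        · exact Subgroup.mem_sup_right (Subgroup.zpow_mem_zpowers _ _)
        · exact Subgroup.mem_sup_right (Subgroup.zpow_mem_zpowers _ _)
      · conv_lhs => rw [hn2 i hi, e, hi']
        conv_rhs => lhs; rw [hn2 j hj, hj']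
        apply Units.ext
        push_cast
        have h0 : ((c : k) ^ (q j)) ≠ 0 := zpow_ne_zero _ (Units.ne_zero c)
        rw [mul_pow, mul_pow, inv_pow]
        field_simp) (hall (r h) (hrp h)) h (Finset.mem_filter.2 ⟨hh, rfl⟩)
  exact (mul_eq_zero.1 this).resolve_right (Units.ne_zero _)

theorem pind_zpow {p : ℕ} [Fact p.Prime] {k : Type*} [Field k] [CharP k p] (H : Subgroup kˣ) (hH : pind p H)
    (L : Subfield k) (h1 : ∀ c : k, c ^ p ∈ L) (h2 : ∀ h ∈ H, (h : k) ∈ L) (c : kˣ) (hc : (c : k) ∉ L)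
    (n : ℤ) (hn : c ^ n ∈ H) : n = 0 := by
  classical
  have hp : p.Prime := Fact.out
  induction hN : n.natAbs using Nat.strong_induction_on generalizing n with
  | _ N ih =>
  by_contra hne
  by_cases hdvd : (p : ℤ) ∣ n
  · obtain ⟨m, rfl⟩ := hdvd
    have hm0 : m ≠ 0 := by rintro rfl; simp at hne
    have hlt : m.natAbs < N := by
      rw [← hN, Int.natAbs_mul, Int.natAbs_natCast]
      have : 0 < m.natAbs := Int.natAbs_pos.2 hm0
      nlinarith [hp.two_le]
    refine hm0 (ih _ hlt m ?_ rfl)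
    by_contra hcm
    have hfr : (c ^ ((p : ℤ) * m)) = (c ^ m) ^ p := by
      rw [mul_comm, zpow_mul, zpow_natCast]
    rw [hfr] at hn
    -- family {1, (c^m)^p}
    have := pind_family hH (Finset.univ : Finset Bool) (fun b => if b then 1 else (c ^ m) ^ p)
      (fun b => if b then ((c ^ m : kˣ) : k) else -1) (by
        intro i _
        cases i
        · simpa using hn
        · simp) (by
        intro i _ j _ w hw e
        cases i <;> cases j
        · rfl
        · exfalso
          simp only [Bool.false_eq_true, if_false, if_true, one_mul] at e
          have : c ^ m = w := Units.ext (frobenius_inj k p (by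
            have := congrArg Units.val e
            rw [Units.val_pow_eq_pow_val, Units.val_pow_eq_pow_val] at this
            exact this))
          exact hcm (this ▸ hw)
        · exfalso
          simp only [Bool.false_eq_true, if_false, if_true] at e
          have : 1 = c ^ m * w := Units.ext (frobenius_inj k p (by
            have := congrArg Units.val e
            simpa [frobenius_def, mul_pow] using this))
          rw [eq_comm, mul_eq_one_iff_eq_inv] at this
          exact hcm (this ▸ inv_mem hw)
        · rfl) (by
        have hneg : (-1 : k) ^ p = -1 := by
          have := map_neg (frobenius k p) 1
          simpa [frobenius_def] using this
        simp [hneg]) true (Finset.mem_univ _)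
    exact Units.ne_zero (c ^ m) (by simpa using this)
  · have hcop : IsCoprime (p : ℤ) n := (Nat.prime_iff_prime_int.1 hp).irreducible.coprime_iff_not_dvd.2 hdvd
    obtain ⟨a, b, hab⟩ := hcop
    apply hc
    have : (c : k) = ((c : k) ^ p) ^ a * ((c ^ n : kˣ) : k) ^ b := by
      rw [Units.val_zpow_eq_zpow_val, ← zpow_natCast, ← zpow_mul, ← zpow_mul, ← zpow_add₀ (Units.ne_zero c)]
      rw [mul_comm (p : ℤ) a, mul_comm n b, hab, zpow_one]
    rw [this]
    exact mul_mem (zpow_mem (h1 _) _) (zpow_mem (h2 _ hn) _)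

end PartRed4a

section PartRed4b

theorem chain_finset {U : Type*} [Group U] (c : Set (Subgroup U)) (hc : IsChain (· ≤ ·) c) (H0 : Subgroup U)
    (hH0 : H0 ∈ c) {ι : Type*} (s : Finset ι) (q : ι → U) (hq : ∀ i ∈ s, ∃ H ∈ c, q i ∈ H) :
    ∃ H ∈ c, ∀ i ∈ s, q i ∈ H := by
  classical
  induction s using Finset.induction_on with
  | empty => exact ⟨H0, hH0, by simp⟩
  | insert a s _ ih =>
    obtain ⟨H1, h1, h1'⟩ := ih fun i hi => hq i (Finset.mem_insert_of_mem hi)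
    obtain ⟨H2, h2, h2'⟩ := hq a (Finset.mem_insert_self _ _)
    rcases hc.total h1 h2 with h | h
    · refine ⟨H2, h2, fun i hi => ?_⟩
      rcases Finset.mem_insert.1 hi with rfl | hi
      · exact h2'
      · exact h (h1' i hi)
    · refine ⟨H1, h1, fun i hi => ?_⟩
      rcases Finset.mem_insert.1 hi with rfl | hi
      · exact h h2'
      · exact h1' i hi

theorem pbasis_exists {p : ℕ} [Fact p.Prime] {k U : Type*} [Field k] [CharP k p] [CommGroup U] (f : U →* kˣ)
    (hf : Function.Surjective f) : ∃ H : Subgroup U, (∀ h ∈ H, f h = 1 → h = 1) ∧ pind p (H.map f) ∧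
      ∀ y : k, ∃ (n : ℕ) (F : Fin n → k) (g : Fin n → kˣ), (∀ i, g i ∈ H.map f) ∧ y = ∑ i, F i ^ p * (g i : k) := by
  have hp : p.Prime := Fact.out
  obtain ⟨H, hH⟩ := zorn_le₀ {H : Subgroup U | (∀ h ∈ H, f h = 1 → h = 1) ∧ pind p (H.map f)} (by
    intro c hc hch
    rcases c.eq_empty_or_nonempty with rfl | hne
    · refine ⟨⊥, ⟨?_, ?_⟩, by simp⟩
      · intro h hh _
        exact Subgroup.mem_bot.1 hh
      · intro s d hs _ hsum h hh
        rw [Subgroup.map_bot] at hs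
        have hs1 : s = {1} := by
          apply Finset.eq_singleton_iff_unique_mem.2
          have h1 := Subgroup.mem_bot.1 (hs h hh)
          exact ⟨h1 ▸ hh, fun x hx => Subgroup.mem_bot.1 (hs x hx)⟩
        have h1 := Subgroup.mem_bot.1 (hs h hh)
        subst h1
        rw [hs1, Finset.sum_singleton, Units.val_one, mul_one] at hsum
        exact eq_zero_of_pow_eq_zero hsum
    · have hmem : ∀ {x}, x ∈ sSup c ↔ ∃ s ∈ c, x ∈ s := Subgroup.mem_sSup_of_directedOn hne hch.directedOn
      refine ⟨sSup c, ⟨?_, ?_⟩, fun z hz => le_sSup hz⟩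
      · intro h hh h1
        obtain ⟨s, hs, hs'⟩ := hmem.1 hh
        exact (hc hs).1 h hs' h1
      · intro s d hs hd hsum
        have hpre : ∀ x : kˣ, ∃ u : U, x ∈ s → u ∈ sSup c ∧ f u = x := by
          intro x
          by_cases hx : x ∈ s
          · obtain ⟨u, hu, hu'⟩ := hs x hx
            exact ⟨u, fun _ => ⟨hu, hu'⟩⟩
          · exact ⟨1, fun h => absurd h hx⟩
        choose u hu using hpre
        obtain ⟨H0, hH0⟩ := hne
        obtain ⟨H, hH, hHs⟩ := chain_finset c hch H0 hH0 s u (fun x hx => hmem.1 (hu x hx).1)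
        refine (hc hH).2 s d (fun h hh => ⟨u h, hHs h hh, (hu h hh).2⟩) ?_ hsum
        intro h hh h' hh' w hw
        exact hd h hh h' hh' w (Subgroup.map_mono (le_sSup hH) hw))
  refine ⟨H, hH.prop.1, hH.prop.2, ?_⟩
  obtain ⟨L, hL1, hL2, hL3⟩ := pfield (p := p) (H.map f)
  by_contra hcon
  have : ∃ y : k, y ∉ L := by
    by_contra! h
    exact hcon fun y => hL3 y (h y)
  obtain ⟨y, hy⟩ := this
  have hy0 : y ≠ 0 := fun h => hy (h ▸ L.zero_mem)
  obtain ⟨u, hu⟩ := hf (Units.mk0 y hy0)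
  have hyu : ((f u : kˣ) : k) = y := by rw [hu]; rfl
  have hmap : (H ⊔ Subgroup.zpowers u).map f = H.map f ⊔ Subgroup.zpowers (f u) := by
    rw [Subgroup.map_sup, MonoidHom.map_zpowers]
  have hle := hH.le_of_ge (y := H ⊔ Subgroup.zpowers u) ⟨by
      intro h hh h1
      obtain ⟨a, ha, b, hb, rfl⟩ := Subgroup.mem_sup.1 hh
      obtain ⟨n, rfl⟩ := Subgroup.mem_zpowers_iff.1 hb
      have hn : n = 0 := by
        refine pind_zpow (H.map f) hH.prop.2 L hL1 hL2 (f u) (by rw [hyu]; exact hy) n ?_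
        rw [map_mul, map_zpow, mul_comm, mul_eq_one_iff_eq_inv] at h1
        rw [h1]
        exact inv_mem ⟨a, ha, rfl⟩
      subst hn
      rw [zpow_zero, mul_one] at h1 ⊢
      exact hH.prop.1 a ha h1, by
      rw [hmap]
      exact pind_ext (H.map f) hH.prop.2 L hL1 hL2 (f u) (by rw [hyu]; exact hy)⟩ le_sup_left
  have huH : u ∈ H := hle (Subgroup.mem_sup_right (Subgroup.mem_zpowers u))
  exact hy (hyu ▸ hL2 (f u) ⟨u, huH, rfl⟩)

theorem group_indep {k K ι : Type*} [CommRing k] [CommRing K] (f : k →+* K) (g : ι → K)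
    (rep : ι → ι) (u : ι → k) (hu : ∀ i, g i = f (u i) * g (rep i)) (hrep : ∀ i, rep (rep i) = rep i)
    (hInd : ∀ t : Finset ι, (∀ i ∈ t, rep i = i) → ∀ c : ι → k, ∑ i ∈ t, f (c i) * g i = 0 → ∀ i ∈ t, c i = 0)
    (s : Finset ι) (c : ι → k) (hs : ∑ i ∈ s, f (c i) * g i = 0) (j : ι) [DecidableEq ι] :
    ∑ i ∈ s with rep i = j, c i * u i = 0 := by
  by_cases hj : j ∈ s.image rep
  · refine hInd (s.image rep) ?_ (fun j => ∑ i ∈ s with rep i = j, c i * u i) ?_ j hj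
    · intro i hi
      obtain ⟨i, -, rfl⟩ := Finset.mem_image.1 hi
      exact hrep i
    · rw [← hs, ← Finset.sum_fiberwise_of_maps_to (s := s) (t := s.image rep) (g := rep)
        (fun h hh => Finset.mem_image_of_mem _ hh)]
      refine Finset.sum_congr rfl fun j _ => ?_
      rw [map_sum, Finset.sum_mul]
      refine Finset.sum_congr rfl fun i hi => ?_
      obtain ⟨_, rfl⟩ := Finset.mem_filter.1 hi
      conv_rhs => rw [hu i]
      rw [map_mul, mul_assoc]
  · rw [Finset.filter_false_of_mem, Finset.sum_empty]
    intro i hi h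
    exact hj (h ▸ Finset.mem_image_of_mem _ hi)

/-- independence in the perfect closure -/
theorem perf_indep {p : ℕ} [Fact p.Prime] {k E : Type*} [Field k] [CharP k p] [Field E] [CharP E p] (ι : k →+* E)
    (H : Subgroup kˣ) (hH : pind p H) (n : ℕ) : ∀ (s : Finset Eˣ)
    (_ : ∀ g ∈ s, g ^ p ^ n ∈ H.map (Units.map ι.toMonoidHom))
    (_ : ∀ g ∈ s, ∀ g' ∈ s, g / g' ∈ H.map (Units.map ι.toMonoidHom) → g = g')
    (c : Eˣ → k) (_ : ∑ g ∈ s, ι (c g) * (g : E) = 0), ∀ g ∈ s, c g = 0 := by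
  classical
  set HE := H.map (Units.map ι.toMonoidHom) with hHE
  have hfinj : ∀ a b : Eˣ, a ^ p = b ^ p → a = b := by
    intro a b h
    refine Units.ext (frobenius_inj E p ?_)
    have := congrArg Units.val h
    rw [Units.val_pow_eq_pow_val, Units.val_pow_eq_pow_val] at this
    exact this
  have hιinj : ∀ a b : kˣ, Units.map ι.toMonoidHom a = Units.map ι.toMonoidHom b → a = b := by
    intro a b h
    exact Units.ext (ι.injective (congrArg Units.val h))
  induction n with
  | zero =>
    intro s h1 h2 c h3 g hg
    have hs : s = {g} := by
      refine Finset.eq_singleton_iff_unique_mem.2 ⟨hg, fun g' hg' => h2 g' hg' g hg ?_⟩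
      have a1 := h1 g hg
      have a2 := h1 g' hg'
      rw [pow_zero, pow_one] at a1 a2
      exact div_mem a2 a1
    rw [hs, Finset.sum_singleton] at h3
    exact (map_eq_zero_iff ι ι.injective).1 ((mul_eq_zero.1 h3).resolve_right (Units.ne_zero _))
  | succ n ih =>
    intro s h1 h2 c h3
    -- relation on ↥s
    let R : Setoid s :=
      { r := fun i j => (i : Eˣ) ^ p / (j : Eˣ) ^ p ∈ HE
        iseqv := ⟨fun i => by rw [div_self']; exact one_mem _,
          fun {i j} h => by rw [← inv_div]; exact inv_mem h,
          fun {i j l} h h' => by rw [← div_mul_div_cancel _ ((j : Eˣ) ^ p)]; exact mul_mem h h'⟩ }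
    let rep : s → s := fun i => (Quotient.mk R i).out
    have hrep : ∀ i : s, (i : Eˣ) ^ p / (rep i : Eˣ) ^ p ∈ HE := fun i =>
      R.iseqv.symm (Quotient.mk_out (s := R) i)
    have hrep2 : ∀ i : s, rep (rep i) = rep i := by
      intro i
      change (Quotient.mk R (Quotient.mk R i).out).out = _
      rw [Quotient.out_eq]
    choose u huH hu using hrep
    have hu' : ∀ i : s, ((i : Eˣ) ^ p) = Units.map ι.toMonoidHom (u i) * (rep i : Eˣ) ^ p := by
      intro i
      rw [hu i, div_mul_cancel]
    have hsum : ∑ i : s, ι (c i ^ p) * (((i : Eˣ) ^ p : Eˣ) : E) = 0 := by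
      have := congrArg (frobenius E p) h3
      rw [map_zero, map_sum] at this
      rw [← this, ← Finset.sum_coe_sort s (fun x => (frobenius E p) (ι (c x) * (x : E)))]
      refine Finset.sum_congr rfl fun i _ => ?_
      rw [frobenius_def, mul_pow, map_pow, Units.val_pow_eq_pow_val]
    have key := group_indep ι (fun i : s => (((i : Eˣ) ^ p : Eˣ) : E)) rep (fun i => (u i : k))
      (fun i => by
        have := congrArg Units.val (hu' i)
        exact this) hrep2 (by
        intro t ht d hd
        have hinj : Set.InjOn (fun i : s => (i : Eˣ) ^ p) t := fun i _ j _ hij => Subtype.ext (hfinj _ _ hij)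
        rcases t.eq_empty_or_nonempty with rfl | ⟨i0, hi0⟩
        · simp
        haveI : Nonempty s := ⟨i0⟩
        let gi := Function.invFunOn (fun i : s => (i : Eˣ) ^ p) t
        have hgi : ∀ i ∈ t, gi ((i : Eˣ) ^ p) = i := fun i hi => hinj.leftInvOn_invFunOn hi
        have := ih (t.image (fun i : s => (i : Eˣ) ^ p)) (by
          intro g hg
          obtain ⟨i, hi, rfl⟩ := Finset.mem_image.1 hg
          rw [← pow_mul, ← pow_succ']
          exact h1 i i.2) (by
          intro g hg g' hg' hgg
          obtain ⟨i, hi, rfl⟩ := Finset.mem_image.1 hg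
          obtain ⟨j, hj, rfl⟩ := Finset.mem_image.1 hg'
          have : rep i = rep j := by
            change (Quotient.mk R i).out = (Quotient.mk R j).out
            rw [Quotient.sound (s := R) (a := i) (b := j) hgg]
          rw [ht i hi, ht j hj] at this
          rw [this]) (fun g => d (gi g)) (by
          rw [Finset.sum_image hinj, ← hd]
          exact Finset.sum_congr rfl fun i hi => by rw [hgi i hi])
        intro i hi
        have h := this _ (Finset.mem_image_of_mem _ hi)
        rwa [hgi i hi] at h)
      Finset.univ (fun i => c i ^ p) hsum
    intro g hg
    have := pind_family hH (Finset.univ.filter (fun i : s => rep i = rep ⟨g, hg⟩)) u (fun i => c i)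
      (fun i _ => huH i) (by
        intro i hi j hj w hw e
        have hi' := (Finset.mem_filter.1 hi).2
        have hj' := (Finset.mem_filter.1 hj).2
        apply Subtype.ext
        refine h2 _ i.2 _ j.2 ?_
        refine ⟨w, hw, ?_⟩
        apply hfinj
        rw [div_pow, hu' i, hu' j, hi', hj', e, map_mul, map_pow]
        rw [mul_div_mul_right_eq_div, mul_div_cancel_left]) (key (rep ⟨g, hg⟩)) ⟨g, hg⟩ (Finset.mem_filter.2 ⟨Finset.mem_univ _, rfl⟩)
    exact this

end PartRed4b

section PartRed4c

open IsLocalRing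

theorem flat_quot_retract {S A F : Type*} [CommRing S] [CommRing A] [Algebra S A] [AddCommGroup F] [Module S F]
    [Module.Flat S F] (K : Ideal A) (L : A →ₗ[S] F) (hLK : ∀ x ∈ K, L x = 0) (σ : F →ₗ[S] A)
    (hσL : ∀ x, x - σ (L x) ∈ K) : Module.Flat S (A ⧸ K) := by
  let i : (A ⧸ K) →ₗ[S] F :=
    (((K.restrictScalars S).liftQ L hLK).comp (Submodule.Quotient.restrictScalarsEquiv S K).symm.toLinearMap)
  refine Module.Flat.of_retract i ((Ideal.Quotient.mkₐ S K).toLinearMap.comp σ) ?_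
  apply LinearMap.ext
  intro x
  obtain ⟨x, rfl⟩ := Ideal.Quotient.mk_surjective x
  change Ideal.Quotient.mk K (σ (L x)) = Ideal.Quotient.mk K x
  exact (Ideal.Quotient.eq.2 (hσL x)).symm

theorem twisted_ext {S G E : Type*} [CommRing S] [CommGroup G] [Field E] (N : Subgroup G) (ρ : N →* Sˣ)
    (m : Ideal S) (r0 : S →+* E) (hm : RingHom.ker r0 = m) (θ : G →* E) (hθ : ∀ h : N, θ h = r0 (ρ h))
    (hind : ∀ (t : Finset (G ⧸ N)) (c : G ⧸ N → S), ∑ q ∈ t, r0 (c q) * θ q.out = 0 → ∀ q ∈ t, c q ∈ m)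
    (hspan : ∀ e : E, e ∈ AddSubgroup.closure {e | ∃ s g, e = r0 s * θ g}) :
    ∃ (K : Ideal (MonoidAlgebra S G)) (π : (MonoidAlgebra S G ⧸ K) →+* E), Function.Surjective π ∧
      Module.Flat S (MonoidAlgebra S G ⧸ K) ∧ RingHom.ker π = m.map (algebraMap S (MonoidAlgebra S G ⧸ K)) := by
  classical
  let K : Ideal (MonoidAlgebra S G) := Ideal.span (Set.range fun h : N =>
    MonoidAlgebra.single (h : G) (1 : S) - MonoidAlgebra.single 1 (ρ h : S))
  let v : G → G := fun g => (QuotientGroup.mk (s := N) g).out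
  have hv : ∀ g, (v g)⁻¹ * g ∈ N := fun g => by
    rw [← QuotientGroup.eq]; exact QuotientGroup.out_eq' _
  let h : G → N := fun g => ⟨(v g)⁻¹ * g, hv g⟩
  have hvh : ∀ g, v g * (h g : G) = g := fun g => by simp [h]
  have hvN : ∀ g (n : N), v (g * n) = v g := fun g n => by
    simp only [v]; congr 1; rw [QuotientGroup.eq]; simp
  have hhN : ∀ g (n : N), h (g * n) = h g * n := fun g n => by
    apply Subtype.ext; simp only [h, hvN]; simp [mul_assoc]
  let L0 : (G →₀ S) →ₗ[S] (G ⧸ N →₀ S) := Finsupp.lsum S fun g =>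
    (Finsupp.lsingle (QuotientGroup.mk g)).comp (LinearMap.mulRight S (ρ (h g) : S))
  let L : MonoidAlgebra S G →ₗ[S] (G ⧸ N →₀ S) := L0.comp (MonoidAlgebra.coeffLinearEquiv S).toLinearMap
  have hL : ∀ g s, L (MonoidAlgebra.single g s) = Finsupp.single (QuotientGroup.mk g) (s * (ρ (h g) : S)) := by
    intro g s
    simp [L, L0]
  have hLK : ∀ x ∈ K, L x = 0 := by
    intro x hx
    have hx' : ∀ a, L (a * x) = 0 := by
      induction hx using Submodule.span_induction with
      | zero => simp
      | add x y _ _ hx hy => intro a; rw [mul_add, map_add, hx, hy, add_zero]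
      | smul b x _ hx => intro a; rw [smul_eq_mul, ← mul_assoc]; exact hx _
      | mem x hx =>
        obtain ⟨n, rfl⟩ := hx
        intro a
        induction a using MonoidAlgebra.induction_linear with
        | zero => simp
        | add x y hx hy => rw [add_mul, map_add, hx, hy, add_zero]
        | single g s =>
          simp only
          rw [mul_sub, MonoidAlgebra.single_mul_single, MonoidAlgebra.single_mul_single, map_sub, hL, hL, hhN]
          have e : (QuotientGroup.mk (g * (n : G)) : G ⧸ N) = QuotientGroup.mk g := by
            rw [QuotientGroup.eq]; simp
          rw [e, mul_one, mul_one, map_mul, Units.val_mul, mul_assoc, mul_comm (ρ n : S), sub_self]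
    rw [← one_mul x]; exact hx' 1
  let σ : (G ⧸ N →₀ S) →ₗ[S] MonoidAlgebra S G := Finsupp.lsum S fun q =>
    ((MonoidAlgebra.coeffLinearEquiv S).symm.toLinearMap.comp (Finsupp.lsingle q.out))
  have hσ : ∀ q s, σ (Finsupp.single q s) = MonoidAlgebra.single q.out s := by
    intro q s
    simp [σ]
  have hσL : ∀ x, x - σ (L x) ∈ K := by
    intro x
    induction x using MonoidAlgebra.induction_linear with
    | zero => simp
    | add x y hx hy =>
      have : x + y - σ (L (x + y)) = (x - σ (L x)) + (y - σ (L y)) := by rw [map_add, map_add]; ring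
      rw [this]; exact add_mem hx hy
    | single g s =>
      rw [hL, hσ]
      have : MonoidAlgebra.single g s - MonoidAlgebra.single (v g) (s * (ρ (h g) : S)) =
        MonoidAlgebra.single (v g) s * (MonoidAlgebra.single (h g : G) (1 : S) - MonoidAlgebra.single 1 (ρ (h g) : S)) := by
        rw [mul_sub, MonoidAlgebra.single_mul_single, MonoidAlgebra.single_mul_single, hvh, mul_one, mul_one]
      change MonoidAlgebra.single g s - MonoidAlgebra.single (v g) (s * (ρ (h g) : S)) ∈ K
      rw [this]
      exact Ideal.mul_mem_left _ _ (Ideal.subset_span ⟨h g, rfl⟩)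
  let π0 : MonoidAlgebra S G →+* E := MonoidAlgebra.liftNCRingHom r0 θ (fun _ _ => Commute.all _ _)
  have hπ0 : ∀ g s, π0 (MonoidAlgebra.single g s) = r0 s * θ g := fun g s => MonoidAlgebra.liftNCRingHom_single _ _ _ _ _
  have hπK : K ≤ RingHom.ker π0 := by
    rw [Ideal.span_le]
    rintro _ ⟨n, rfl⟩
    change π0 _ = 0
    rw [map_sub, hπ0, hπ0, hθ, map_one, map_one, one_mul, mul_one, sub_self]
  let π : (MonoidAlgebra S G ⧸ K) →+* E := Ideal.Quotient.lift K π0 hπK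
  have hπ : ∀ x, π (Ideal.Quotient.mk K x) = π0 x := fun x => rfl
  refine ⟨K, π, ?_, ?_, ?_⟩
  · intro e
    have : AddSubgroup.closure {e | ∃ s g, e = r0 s * θ g} ≤ π.toAddMonoidHom.range := by
      rw [AddSubgroup.closure_le]
      rintro _ ⟨s, g, rfl⟩
      exact ⟨Ideal.Quotient.mk K (MonoidAlgebra.single g s), hπ0 g s⟩
    exact this (hspan e)
  · exact flat_quot_retract K L hLK σ hσL
  · apply le_antisymm
    · intro b hb
      obtain ⟨x, rfl⟩ := Ideal.Quotient.mk_surjective b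
      have e1 : Ideal.Quotient.mk K x = Ideal.Quotient.mk K (σ (L x)) := Ideal.Quotient.eq.2 (hσL x)
      rw [e1] at hb ⊢
      have e2 : σ (L x) = ∑ q ∈ (L x).support, MonoidAlgebra.single q.out (L x q) := by
        conv_lhs => rw [← Finsupp.sum_single (L x), Finsupp.sum, map_sum]
        exact Finset.sum_congr rfl fun q _ => hσ _ _
      have e3 : π0 (σ (L x)) = 0 := hb
      rw [e2, map_sum] at e3
      have e4 := hind _ (L x) (by rw [← e3]; exact Finset.sum_congr rfl fun q _ => (hπ0 _ _).symm)
      rw [e2, map_sum]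
      refine Ideal.sum_mem _ fun q hq => ?_
      have : MonoidAlgebra.single q.out (L x q) = algebraMap S (MonoidAlgebra S G) (L x q) * MonoidAlgebra.single q.out 1 := by
        simp
      rw [this, map_mul]
      exact Ideal.mul_mem_right _ _ (Ideal.mem_map_of_mem _ (e4 q hq))
    · rw [Ideal.map_le_iff_le_comap]
      intro s hs
      rw [← hm] at hs
      change π0 (algebraMap S (MonoidAlgebra S G) s) = 0
      have : algebraMap S (MonoidAlgebra S G) s = MonoidAlgebra.single 1 s := by simp
      rw [this, hπ0, show r0 s = 0 from hs, zero_mul]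

end PartRed4c

section PartRed4d

open IsLocalRing

theorem serre_ineq {n : ℕ} {S : Type*} [CommRing S] [IsLocalRing S] [IsNoetherianRing S]
    (x : Fin n → S) (hx : Ideal.span (Set.range x) = maximalIdeal S) (P Q : Ideal S) [P.IsPrime] [Q.IsPrime]
    (k : ℕ) (hk : maximalIdeal S ^ k ≤ P ⊔ Q) : ringKrullDim (S ⧸ P) + ringKrullDim (S ⧸ Q) ≤ n := by
  classical
  obtain ⟨p, hp⟩ := CharP.exists (ResidueField S)
  rcases CharP.char_is_prime_or_zero (ResidueField S) p with hpp | h0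
  swap
  · subst h0
    haveI := CharP.charP_to_charZero (ResidueField S)
    exact serre_of_ext (residue S) residue_surjective (by
      rw [ker_residue]; exact (Ideal.map_id _).symm) (Or.inl inferInstance) x hx P Q k hk
  haveI : Fact p.Prime := ⟨hpp⟩
  let E := PerfectClosure (ResidueField S) p
  let ι : ResidueField S →+* E := PerfectClosure.of (ResidueField S) p
  let f : Sˣ →* (ResidueField S)ˣ := Units.map (residue S).toMonoidHom
  have hf : Function.Surjective f := by
    intro u
    obtain ⟨s, hs⟩ := residue_surjective (R := S) (u : ResidueField S)
    have : IsUnit s := by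
      rw [← notMem_maximalIdeal, ← residue_eq_zero_iff, hs]; exact u.ne_zero
    exact ⟨this.unit, Units.ext hs⟩
  obtain ⟨H, hHf, hHi, hHs⟩ := pbasis_exists (p := p) f hf
  let τ : (ResidueField S)ˣ →* Eˣ := Units.map ι.toMonoidHom
  have hτ : Function.Injective τ := fun a b h => Units.ext (ι.injective (congrArg Units.val h))
  let HE : Subgroup Eˣ := (H.map f).map τ
  let G : Subgroup Eˣ :=
    { carrier := {g | ∃ j : ℕ, g ^ p ^ j ∈ HE}
      one_mem' := ⟨0, by rw [one_pow]; exact one_mem _⟩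
      mul_mem' := by
        rintro a b ⟨i, hi⟩ ⟨j, hj⟩
        refine ⟨i + j, ?_⟩
        rw [mul_pow, pow_add]
        refine mul_mem ?_ ?_
        · rw [pow_mul]; exact pow_mem hi _
        · rw [mul_comm (p ^ i), pow_mul]; exact pow_mem hj _
      inv_mem' := by
        rintro a ⟨i, hi⟩
        exact ⟨i, by rw [inv_pow]; exact inv_mem hi⟩ }
  let N : Subgroup G := HE.subgroupOf G
  have hN : ∀ m : N, ∃ h ∈ H, τ (f h) = ((m : G) : Eˣ) := by
    rintro ⟨⟨g, hg⟩, hm⟩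
    obtain ⟨_, ⟨h, hh, rfl⟩, e⟩ := (Subgroup.mem_subgroupOf.1 hm)
    exact ⟨h, hh, e⟩
  choose ρ0 hρH hρ using hN
  have hinj : ∀ a ∈ H, ∀ b ∈ H, τ (f a) = τ (f b) → a = b := by
    intro a ha b hb h
    have := hHf (a / b) (div_mem ha hb) (by rw [map_div, hτ h, div_self'])
    exact div_eq_one.1 this
  let ρ : N →* Sˣ := MonoidHom.mk' ρ0 (by
    intro a b
    refine hinj _ (hρH _) _ (mul_mem (hρH _) (hρH _)) ?_
    rw [hρ, map_mul, map_mul, hρ, hρ]; rfl)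
  let r0 : S →+* E := ι.comp (residue S)
  let θ : G →* E := (Units.coeHom E).comp G.subtype
  have hker : RingHom.ker r0 = maximalIdeal S := by
    ext s
    rw [RingHom.mem_ker, RingHom.comp_apply, map_eq_zero_iff _ ι.injective, residue_eq_zero_iff]
  have hind : ∀ (t : Finset (G ⧸ N)) (c : G ⧸ N → S), ∑ q ∈ t, r0 (c q) * θ q.out = 0 →
      ∀ q ∈ t, c q ∈ maximalIdeal S := by
    intro t c hc
    let gi : Eˣ → G ⧸ N := fun u => if h : u ∈ G then QuotientGroup.mk ⟨u, h⟩ else 1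
    have hgi : ∀ q : G ⧸ N, gi (q.out : Eˣ) = q := by
      intro q
      have : ((q.out : G) : Eˣ) ∈ G := q.out.2
      simp only [gi, dif_pos this]
      exact QuotientGroup.out_eq' q
    have hinj2 : Function.Injective (fun q : G ⧸ N => ((q.out : G) : Eˣ)) := Function.LeftInverse.injective hgi
    choose j hj using (fun q : G ⧸ N => (q.out : G).2)
    have := perf_indep ι (H.map f) hHi (t.sup j) (t.image (fun q => ((q.out : G) : Eˣ))) (by
      intro g hg
      obtain ⟨q, hq, rfl⟩ := Finset.mem_image.1 hg
      have hle : j q ≤ t.sup j := Finset.le_sup hq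
      obtain ⟨l, hl⟩ := Nat.exists_eq_add_of_le hle
      rw [hl, pow_add, pow_mul]
      exact pow_mem (hj q) _) (by
      intro g hg g' hg' h
      obtain ⟨q, hq, rfl⟩ := Finset.mem_image.1 hg
      obtain ⟨q', hq', rfl⟩ := Finset.mem_image.1 hg'
      have : q' = q := by
        rw [← QuotientGroup.out_eq' q, ← QuotientGroup.out_eq' q', QuotientGroup.eq, Subgroup.mem_subgroupOf]
        rw [div_eq_inv_mul] at h
        exact h
      rw [this]) (fun u => residue S (c (gi u))) (by
      rw [Finset.sum_image hinj2.injOn, ← hc]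
      refine Finset.sum_congr rfl fun q _ => ?_
      rw [hgi]; rfl)
    intro q hq
    have h := this _ (Finset.mem_image_of_mem _ hq)
    simp only [hgi] at h
    exact (residue_eq_zero_iff _).1 h
  let A : Submonoid E :=
    { carrier := {e | ∃ s g, e = r0 s * θ g}
      one_mem' := ⟨1, 1, by rw [map_one, map_one, one_mul]⟩
      mul_mem' := by
        rintro _ _ ⟨s, g, rfl⟩ ⟨s', g', rfl⟩
        exact ⟨s * s', g * g', by rw [map_mul, map_mul]; ring⟩ }
  have hclaim : ∀ (j : ℕ) (e : E) (y : ResidueField S), e ^ p ^ j = ι y → e ∈ Subring.closure (A : Set E) := by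
    intro j
    induction j with
    | zero =>
      intro e y h
      obtain ⟨s, rfl⟩ := residue_surjective y
      rw [pow_zero, pow_one] at h
      exact Subring.subset_closure ⟨s, 1, by rw [h, map_one, mul_one]; rfl⟩
    | succ j ih =>
      intro e y h
      obtain ⟨l, F, g, hg, rfl⟩ := hHs y
      have hd : ∀ i, ∃ d : E, d ^ p ^ j = ι (F i) := fun i => by
        obtain ⟨d, hd⟩ := (bijective_iterateFrobenius E p j).2 (ι (F i))
        exact ⟨d, by rw [← hd, iterateFrobenius_def]⟩
      have hγ : ∀ i, ∃ d : E, d ^ p ^ (j + 1) = ι (g i) := fun i => by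
        obtain ⟨d, hd⟩ := (bijective_iterateFrobenius E p (j + 1)).2 (ι (g i))
        exact ⟨d, by rw [← hd, iterateFrobenius_def]⟩
      choose d hd using hd
      choose γ hγ using hγ
      have he : e = ∑ i, d i * γ i := by
        apply (bijective_iterateFrobenius E p (j + 1)).1
        rw [map_sum, iterateFrobenius_def, h, map_sum]
        refine Finset.sum_congr rfl fun i _ => ?_
        rw [iterateFrobenius_def, mul_pow, hγ, pow_succ, pow_mul, hd, map_mul, map_pow]
      rw [he]
      refine sum_mem fun i _ => mul_mem (ih _ _ (hd i)) (Subring.subset_closure ?_)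
      have hne : γ i ≠ 0 := by
        intro h0
        have := hγ i
        rw [h0, zero_pow (pow_ne_zero _ hpp.ne_zero)] at this
        exact (g i).ne_zero ((map_eq_zero_iff ι ι.injective).1 this.symm)
      refine ⟨1, ⟨Units.mk0 _ hne, j + 1, ?_⟩, ?_⟩
      · refine ⟨g i, hg i, ?_⟩
        apply Units.ext
        rw [Units.val_pow_eq_pow_val, Units.val_mk0, hγ]; rfl
      · rw [map_one, one_mul]; rfl
  have hspan : ∀ e : E, e ∈ AddSubgroup.closure {e | ∃ s g, e = r0 s * θ g} := by
    intro e
    obtain ⟨⟨j, y⟩, rfl⟩ := PerfectClosure.mk_surjective _ _ e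
    have := hclaim j (PerfectClosure.mk _ p (j, y)) y (by
      rw [← iterate_frobenius]; exact PerfectClosure.iterate_frobenius_mk _ _ _ _)
    rw [Subring.mem_closure_iff, Submonoid.closure_eq] at this
    exact this
  obtain ⟨K, π, h1, h2, h3⟩ := twisted_ext N ρ (maximalIdeal S) r0 hker θ (by
    intro m
    exact (congrArg Units.val (hρ m)).symm) hind hspan
  exact serre_of_ext (B := MonoidAlgebra S G ⧸ K) (E := E) π h1 h3 (Or.inr ⟨p, inferInstance, inferInstance, inferInstance⟩) x hx P Q k hk

end PartRed4d

section PartCM1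

open IsLocalRing RingTheory.Sequence CategoryTheory Abelian Pointwise

theorem exists_prime_dim_le {R : Type*} [CommRing R] (A : Ideal R) (n : ℕ) (h : (n : WithBot ℕ∞) ≤ ringKrullDim (R ⧸ A)) :
    ∃ q : Ideal R, q.IsPrime ∧ A ≤ q ∧ (n : WithBot ℕ∞) ≤ ringKrullDim (R ⧸ q) := by
  rw [ringKrullDim_quotient, Order.le_krullDim_iff] at h
  obtain ⟨l, hl⟩ := h
  refine ⟨l.head.1.asIdeal, l.head.1.2, l.head.2, ?_⟩
  rw [ringKrullDim_quotient, Order.le_krullDim_iff]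
  refine ⟨⟨l.length, fun i => ⟨(l i).1, ?_⟩, ?_⟩, hl⟩
  · exact l.head_le i
  · intro i
    exact l.step i

theorem prime_dim_lt {R : Type*} [CommRing R] (p q : Ideal R) [p.IsPrime] (hpq : p ≤ q) (x : R) (hxq : x ∈ q)
    (hxp : x ∉ p) : ringKrullDim (R ⧸ q) + 1 ≤ ringKrullDim (R ⧸ p) := by
  refine ringKrullDim_succ_le_of_surjective (Ideal.Quotient.factor hpq)
    (Ideal.Quotient.factor_surjective hpq) (r := Ideal.Quotient.mk p x) ?_ ?_
  · rw [mem_nonZeroDivisors_iff_ne_zero, Ne, Ideal.Quotient.eq_zero_iff_mem]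
    exact hxp
  · rw [Ideal.Quotient.factor_mk, Ideal.Quotient.eq_zero_iff_mem]; exact hxq

theorem ass_dim {R : Type*} [CommRing R] [IsLocalRing R] [IsNoetherianRing R] (rs : List R) :
    ∀ (M : Type*) [AddCommGroup M] [Module R M] [Module.Finite R M] (_ : ∀ r ∈ rs, r ∈ maximalIdeal R)
    (_ : IsRegular M rs) (p : Ideal R) (_ : IsAssociatedPrime p M),
    (rs.length : WithBot ℕ∞) ≤ ringKrullDim (R ⧸ p) := by
  induction rs with
  | nil =>
    intro M _ _ _ _ _ p hp
    haveI := hp.isPrime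
    simpa using ringKrullDim_nonneg_of_nontrivial
  | cons x rs ih =>
    intro M _ _ _ hm hreg p hp
    haveI := hp.isPrime
    have hxm := hm x List.mem_cons_self
    obtain ⟨hx, hreg'⟩ := (isRegular_cons_iff M x rs).1 hreg
    have hxp : x ∉ p := by
      intro h
      have : x ∈ ({r : R | IsSMulRegular M r} : Set R)ᶜ := by
        rw [← biUnion_associatedPrimes_eq_compl_regular R M]
        exact Set.mem_biUnion (x := p) hp h
      exact this hx
    let N : Submodule R M := Submodule.torsionBySet R M p
    have hN : ∀ z : M, z ∈ N ↔ ∀ r ∈ p, r • z = 0 := fun z => by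
      rw [Submodule.mem_torsionBySet_iff]; exact ⟨fun h r hr => h ⟨r, hr⟩, fun h r => h r r.2⟩
    have hNnt : Nontrivial N := by
      obtain ⟨_, z, hz⟩ := isAssociatedPrime_iff.1 hp
      have hmem : ∀ r, r ∈ p ↔ r • z = 0 := fun r => by
        rw [hz, Submodule.mem_colon_singleton, Submodule.mem_bot]
      refine ⟨⟨⟨z, (hN z).2 fun r hr => (hmem r).1 hr⟩, 0, fun h => ?_⟩⟩
      apply Ideal.IsPrime.one_notMem (I := p) inferInstance
      rw [hmem, one_smul]
      exact congrArg Subtype.val h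
    -- N / xN embeds in M / xM
    let φ : N →ₗ[R] QuotSMulTop x M := (Submodule.mkQ _).comp N.subtype
    have hφ : ∀ z : N, φ z = 0 → z ∈ (maximalIdeal R) • (⊤ : Submodule R N) := by
      intro z hz
      have hz' : (z : M) ∈ x • (⊤ : Submodule R M) := (Submodule.Quotient.mk_eq_zero _).1 hz
      obtain ⟨w, -, hw⟩ := hz'
      have hwN : w ∈ N := by
        rw [hN]
        intro r hr
        apply hx
        change x • r • w = x • 0
        rw [smul_comm]
        have := (hN z).1 z.2 r hr
        rw [← hw] at this
        rw [smul_zero]; exact this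
      have : z = x • (⟨w, hwN⟩ : N) := Subtype.ext hw.symm
      rw [this]
      exact Submodule.smul_mem_smul hxm trivial
    have hW : Nontrivial (LinearMap.range φ) := by
      by_contra hcon
      rw [not_nontrivial_iff_subsingleton] at hcon
      have htop : (⊤ : Submodule R N) ≤ maximalIdeal R • (⊤ : Submodule R N) := by
        intro z _
        apply hφ
        have := Subsingleton.elim (⟨φ z, z, rfl⟩ : LinearMap.range φ) 0
        exact congrArg Subtype.val this
      have := Submodule.eq_bot_of_le_smul_of_le_jacobson_bot (maximalIdeal R) (⊤ : Submodule R N)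
        (IsNoetherian.noetherian _) htop (maximalIdeal_le_jacobson _)
      exact (bot_ne_top (α := Submodule R N)) this.symm
    obtain ⟨q, hq⟩ := associatedPrimes.nonempty R (LinearMap.range φ)
    have hq' : IsAssociatedPrime q (QuotSMulTop x M) := IsAssociatedPrime.map_of_injective (LinearMap.range φ).subtype hq
      (Submodule.injective_subtype _)
    have hann := IsAssociatedPrime.annihilator_le hq
    have hpq : p ≤ q := by
      refine le_trans ?_ hann
      intro r hr
      rw [Submodule.mem_annihilator]
      rintro ⟨_, z, rfl⟩ -
      apply Subtype.ext
      change r • φ z = 0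
      rw [← map_smul, show r • z = 0 from Subtype.ext ((hN z).1 z.2 r hr), map_zero]
    have hxq : x ∈ q := by
      apply hann
      rw [Submodule.mem_annihilator]
      rintro ⟨_, z, rfl⟩ -
      apply Subtype.ext
      change x • φ z = 0
      exact (Submodule.Quotient.mk_eq_zero _).2 ⟨z, trivial, rfl⟩
    have h1 := ih (QuotSMulTop x M) (fun r hr => hm r (List.mem_cons_of_mem _ hr)) hreg' q hq'
    have h2 := prime_dim_lt p q hpq x hxq hxp
    refine le_trans ?_ h2
    rw [List.length_cons]
    push_cast
    exact add_le_add_left h1 1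

theorem depth_exchange {R : Type u} [CommRing R] [IsLocalRing R] [IsNoetherianRing R] (M : Type u) [AddCommGroup M]
    [Module R M] [Module.Finite R M] [Nontrivial M] (n : ℕ) (h : ∃ rs : List R, rs.length = n + 1 ∧ (∀ r ∈ rs, r ∈ maximalIdeal R) ∧ IsRegular M rs)
    (x : R) (hxm : x ∈ maximalIdeal R) (hx : IsSMulRegular M x) :
    ∃ rs : List R, rs.length = n ∧ (∀ r ∈ rs, r ∈ maximalIdeal R) ∧ IsRegular (QuotSMulTop x M) rs := by
  have hlt : ∀ (L : Type u) [AddCommGroup L] [Module R L] [Module.Finite R L] [Nontrivial L],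
      maximalIdeal R • (⊤ : Submodule R L) < ⊤ := by
    intro L _ _ _ _
    refine lt_top_iff_ne_top.2 fun hc => ?_
    exact bot_ne_top (Submodule.eq_bot_of_le_smul_of_le_jacobson_bot (maximalIdeal R) (⊤ : Submodule R L)
        (IsNoetherian.noetherian _) hc.ge (maximalIdeal_le_jacobson _)).symm
  have hsupp : Module.support R (ModuleCat.of R (R ⧸ maximalIdeal R)) = PrimeSpectrum.zeroLocus (maximalIdeal R) := by
    rw [Module.support_eq_zeroLocus]
    congr 1
    exact congrArg _ (Ideal.annihilator_quotient (I := maximalIdeal R))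
  haveI : Nontrivial (QuotSMulTop x M) := nontrivial_quotSMulTop_of_mem_maximalIdeal M hxm
  obtain ⟨rs, hl, hm, hr⟩ := h
  have hext := ModuleCat.subsingleton_ext_of_exists_isRegular (maximalIdeal R) (ModuleCat.of R (R ⧸ maximalIdeal R)) hsupp.le
    (ModuleCat.of R M) (hlt M) rs hm hr
  refine ModuleCat.exists_isRegular_of_exists_subsingleton_ext (maximalIdeal R) n (ModuleCat.of R (QuotSMulTop x M)) (hlt _)
    (ModuleCat.of R (R ⧸ maximalIdeal R)) hsupp ?_
  intro i hi
  have zero1 := AddCommGrpCat.isZero_of_iff_subsingleton.mpr (hext i (by omega))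
  have zero2 := AddCommGrpCat.isZero_of_iff_subsingleton.mpr (hext (i + 1) (by omega))
  exact AddCommGrpCat.subsingleton_of_isZero <| ShortComplex.Exact.isZero_of_both_zeros
    ((Ext.covariant_sequence_exact₃' _ (IsSMulRegular.smulShortComplex_shortExact (M := ModuleCat.of R M) hx)) i (i + 1) rfl)
    (zero1.eq_zero_of_src _) (zero2.eq_zero_of_tgt _)

end PartCM1

section PartCM2

open IsLocalRing RingTheory.Sequence Pointwise

theorem wb_cancel (t r : ℕ) (D : WithBot ℕ∞) (h : ((t + r : ℕ) : WithBot ℕ∞) ≤ D + (r : WithBot ℕ∞)) : (t : WithBot ℕ∞) ≤ D := by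
  induction D using WithBot.recBotCoe with
  | bot => simp at h
  | coe D =>
    induction D using ENat.recTopCoe with
    | top => exact le_top
    | coe D =>
      have : t + r ≤ D + r := by exact_mod_cast h
      have : t ≤ D := by omega
      exact_mod_cast this

theorem cm_sop {R : Type u} [CommRing R] [IsLocalRing R] [IsNoetherianRing R] (xs : List R) :
    ∀ (M : Type u) [AddCommGroup M] [Module R M] [Module.Finite R M] [Nontrivial M] (n : ℕ)
    (_ : ∃ rs : List R, rs.length = n ∧ (∀ r ∈ rs, r ∈ maximalIdeal R) ∧ IsRegular M rs)
    (_ : ∀ x ∈ xs, x ∈ maximalIdeal R)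
    (_ : ∀ q : Ideal R, q.IsPrime → Module.annihilator R M ≤ q → (∀ x ∈ xs, x ∈ q) →
      ringKrullDim (R ⧸ q) + (xs.length : WithBot ℕ∞) ≤ n), IsWeaklyRegular M xs := by
  classical
  induction xs with
  | nil => intro M _ _ _ _ n _ _ _; exact IsWeaklyRegular.nil R M
  | cons x xs ih =>
    intro M _ _ _ _ n hrs hm hdim
    have hxm := hm x List.mem_cons_self
    have hlen : xs.length + 1 ≤ n := by
      have h := hdim (maximalIdeal R) inferInstance (le_maximalIdeal (by
        rw [Ne, Module.annihilator_eq_top_iff, not_subsingleton_iff_nontrivial]; infer_instance)) hm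
      have h0 : (0 : WithBot ℕ∞) ≤ ringKrullDim (R ⧸ maximalIdeal R) := ringKrullDim_nonneg_of_nontrivial
      have := (add_le_add_left h0 _).trans h
      rw [zero_add, List.length_cons] at this
      exact_mod_cast this
    have hx : IsSMulRegular M x := by
      by_contra hx
      have : x ∈ ({r : R | IsSMulRegular M r} : Set R)ᶜ := hx
      rw [← biUnion_associatedPrimes_eq_compl_regular R M] at this
      obtain ⟨p, hp, hxp⟩ := Set.mem_iUnion₂.1 this
      haveI : p.IsPrime := IsAssociatedPrime.isPrime hp
      obtain ⟨rs, hl, hrm, hr⟩ := hrs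
      have h1 := ass_dim rs M hrm hr p hp
      rw [hl] at h1
      let s : Finset (R ⧸ p) := (xs.map (Ideal.Quotient.mk p)).toFinset
      haveI : IsLocalRing (R ⧸ p) := IsLocalRing.of_surjective' _ Ideal.Quotient.mk_surjective
      have h2 := ringKrullDim_le_ringKrullDim_quotient_add_card s (by
        rw [IsLocalRing.ringJacobson_eq_maximalIdeal]
        intro y hy
        obtain ⟨z, hz, rfl⟩ := List.mem_map.1 (List.mem_toFinset.1 hy)
        rw [← IsLocalRing.map_maximalIdeal_of_surjective _ (Ideal.Quotient.mk_surjective (I := p))]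
        exact Ideal.mem_map_of_mem _ (hm z (List.mem_cons_of_mem _ hz)))
      have hc : s.card ≤ xs.length := (List.toFinset_card_le _).trans_eq (List.length_map _)
      have h3 : ((n - xs.length : ℕ) : WithBot ℕ∞) ≤ ringKrullDim ((R ⧸ p) ⧸ Ideal.span (s : Set (R ⧸ p))) := by
        apply wb_cancel _ xs.length
        rw [Nat.sub_add_cancel (by omega)]
        refine (h1.trans h2).trans ?_
        gcongr
      obtain ⟨q, hqp, hsq, hq⟩ := exists_prime_dim_le _ _ h3
      have h4 : ringKrullDim (R ⧸ q.comap (Ideal.Quotient.mk p)) = ringKrullDim ((R ⧸ p) ⧸ q) :=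
        quot_comap_dim _ Ideal.Quotient.mk_surjective q
      have hpq : p ≤ q.comap (Ideal.Quotient.mk p) := by
        intro y hy
        rw [Ideal.mem_comap, Ideal.Quotient.eq_zero_iff_mem.2 hy]; exact zero_mem _
      have h5 := hdim (q.comap (Ideal.Quotient.mk p)) (Ideal.comap_isPrime _ _)
        (le_trans (by
          have := IsAssociatedPrime.annihilator_le hp
          rwa [Submodule.annihilator_top] at this) hpq) (by
          intro y hy
          rcases List.mem_cons.1 hy with rfl | hy
          · exact hpq hxp
          · exact hsq (Ideal.subset_span (List.mem_toFinset.2 (List.mem_map_of_mem hy))))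
      rw [h4] at h5
      have h6 := (add_le_add_left hq _).trans h5
      rw [List.length_cons] at h6
      have : n - xs.length + (xs.length + 1) ≤ n := by exact_mod_cast h6
      omega
    obtain ⟨n, rfl⟩ := Nat.exists_eq_add_of_le' (show 1 ≤ n by omega)
    haveI : Nontrivial (QuotSMulTop x M) := nontrivial_quotSMulTop_of_mem_maximalIdeal M hxm
    refine IsWeaklyRegular.cons hx (ih (QuotSMulTop x M) n (depth_exchange M n hrs x hxm hx)
      (fun y hy => hm y (List.mem_cons_of_mem _ hy)) ?_)
    intro q hq hann hxs
    have hxq : x ∈ q := by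
      apply hann
      rw [Module.mem_annihilator]
      intro y
      obtain ⟨y, rfl⟩ := Submodule.mkQ_surjective _ y
      exact (Submodule.Quotient.mk_eq_zero _).2 ⟨y, trivial, rfl⟩
    have h := hdim q hq (le_trans (by
      intro r hr
      rw [Module.mem_annihilator] at hr ⊢
      intro y
      obtain ⟨y, rfl⟩ := Submodule.mkQ_surjective _ y
      rw [← map_smul, hr, map_zero]) hann) (by
      intro y hy
      rcases List.mem_cons.1 hy with rfl | hy
      · exact hxq
      · exact hxs y hy)
    rw [List.length_cons] at h
    push_cast at h
    rw [← add_assoc] at h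
    generalize ringKrullDim (R ⧸ q) + (xs.length : WithBot ℕ∞) = D at h
    induction D using WithBot.recBotCoe with
    | bot => exact bot_le
    | coe D =>
      induction D using ENat.recTopCoe with
      | top => exact absurd h (by
          rw [not_le]
          exact_mod_cast (ENat.coe_lt_top (n+1)))
      | coe D =>
        have : D + 1 ≤ n + 1 := by exact_mod_cast h
        have : D ≤ n := by omega
        exact_mod_cast this

end PartCM2

section PartCM3

open IsLocalRing RingTheory.Sequence Pointwise

theorem exists_avoid {S : Type*} [CommRing S] [IsLocalRing S] [IsNoetherianRing S] (h : ¬ ringKrullDim S ≤ 0) :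
    ∃ y ∈ maximalIdeal S, y ∉ maximalIdeal S ^ 2 ∧ ∀ p ∈ minimalPrimes S, y ∉ p := by
  classical
  by_contra hcon
  push Not at hcon
  let s : Finset (Ideal S) := insert (maximalIdeal S ^ 2) (minimalPrimes.finite_of_isNoetherianRing S).toFinset
  have hsub : (maximalIdeal S : Set S) ⊆ ⋃ i ∈ (s : Set (Ideal S)), ((id i : Ideal S) : Set S) := by
    intro y hy
    by_cases h2 : y ∈ maximalIdeal S ^ 2
    · exact Set.mem_biUnion (Finset.mem_coe.2 (Finset.mem_insert_self _ _)) h2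
    · obtain ⟨p, hp, hyp⟩ := hcon y hy h2
      exact Set.mem_biUnion (Finset.mem_coe.2 (Finset.mem_insert_of_mem ((Set.Finite.mem_toFinset _).2 hp))) hyp
  rw [Ideal.subset_union_prime (maximalIdeal S ^ 2) (maximalIdeal S ^ 2) (by
    intro i hi hne _
    rcases Finset.mem_insert.1 hi with h | h
    · exact absurd h hne
    · exact Ideal.minimalPrimes_isPrime ((Set.Finite.mem_toFinset _).1 h))] at hsub
  obtain ⟨i, hi, hle⟩ := hsub
  apply h
  rcases Finset.mem_insert.1 hi with rfl | hi
  · have hb : maximalIdeal S = ⊥ := by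
      refine Submodule.eq_bot_of_le_smul_of_le_jacobson_bot (maximalIdeal S) (maximalIdeal S)
        (IsNoetherian.noetherian _) ?_ (maximalIdeal_le_jacobson _)
      rw [smul_eq_mul, ← pow_two]; exact hle
    have := (isField_iff_maximalIdeal_eq (R := S)).2 hb
    exact (ringKrullDim_eq_zero_of_isField this).le
  · have hi' := (Set.Finite.mem_toFinset _).1 hi
    haveI : i.IsPrime := Ideal.minimalPrimes_isPrime hi'
    have : i = maximalIdeal S := le_antisymm (le_maximalIdeal_of_isPrime i) hle
    rw [← maximalIdeal_height_eq_ringKrullDim]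
    rw [this] at hi'
    rw [Ideal.height_eq_zero_iff.2 hi']; rfl

theorem isLocalRing_reg {S : Type*} [CommRing S] (y : S) (rs : List S) (hy : IsSMulRegular S y)
    (h : IsRegular (S ⧸ Ideal.span {y}) (rs.map (Ideal.Quotient.mk (Ideal.span {y})))) : IsRegular S (y :: rs) := by
  refine (isRegular_cons_iff S y rs).2 ⟨hy, ?_⟩
  have e0 : y • (⊤ : Ideal S) = Ideal.span {y} := by simp [← Submodule.ideal_span_singleton_smul]
  let e : QuotSMulTop y S ≃ₗ[S] (S ⧸ Ideal.span {y}) := Submodule.quotEquivOfEq _ _ e0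
  refine (AddEquiv.isRegular_congr (e := e.toAddEquiv) (as := rs) (bs := rs.map (Ideal.Quotient.mk (Ideal.span {y}))) ?_).2 h
  rw [List.forall₂_map_right_iff, List.forall₂_same]
  intro r _ z
  exact e.map_smul r z

theorem reg_local (n : ℕ) : ∀ (S : Type u) [CommRing S] [IsLocalRing S] [IsNoetherianRing S] (x : Fin n → S)
    (_ : Ideal.span (Set.range x) = maximalIdeal S) (_ : ringKrullDim S = n),
    IsDomain S ∧ ∃ rs : List S, rs.length = n ∧ (∀ r ∈ rs, r ∈ maximalIdeal S) ∧ IsRegular S rs := by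
  classical
  induction n with
  | zero =>
    intro S _ _ _ x hx hd
    refine ⟨?_, [], rfl, by simp, IsRegular.nil S S⟩
    have hb : maximalIdeal S = ⊥ := by rw [← hx, Set.range_eq_empty, Ideal.span_empty]
    exact ((isField_iff_maximalIdeal_eq (R := S)).2 hb).isDomain
  | succ n ih =>
    intro S _ _ _ x hx hd
    obtain ⟨y, hym, hy2, hymin⟩ := exists_avoid (S := S) (by
      rw [hd, not_le]; exact_mod_cast Nat.succ_pos n)
    haveI : Nontrivial (S ⧸ Ideal.span {y}) := Ideal.Quotient.nontrivial_iff.2 (fun h => by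
      have : Ideal.span {y} ≤ maximalIdeal S := (Ideal.span_singleton_le_iff_mem _).2 hym
      rw [h] at this
      exact (maximalIdeal.isMaximal S).ne_top (top_le_iff.1 this))
    haveI : IsLocalRing (S ⧸ Ideal.span {y}) := IsLocalRing.of_surjective' _ Ideal.Quotient.mk_surjective
    have hmap := IsLocalRing.map_maximalIdeal_of_surjective _ (Ideal.Quotient.mk_surjective (I := Ideal.span {y}))
    have hxm : ∀ i, x i ∈ maximalIdeal S := fun i => by rw [← hx]; exact Ideal.subset_span ⟨i, rfl⟩
    obtain ⟨c, hc⟩ := Ideal.mem_span_range_iff_exists_fun.1 (hx.symm ▸ hym)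
    obtain ⟨i, hi⟩ : ∃ i, IsUnit (c i) := by
      by_contra hcon
      push Not at hcon
      apply hy2
      rw [← hc, pow_two]
      exact Ideal.sum_mem _ fun i _ => Ideal.mul_mem_mul ((mem_maximalIdeal _).2 (hcon i)) (hxm i)
    let x' : Fin n → S ⧸ Ideal.span {y} := fun j => Ideal.Quotient.mk _ (x (i.succAbove j))
    have hx' : Ideal.span (Set.range x') = maximalIdeal (S ⧸ Ideal.span {y}) := by
      rw [← hmap, ← hx, Ideal.map_span]
      apply le_antisymm
      · rw [Ideal.span_le]
        rintro _ ⟨j, rfl⟩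
        exact Ideal.subset_span ⟨_, ⟨_, rfl⟩, rfl⟩
      · rw [Ideal.span_le]
        rintro _ ⟨_, ⟨j, rfl⟩, rfl⟩
        rcases Fin.eq_self_or_eq_succAbove i j with rfl | ⟨j, rfl⟩
        · obtain ⟨u, hu⟩ := hi
          have e : Ideal.Quotient.mk (Ideal.span {y}) (x j) =
              - ∑ l, Ideal.Quotient.mk (Ideal.span {y}) (↑u⁻¹ * c (j.succAbove l)) * x' l := by
            rw [eq_neg_iff_add_eq_zero]
            simp only [x', ← map_mul, ← map_sum, ← map_add]
            rw [Ideal.Quotient.eq_zero_iff_mem]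
            have : x j + ∑ l, ↑u⁻¹ * c (j.succAbove l) * x (j.succAbove l) = ↑u⁻¹ * y := by
              rw [← hc, Fin.sum_univ_succAbove _ j, mul_add, ← hu, ← mul_assoc, Units.inv_mul, one_mul, Finset.mul_sum]
              congr 1
              exact Finset.sum_congr rfl fun l _ => by ring
            rw [this]
            exact Ideal.mul_mem_left _ _ (Ideal.mem_span_singleton_self y)
          rw [SetLike.mem_coe, e]
          refine neg_mem (Ideal.sum_mem _ fun l _ => Ideal.mul_mem_left _ _ (Ideal.subset_span ⟨l, rfl⟩))
        · exact Ideal.subset_span ⟨j, rfl⟩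
    have hd' : ringKrullDim (S ⧸ Ideal.span {y}) = n := by
      apply le_antisymm
      · have h := ringKrullDim_le_ringKrullDim_quotient_add_card (Finset.univ.image x') (by
          rw [IsLocalRing.ringJacobson_eq_maximalIdeal, ← hx']
          rw [Finset.coe_image, Finset.coe_univ, Set.image_univ]
          exact Ideal.subset_span)
        rw [Finset.coe_image, Finset.coe_univ, Set.image_univ, hx'] at h
        have h0 : ringKrullDim ((S ⧸ Ideal.span {y}) ⧸ maximalIdeal (S ⧸ Ideal.span {y})) = 0 :=
          ringKrullDim_eq_zero_of_isField (Ideal.Quotient.maximal_ideal_iff_isField_quotient _ |>.1 inferInstance)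
        rw [h0, zero_add] at h
        refine h.trans ?_
        exact_mod_cast (Finset.card_image_le.trans_eq (by simp) : (Finset.univ.image x').card ≤ n)
      · have h := ringKrullDim_le_ringKrullDim_quotient_add_card {y} (by
          rw [IsLocalRing.ringJacobson_eq_maximalIdeal]; simpa using hym)
        rw [Finset.coe_singleton, hd, Finset.card_singleton] at h
        exact wb_cancel n 1 _ h
    obtain ⟨hdom, rs, hl, hrm, hr⟩ := ih _ x' hx' hd'
    haveI hyp : (Ideal.span {y}).IsPrime := (Ideal.Quotient.isDomain_iff_prime _).1 hdom
    obtain ⟨p, hp, hpy⟩ := Ideal.exists_minimalPrimes_le (I := ⊥) (J := Ideal.span {y}) bot_le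
    have hp' : p ∈ minimalPrimes S := hp
    haveI : p.IsPrime := Ideal.minimalPrimes_isPrime hp'
    have hpb : p = ⊥ := by
      refine Submodule.eq_bot_of_le_smul_of_le_jacobson_bot (maximalIdeal S) p
        (IsNoetherian.noetherian _) ?_ (maximalIdeal_le_jacobson _)
      intro z hz
      obtain ⟨w, rfl⟩ := Ideal.mem_span_singleton'.1 (hpy hz)
      have hw : w ∈ p := (Ideal.IsPrime.mem_or_mem inferInstance hz).resolve_right (hymin p hp')
      rw [mul_comm]
      exact Submodule.smul_mem_smul hym hw
    haveI : IsDomain S := by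
      have : (⊥ : Ideal S).IsPrime := hpb ▸ inferInstance
      exact IsDomain.of_bot_isPrime S
    refine ⟨inferInstance, ?_⟩
    have hy0 : y ≠ 0 := fun h => hy2 (h ▸ zero_mem _)
    obtain ⟨rs', rfl⟩ : ∃ rs' : List S, rs'.map (Ideal.Quotient.mk (Ideal.span {y})) = rs :=
      ⟨rs.map (Function.surjInv Ideal.Quotient.mk_surjective), by
        rw [List.map_map]
        convert List.map_id rs
        exact funext fun z => Function.surjInv_eq _ z⟩
    refine ⟨y :: rs', by simpa using hl, ?_, ?_⟩
    · intro r hr'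
      rcases List.mem_cons.1 hr' with rfl | hr'
      · exact hym
      · have h := hrm _ (List.mem_map_of_mem hr')
        rw [mem_maximalIdeal, mem_nonunits_iff] at h ⊢
        exact fun hu => h (hu.map _)
    · refine (isLocalRing_reg y rs' ?_ ?_)
      · exact (isSMulRegular_iff_right_eq_zero_of_smul (M := S)).2 fun z hz => (mul_eq_zero.1 hz).resolve_left hy0
      · exact hr

end PartCM3

section PartCM4

open IsLocalRing RingTheory.Sequence Pointwise

theorem sop_pow {S : Type u} [CommRing S] [IsLocalRing S] [IsNoetherianRing S] (I : Ideal S)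
    {d : ℕ} (a : Fin d → S)
    (hsop : Order.krullDim (Submodule (S ⧸ I)
      ((S ⧸ I) ⧸ Ideal.span (Set.range fun i => Ideal.Quotient.mk I (a i)))) < ⊤) :
    ∃ k : ℕ, maximalIdeal S ^ k ≤ I ⊔ Ideal.span (Set.range a) := by
  set B := Ideal.span (Set.range fun i => Ideal.Quotient.mk I (a i)) with hB
  have hB' : B = (Ideal.span (Set.range a)).map (Ideal.Quotient.mk I) := by
    rw [Ideal.map_span, hB, ← Set.range_comp]; rfl
  have hlen : Module.length (S ⧸ I) ((S ⧸ I) ⧸ B) ≠ ⊤ := by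
    intro h
    rw [← Module.coe_length, h] at hsop
    exact lt_irrefl _ hsop
  have hart : IsArtinian (S ⧸ I) ((S ⧸ I) ⧸ B) :=
    (isFiniteLength_iff_isNoetherian_isArtinian.1 (Module.length_ne_top_iff.1 hlen)).2
  have hker : ∀ x : S, Ideal.Quotient.mk B (Ideal.Quotient.mk I x) = 0 →
      x ∈ I ⊔ Ideal.span (Set.range a) := by
    intro x hx
    rw [Ideal.Quotient.eq_zero_iff_mem, hB', Ideal.mem_quotient_iff_mem_sup] at hx
    rwa [sup_comm]
  rcases subsingleton_or_nontrivial ((S ⧸ I) ⧸ B) with hs | hn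
  · exact ⟨0, fun x _ => hker x (Subsingleton.elim _ _)⟩
  · have hartR : IsArtinianRing ((S ⧸ I) ⧸ B) :=
      isArtinian_of_tower (S ⧸ I) hart
    let φ : S →+* ((S ⧸ I) ⧸ B) := (Ideal.Quotient.mk B).comp (Ideal.Quotient.mk I)
    have hφ : Function.Surjective φ := Ideal.Quotient.mk_surjective.comp Ideal.Quotient.mk_surjective
    haveI : IsLocalRing ((S ⧸ I) ⧸ B) := IsLocalRing.of_surjective' φ hφ
    obtain ⟨k, hk⟩ := (isArtinianRing_iff_isNilpotent_maximalIdeal ((S ⧸ I) ⧸ B)).1 hartR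
    refine ⟨k, fun x hx => hker x ?_⟩
    have h1 : φ x ∈ (maximalIdeal S ^ k).map φ := Ideal.mem_map_of_mem _ hx
    rw [Ideal.map_pow, IsLocalRing.map_maximalIdeal_of_surjective φ hφ, hk] at h1
    exact h1

theorem cm_reg {R : Type u} [CommRing R] [IsLocalRing R] (d : ℕ)
    (hd : sSup {n : ℕ∞ | ∃ rs : List R, (rs.length : ℕ∞) = n ∧ (∀ r ∈ rs, r ∈ maximalIdeal R) ∧
    RingTheory.Sequence.IsRegular R rs} = (d : ℕ∞)) :
    ∃ rs : List R, rs.length = d ∧ (∀ r ∈ rs, r ∈ maximalIdeal R) ∧ IsRegular R rs := by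
  set A := {n : ℕ∞ | ∃ rs : List R, (rs.length : ℕ∞) = n ∧ (∀ r ∈ rs, r ∈ maximalIdeal R) ∧
    RingTheory.Sequence.IsRegular R rs}
  have : (d : ℕ∞) ∈ A := by
    rw [← hd]
    haveI : Nonempty A := ⟨0, [], by simp, by simp, IsRegular.nil R R⟩
    exact ENat.sSup_mem_of_nonempty_of_lt_top (hd ▸ ENat.coe_lt_top d)
  obtain ⟨rs, h1, h2, h3⟩ := this
  exact ⟨rs, by exact_mod_cast h1, h2, h3⟩

theorem a_reg {S : Type u} [CommRing S] [IsLocalRing S] [IsNoetherianRing S]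
    (s : Finset S) (hs : Ideal.span (s : Set S) = maximalIdeal S)
    (hs' : ((s.card : ℕ∞) : WithBot ℕ∞) = ringKrullDim S)
    (I : Ideal S) [IsLocalRing (S ⧸ I)]
    (d : ℕ) (hd : ringKrullDim (S ⧸ I) = ((d : ℕ∞) : WithBot ℕ∞))
    (hdep : ∃ rs : List (S ⧸ I), rs.length = d ∧ (∀ r ∈ rs, r ∈ maximalIdeal (S ⧸ I)) ∧ IsRegular (S ⧸ I) rs)
    (a : Fin d → S) (ham : ∀ i, a i ∈ maximalIdeal S)
    (hsop : Order.krullDim (Submodule (S ⧸ I)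
      ((S ⧸ I) ⧸ Ideal.span (Set.range fun i => Ideal.Quotient.mk I (a i)))) < ⊤) :
    IsWeaklyRegular (S ⧸ I) (List.ofFn a) ∧ IsWeaklyRegular S (List.ofFn a) := by
  obtain ⟨k, hk⟩ := sop_pow I a hsop
  have hxm : ∀ x ∈ List.ofFn a, x ∈ maximalIdeal S := by
    intro x hx
    obtain ⟨i, rfl⟩ := (List.mem_ofFn' _ _).1 hx
    exact ham i
  have hspan : ∀ q : Ideal S, (∀ x ∈ List.ofFn a, x ∈ q) → Ideal.span (Set.range a) ≤ q := by
    intro q hq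
    rw [Ideal.span_le]
    rintro _ ⟨i, rfl⟩
    exact hq _ ((List.mem_ofFn' _ _).2 ⟨i, rfl⟩)
  constructor
  · obtain ⟨rs, hl, hm, hr⟩ := hdep
    obtain ⟨rs', rfl⟩ : ∃ rs' : List S, rs'.map (Ideal.Quotient.mk I) = rs :=
      ⟨rs.map (Function.surjInv Ideal.Quotient.mk_surjective), by
        rw [List.map_map]
        convert List.map_id rs
        exact funext fun z => Function.surjInv_eq _ z⟩
    refine cm_sop (List.ofFn a) (S ⧸ I) d ⟨rs', by simpa using hl, ?_, ?_⟩ hxm ?_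
    · intro r hr'
      have h := hm _ (List.mem_map_of_mem hr')
      rw [mem_maximalIdeal, mem_nonunits_iff] at h ⊢
      exact fun hu => h (hu.map _)
    · refine (AddEquiv.isRegular_congr (e := AddEquiv.refl (S ⧸ I)) (as := rs') (bs := rs'.map (Ideal.Quotient.mk I)) ?_).2 hr
      rw [List.forall₂_map_right_iff, List.forall₂_same]
      intro r _ z
      exact (algebraMap_smul (S ⧸ I) r z).symm
    · intro q hq hIq hxq
      have hmq : maximalIdeal S ≤ q := by
        refine hq.le_of_pow_le (hk.trans (sup_le ?_ (hspan q hxq)))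
        rwa [Ideal.annihilator_quotient] at hIq
      have : q = maximalIdeal S := le_antisymm (le_maximalIdeal hq.ne_top) hmq
      subst this
      rw [ringKrullDim_eq_zero_of_isField (Ideal.Quotient.maximal_ideal_iff_isField_quotient _ |>.1 inferInstance)]
      simp
  · let x : Fin s.card → S := fun i => (s.equivFin.symm i : S)
    have hx : Ideal.span (Set.range x) = maximalIdeal S := by
      rw [← hs]
      congr 1
      ext z
      constructor
      · rintro ⟨i, rfl⟩; exact (s.equivFin.symm i).2
      · intro hz; exact ⟨s.equivFin ⟨z, hz⟩, by simp [x]⟩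
    obtain ⟨_, hrs⟩ := reg_local s.card S x hx hs'.symm
    refine cm_sop (List.ofFn a) S s.card hrs hxm ?_
    intro q hq _ hxq
    obtain ⟨Q, hQ, hIQ, hQd⟩ := exists_prime_dim_le I d (by rw [hd]; rfl)
    have h := serre_ineq x hx q Q k (hk.trans (by
      rw [sup_comm]; exact sup_le_sup (hspan q hxq) hIQ))
    refine le_trans ?_ h
    rw [List.length_ofFn]
    gcongr

end PartCM4

section PartTR1

open IsLocalRing RingTheory.Sequence Pointwise

theorem pow_step {S : Type u} [CommRing S] (a : S) (xs : List S) (M : Type u) [AddCommGroup M] [Module S M] (n : ℕ) (m : M)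
    (hm : m ∈ (Ideal.ofList (a :: xs)) ^ (n+1) • (⊤ : Submodule S M)) :
    ∃ y ∈ (Ideal.ofList xs) ^ (n+1) • (⊤ : Submodule S M), ∃ z ∈ (Ideal.ofList (a :: xs)) ^ n • (⊤ : Submodule S M),
      m = y + a • z := by
  have e : (Ideal.ofList (a :: xs)) ^ (n+1) ≤ (Ideal.ofList xs) ^ (n+1) ⊔ Ideal.span {a} * (Ideal.ofList (a :: xs)) ^ n := by
    rw [Ideal.ofList_cons]
    clear hm m
    induction n with
    | zero => simp [sup_comm]
    | succ n ih =>
      rw [pow_succ' _ (n+1), Ideal.sup_mul]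
      refine sup_le le_sup_right ?_
      refine (Ideal.mul_mono_right ih).trans ?_
      rw [Ideal.mul_sup, ← pow_succ']
      refine sup_le_sup_left ?_ _
      rw [mul_left_comm, pow_succ' (Ideal.span {a} ⊔ Ideal.ofList xs) n]
      exact Ideal.mul_mono_right (Ideal.mul_mono_left le_sup_right)
  have h := Submodule.smul_mono_left (N := (⊤ : Submodule S M)) e hm
  rw [Submodule.sup_smul, Submodule.mem_sup] at h
  obtain ⟨y, hy, w, hw, rfl⟩ := h
  rw [mul_smul, Submodule.ideal_span_singleton_smul, Submodule.mem_smul_pointwise_iff_exists] at hw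
  obtain ⟨z, hz, rfl⟩ := hw
  exact ⟨y, hy, z, hz, rfl⟩

/-- colon step -/
theorem colon_step {S : Type u} [CommRing S] (a : S) (xs : List S) (M : Type u) [AddCommGroup M] [Module S M] (n : ℕ)
    (h : ∀ m : M, a • m ∈ (Ideal.ofList xs) ^ (n+1) • (⊤ : Submodule S M) → m ∈ (Ideal.ofList xs) ^ (n+1) • (⊤ : Submodule S M))
    (m : M) (hm : a • m ∈ (Ideal.ofList (a :: xs)) ^ (n+1) • (⊤ : Submodule S M)) :
    m ∈ (Ideal.ofList (a :: xs)) ^ n • (⊤ : Submodule S M) := by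
  obtain ⟨y, hy, z, hz, e⟩ := pow_step a xs M n _ hm
  have h1 : m - z ∈ (Ideal.ofList xs) ^ (n+1) • (⊤ : Submodule S M) := by
    apply h
    rw [smul_sub, e]
    simpa using hy
  have h2 : (Ideal.ofList xs) ^ (n+1) ≤ (Ideal.ofList (a :: xs)) ^ n := by
    rw [Ideal.ofList_cons]
    exact (Ideal.pow_le_pow_right (Nat.le_succ n)).trans (Ideal.pow_right_mono le_sup_right n)
  have h3 := Submodule.smul_mono_left (N := (⊤ : Submodule S M)) h2 h1
  have := add_mem h3 hz
  simpa using this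

theorem reg_pow {S : Type u} [CommRing S] [IsLocalRing S] [IsNoetherianRing S] (xs : List S) :
    ∀ (M : Type u) [AddCommGroup M] [Module S M] [Module.Finite S M] (b : S)
    (_ : ∀ x ∈ xs, x ∈ maximalIdeal S) (_ : b ∈ maximalIdeal S) (_ : IsWeaklyRegular M (xs ++ [b])) (n : ℕ)
    (m : M) (_ : b • m ∈ (Ideal.ofList xs) ^ n • (⊤ : Submodule S M)),
      m ∈ (Ideal.ofList xs) ^ n • (⊤ : Submodule S M) := by
  induction xs with
  | nil =>
    intro M _ _ _ b _ _ hr n m hm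
    cases n with
    | zero => simp
    | succ n =>
      rw [Ideal.ofList_nil] at hm ⊢
      simp only [List.nil_append, isWeaklyRegular_cons_iff] at hr
      have h0 : (⊥ : Ideal S) ^ (n+1) = ⊥ := by simp [Ideal.bot_pow]
      rw [h0, Submodule.bot_smul, Submodule.mem_bot] at hm ⊢
      exact (isSMulRegular_iff_right_eq_zero_of_smul (M := M)).1 hr.1 m hm
  | cons a xs ih =>
    intro M _ _ _ b hxs hb hr n
    have ha := hxs a (by simp)
    have hxs' : ∀ x ∈ xs, x ∈ maximalIdeal S := fun x hx => hxs x (by simp [hx])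
    have hr1 : IsWeaklyRegular M (xs ++ [a]) := by
      have h1 := ((isWeaklyRegular_append_iff M (a :: xs) [b]).1 hr).1
      refine IsLocalRing.isWeaklyRegular_of_perm_of_subset_maximalIdeal h1 ?_ hxs
      exact (List.perm_append_singleton a xs).symm
    have hr2 : IsWeaklyRegular (QuotSMulTop a M) (xs ++ [b]) := by
      rw [List.cons_append, isWeaklyRegular_cons_iff] at hr
      exact hr.2
    induction n with
    | zero => intro m _; simp
    | succ n ihn =>
      intro m hm
      obtain ⟨y, hy, z, hz, e⟩ := pow_step a xs M n _ hm
      have hmap : ((Ideal.ofList xs) ^ (n+1) • (⊤ : Submodule S M)).map (Submodule.mkQ (a • (⊤ : Submodule S M))) = (Ideal.ofList xs) ^ (n+1) • (⊤ : Submodule S (QuotSMulTop a M)) := by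
        rw [Submodule.map_smul'', Submodule.map_top, Submodule.range_mkQ]
      have h1 := ih (QuotSMulTop a M) b hxs' hb hr2 (n+1) (Submodule.mkQ (a • (⊤ : Submodule S M)) m) (by
        rw [← map_smul, e, map_add, ← hmap]
        have : Submodule.mkQ (a • (⊤ : Submodule S M)) (a • z) = 0 := by
          rw [Submodule.mkQ_apply, Submodule.Quotient.mk_eq_zero]
          exact Submodule.smul_mem_pointwise_smul _ _ _ trivial
        rw [this, add_zero]
        exact Submodule.mem_map_of_mem hy)
      rw [← hmap] at h1
      obtain ⟨y', hy', e'⟩ := h1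
      have h2 : m - y' ∈ a • (⊤ : Submodule S M) := by
        rw [← Submodule.Quotient.mk_eq_zero, Submodule.Quotient.mk_sub, sub_eq_zero]
        exact e'.symm
      obtain ⟨w, -, hw⟩ := (Submodule.mem_smul_pointwise_iff_exists _ _ _).1 h2
      have hm' : m = y' + a • w := by rw [hw]; abel
      have hle : (Ideal.ofList xs) ^ (n+1) • (⊤ : Submodule S M) ≤ (Ideal.ofList (a :: xs)) ^ (n+1) • (⊤ : Submodule S M) := by
        refine Submodule.smul_mono_left (Ideal.pow_right_mono ?_ _)
        rw [Ideal.ofList_cons]; exact le_sup_right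
      have h3 : a • (b • w) ∈ (Ideal.ofList (a :: xs)) ^ (n+1) • (⊤ : Submodule S M) := by
        have h4 : a • (b • w) = b • m - b • y' := by rw [hm', smul_add, add_sub_cancel_left, smul_comm]
        rw [h4]
        exact sub_mem hm (Submodule.smul_mem _ _ (hle hy'))
      have h5 := ihn w (colon_step a xs M n (ih M a hxs' ha hr1 (n+1)) _ h3)
      rw [hm']
      refine add_mem (hle hy') ?_
      rw [pow_succ', mul_smul]
      exact Submodule.smul_mem_smul (by rw [Ideal.ofList_cons]; exact Ideal.mem_sup_left (Ideal.mem_span_singleton_self a)) h5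

end PartTR1

section PartTR2

open IsLocalRing RingTheory.Sequence CategoryTheory MonoidalCategory

noncomputable section

/-- The complex `X ⊗ P`. -/
def TC {S : Type u} [CommRing S] {C : ModuleCat.{u} S} (P : ProjectiveResolution C) (X : ModuleCat.{u} S) :
    ChainComplex (ModuleCat.{u} S) ℕ :=
  (((tensoringLeft (ModuleCat.{u} S)).obj X).mapHomologicalComplex (ComplexShape.down ℕ)).obj P.complex

def TCmap {S : Type u} [CommRing S] {C : ModuleCat.{u} S} (P : ProjectiveResolution C) {X Y : ModuleCat.{u} S} (f : X ⟶ Y) :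
    TC P X ⟶ TC P Y :=
  (NatTrans.mapHomologicalComplex ((tensoringLeft (ModuleCat.{u} S)).map f) (ComplexShape.down ℕ)).app P.complex

theorem TCmap_f {S : Type u} [CommRing S] {C : ModuleCat.{u} S} (P : ProjectiveResolution C) {X Y : ModuleCat.{u} S} (f : X ⟶ Y) (i : ℕ) :
    (TCmap P f).f i = f ▷ P.complex.X i := rfl

theorem tor_iff {S : Type u} [CommRing S] {C : ModuleCat.{u} S} (P : ProjectiveResolution C) (X : ModuleCat.{u} S) (j : ℕ) :
    (TC P X).ExactAt j ↔ Limits.IsZero (((Tor (ModuleCat.{u} S) j).obj X).obj C) := by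
  rw [HomologicalComplex.exactAt_iff_isZero_homology]
  exact (P.isoLeftDerivedObj ((tensoringLeft (ModuleCat.{u} S)).obj X) j).symm.isZero_iff

theorem TC_short {S : Type u} [CommRing S] {C : ModuleCat.{u} S} (P : ProjectiveResolution C)
    (Q : ShortComplex (ModuleCat.{u} S)) (hQ : Q.ShortExact) :
    ∃ w : TCmap P Q.f ≫ TCmap P Q.g = 0, (ShortComplex.mk (TCmap P Q.f) (TCmap P Q.g) w).ShortExact := by
  have w : TCmap P Q.f ≫ TCmap P Q.g = 0 := by
    ext1 i
    change Q.f ▷ P.complex.X i ≫ Q.g ▷ P.complex.X i = 0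
    rw [← comp_whiskerRight, Q.zero]
    simp
  refine ⟨w, HomologicalComplex.shortExact_of_degreewise_shortExact _ fun i => ?_⟩
  haveI : Module.Projective S (P.complex.X i) := (IsProjective.iff_projective _).2 (P.projective i)
  have h1 : Function.Exact Q.f.hom Q.g.hom := (ShortComplex.ShortExact.moduleCat_exact_iff_function_exact Q).1 hQ.exact
  have h2 := hQ.moduleCat_injective_f
  have h3 := hQ.moduleCat_surjective_g
  refine ShortComplex.ShortExact.mk' ?_ ?_ ?_
  · rw [ShortComplex.ShortExact.moduleCat_exact_iff_function_exact]
    exact rTensor_exact (P.complex.X i) h1 h3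
  · rw [ModuleCat.mono_iff_injective]
    exact Module.Flat.rTensor_preserves_injective_linearMap Q.f.hom h2
  · rw [ModuleCat.epi_iff_surjective]
    exact LinearMap.rTensor_surjective (P.complex.X i) h3

theorem TC_free {S : Type u} [CommRing S] {C : ModuleCat.{u} S} (P : ProjectiveResolution C) (X : ModuleCat.{u} S) [Module.Flat S X]
    (j : ℕ) (hj : 1 ≤ j) : (TC P X).ExactAt j := by
  obtain ⟨j, rfl⟩ : ∃ i, j = i + 1 := ⟨j - 1, by omega⟩
  have h : P.complex.ExactAt (j+1) := P.complex_exactAt_succ j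
  rw [HomologicalComplex.exactAt_iff' _ (j+2) (j+1) j (by simp) (by simp)] at h ⊢
  rw [ShortComplex.ShortExact.moduleCat_exact_iff_function_exact] at h ⊢
  exact Module.Flat.lTensor_exact X h

theorem TC_smul {S : Type u} [CommRing S] {C : ModuleCat.{u} S} (P : ProjectiveResolution C) (X : ModuleCat.{u} S) (a : S)
    (ha : ∀ t : TensorProduct S X C, a • t = 0 → t = 0) :
    Mono (HomologicalComplex.homologyMap (TCmap P (a • 𝟙 X)) 0) := by
  have e1 : TCmap P (a • 𝟙 X) = a • 𝟙 (TC P X) := by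
    ext1 i
    change (a • 𝟙 X) ▷ P.complex.X i = a • 𝟙 _
    rw [MonoidalLinear.smul_whiskerRight, id_whiskerRight]
    rfl
  have e2 : HomologicalComplex.homologyMap (a • 𝟙 (TC P X)) 0 = a • 𝟙 _ := by
    change ShortComplex.homologyMap (a • 𝟙 ((TC P X).sc 0)) = a • 𝟙 _
    rw [ShortComplex.homologyMap_smul, ShortComplex.homologyMap_id]
    rfl
  rw [e1, e2]
  let F := (tensoringLeft (ModuleCat.{u} S)).obj X
  haveI : Limits.PreservesFiniteColimits F :=
    haveI : Limits.PreservesColimits (tensorLeft X) := inferInstance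
    inferInstanceAs (Limits.PreservesFiniteColimits (tensorLeft X))
  let e : (TC P X).homology 0 ≅ F.obj C := (P.isoLeftDerivedObj F 0).symm ≪≫ F.leftDerivedZeroIsoSelf.app C
  rw [ModuleCat.mono_iff_injective, injective_iff_map_eq_zero]
  intro t ht
  have ht' : a • t = 0 := ht
  have h : e.hom.hom t = 0 := by
    apply ha
    have := congrArg e.hom.hom ht'
    rw [map_smul, map_zero] at this
    exact this
  have := congrArg e.inv.hom h
  rw [map_zero] at this
  rw [← this]
  exact (e.hom_inv_id_apply t).symm

end

end PartTR2

section PartTR3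

open IsLocalRing RingTheory.Sequence CategoryTheory MonoidalCategory

theorem acyc_mid {S : Type u} [CommRing S] {C : ModuleCat.{u} S} (P : ProjectiveResolution C)
    {X Y Z : Type u} [AddCommGroup X] [Module S X] [AddCommGroup Y] [Module S Y] [AddCommGroup Z] [Module S Z]
    (f : X →ₗ[S] Y) (g : Y →ₗ[S] Z) (hf : Function.Injective f) (hg : Function.Surjective g) (h : Function.Exact f g)
    (hX : ∀ j, 1 ≤ j → (TC P (ModuleCat.of S X)).ExactAt j) (hZ : ∀ j, 1 ≤ j → (TC P (ModuleCat.of S Z)).ExactAt j) :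
    ∀ j, 1 ≤ j → (TC P (ModuleCat.of S Y)).ExactAt j := by
  intro j hj
  have w : ModuleCat.ofHom f ≫ ModuleCat.ofHom g = 0 := by
    ext x; exact h.apply_apply_eq_zero x
  have hs : (ShortComplex.mk (ModuleCat.ofHom f) (ModuleCat.ofHom g) w).ShortExact :=
    ShortComplex.ShortExact.mk' ((ShortComplex.ShortExact.moduleCat_exact_iff_function_exact _).2 h)
      ((ModuleCat.mono_iff_injective _).2 hf) ((ModuleCat.epi_iff_surjective _).2 hg)
  obtain ⟨w', h'⟩ := TC_short P _ hs
  exact h'.exactAt_X₂ j (hX j hj) (hZ j hj)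

theorem acyc_smul {S : Type u} [CommRing S] {C : ModuleCat.{u} S} (P : ProjectiveResolution C)
    {X Z : Type u} [AddCommGroup X] [Module S X] [AddCommGroup Z] [Module S Z]
    (a : S) (g : X →ₗ[S] Z) (hf : ∀ x : X, a • x = 0 → x = 0) (hg : Function.Surjective g)
    (h : ∀ x : X, g x = 0 ↔ ∃ y, a • y = x)
    (ha : ∀ t : TensorProduct S X C, a • t = 0 → t = 0)
    (hX : ∀ j, 1 ≤ j → (TC P (ModuleCat.of S X)).ExactAt j) :
    ∀ j, 1 ≤ j → (TC P (ModuleCat.of S Z)).ExactAt j := by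
  intro j hj
  have w : (a • 𝟙 (ModuleCat.of S X)) ≫ ModuleCat.ofHom g = 0 := by
    ext x; exact (h (a • x)).2 ⟨x, rfl⟩
  have hs : (ShortComplex.mk (a • 𝟙 (ModuleCat.of S X)) (ModuleCat.ofHom g) w).ShortExact :=
    ShortComplex.ShortExact.mk' ((ShortComplex.ShortExact.moduleCat_exact_iff_function_exact _).2 (fun x => h x))
      ((ModuleCat.mono_iff_injective _).2 ((injective_iff_map_eq_zero _).2 hf)) ((ModuleCat.epi_iff_surjective _).2 hg)
  obtain ⟨w', h'⟩ := TC_short P _ hs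
  refine h'.exactAt_X₃ j ?_ ?_
  · have hz := (HomologicalComplex.exactAt_iff_isZero_homology _ _).1 (hX j hj)
    exact ⟨fun _ _ _ => hz.eq_of_src _ _⟩
  · intro i hi
    rcases Nat.eq_zero_or_pos i with rfl | hi0
    · exact TC_smul P _ a ha
    · have hz := (HomologicalComplex.exactAt_iff_isZero_homology _ _).1 (hX i hi0)
      exact ⟨fun _ _ _ => hz.eq_of_tgt _ _⟩

theorem tensor_quot_reg {S : Type u} [CommRing S] (A : Ideal S) (C : Type u) [AddCommGroup C] [Module S C] (a : S)
    (h : ∀ m : C, a • m ∈ A • (⊤ : Submodule S C) → m ∈ A • (⊤ : Submodule S C)) :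
    ∀ t : TensorProduct S (S ⧸ A) C, a • t = 0 → t = 0 := by
  intro t ht
  let e := TensorProduct.quotTensorEquivQuotSMul C A
  have h1 : a • e t = 0 := by rw [← map_smul, ht, map_zero]
  suffices e t = 0 by simpa using this
  obtain ⟨m, hm⟩ := Submodule.Quotient.mk_surjective _ (e t)
  rw [← hm] at h1 ⊢
  rw [← Submodule.Quotient.mk_smul, Submodule.Quotient.mk_eq_zero] at h1
  exact (Submodule.Quotient.mk_eq_zero _).2 (h m h1)

theorem acyc_main {S : Type u} [CommRing S] [IsLocalRing S] [IsNoetherianRing S]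
    (C : Type u) [AddCommGroup C] [Module S C] [Module.Finite S C] (P : ProjectiveResolution (ModuleCat.of S C))
    (xs : List S) (hxs : ∀ x ∈ xs, x ∈ maximalIdeal S) (hS : IsWeaklyRegular S xs) (hC : IsWeaklyRegular C xs) :
    ∀ n j, 1 ≤ j → (TC P (ModuleCat.of S (S ⧸ (Ideal.ofList xs) ^ n))).ExactAt j := by
  have htop : ∀ A : Ideal S, A • (⊤ : Submodule S S) = A := fun A => by simp
  have hzero : ∀ xs : List S, ∀ j, 1 ≤ j → (TC P (ModuleCat.of S (S ⧸ (Ideal.ofList xs) ^ 0))).ExactAt j := by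
    intro xs j hj
    haveI : Subsingleton (S ⧸ (Ideal.ofList xs) ^ 0) := Ideal.Quotient.subsingleton_iff.2 (by simp)
    haveI : Module.Flat S (ModuleCat.of S (S ⧸ (Ideal.ofList xs) ^ 0)) :=
      inferInstanceAs (Module.Flat S (S ⧸ (Ideal.ofList xs) ^ 0))
    exact TC_free P _ j hj
  induction xs with
  | nil =>
    intro n j hj
    cases n with
    | zero => exact hzero _ j hj
    | succ n =>
      have e : (Ideal.ofList ([] : List S)) ^ (n+1) = ⊥ := by rw [Ideal.ofList_nil]; simp [Ideal.bot_pow]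
      rw [e]
      haveI : Module.Flat S (ModuleCat.of S (S ⧸ (⊥ : Ideal S))) :=
        Module.Flat.of_linearEquiv (Submodule.quotEquivOfEqBot (⊥ : Ideal S) rfl)
      exact TC_free P _ j hj
  | cons a xs ih =>
    have ha := hxs a (by simp)
    have hxs' : ∀ x ∈ xs, x ∈ maximalIdeal S := fun x hx => hxs x (by simp [hx])
    have hrS : IsWeaklyRegular S (xs ++ [a]) :=
      IsLocalRing.isWeaklyRegular_of_perm_of_subset_maximalIdeal hS (List.perm_append_singleton a xs).symm hxs
    have hrC : IsWeaklyRegular C (xs ++ [a]) :=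
      IsLocalRing.isWeaklyRegular_of_perm_of_subset_maximalIdeal hC (List.perm_append_singleton a xs).symm hxs
    have ih' := ih hxs' ((isWeaklyRegular_append_iff S xs [a]).1 hrS).1 ((isWeaklyRegular_append_iff C xs [a]).1 hrC).1
    have regS := reg_pow xs S a hxs' ha hrS
    have regC := reg_pow xs C a hxs' ha hrC
    simp only [htop] at regS
    have key : ∀ n j, 1 ≤ j → (TC P (ModuleCat.of S (S ⧸ ((Ideal.ofList xs) ^ n ⊔ Ideal.span {a})))).ExactAt j := by
      intro n
      refine acyc_smul P a (Submodule.factor (le_sup_left : (Ideal.ofList xs) ^ n ≤ (Ideal.ofList xs) ^ n ⊔ Ideal.span {a}))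
        ?_ (Submodule.factor_surjective _) ?_ (tensor_quot_reg _ C a (regC n)) (ih' n)
      · intro x hx
        obtain ⟨m, rfl⟩ := Submodule.Quotient.mk_surjective _ x
        rw [← Submodule.Quotient.mk_smul, Submodule.Quotient.mk_eq_zero] at hx
        exact (Submodule.Quotient.mk_eq_zero _).2 (regS n m hx)
      · intro x
        obtain ⟨m, rfl⟩ := Submodule.Quotient.mk_surjective _ x
        rw [← Submodule.mkQ_apply, Submodule.factor_mk, Submodule.mkQ_apply, Submodule.mkQ_apply, Submodule.Quotient.mk_eq_zero]
        constructor
        · intro h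
          obtain ⟨y, hy, z, hz, rfl⟩ := Submodule.mem_sup.1 h
          obtain ⟨w, rfl⟩ := Ideal.mem_span_singleton'.1 hz
          refine ⟨Submodule.Quotient.mk w, ?_⟩
          rw [← Submodule.Quotient.mk_smul, Submodule.Quotient.eq]
          have : a • w - (y + w * a) = - y := by rw [smul_eq_mul]; ring
          rw [this]; exact neg_mem hy
        · rintro ⟨y, hy⟩
          obtain ⟨w, rfl⟩ := Submodule.Quotient.mk_surjective _ y
          rw [← Submodule.Quotient.mk_smul, Submodule.Quotient.eq] at hy
          have : m = - (a • w - m) + w * a := by rw [smul_eq_mul]; ring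
          rw [this]
          exact add_mem (neg_mem (Ideal.mem_sup_left hy)) (Ideal.mem_sup_right (Ideal.mem_span_singleton'.2 ⟨w, rfl⟩))
    intro n
    induction n with
    | zero => exact hzero _
    | succ n ihn =>
      have hamem : a ∈ Ideal.ofList (a :: xs) := Ideal.subset_span (by simp)
      have hle1 : (Ideal.ofList (a :: xs)) ^ (n+1) ≤ (Ideal.ofList xs) ^ (n+1) ⊔ Ideal.span {a} := by
        intro m hm
        obtain ⟨y, hy, z, hz, rfl⟩ := pow_step a xs S n m (by rwa [htop])
        rw [htop] at hy
        exact add_mem (Ideal.mem_sup_left hy) (Ideal.mem_sup_right (Ideal.mem_span_singleton'.2 ⟨z, mul_comm _ _⟩))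
      have hle2 : (Ideal.ofList xs) ^ (n+1) ≤ (Ideal.ofList (a :: xs)) ^ (n+1) := by
        refine Ideal.pow_right_mono ?_ _
        rw [Ideal.ofList_cons]; exact le_sup_right
      have hle3 : (Ideal.ofList (a :: xs)) ^ n ≤ Submodule.comap (LinearMap.lsmul S S a) ((Ideal.ofList (a :: xs)) ^ (n+1)) := by
        intro m hm
        change a • m ∈ (Ideal.ofList (a :: xs)) ^ (n+1)
        rw [pow_succ']
        exact Ideal.mul_mem_mul hamem hm
      refine acyc_mid P (Submodule.mapQ _ _ (LinearMap.lsmul S S a) hle3) (Submodule.factor hle1) ?_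
        (Submodule.factor_surjective _) ?_ ihn (key (n+1))
      · rw [injective_iff_map_eq_zero]
        intro x hx
        obtain ⟨m, rfl⟩ := Submodule.Quotient.mk_surjective _ x
        rw [Submodule.mapQ_apply, Submodule.Quotient.mk_eq_zero] at hx
        rw [Submodule.Quotient.mk_eq_zero]
        have := colon_step a xs S n (by simpa only [htop] using regS (n+1)) m (by rw [htop]; exact hx)
        rwa [htop] at this
      · intro x
        obtain ⟨m, rfl⟩ := Submodule.Quotient.mk_surjective _ x
        rw [← Submodule.mkQ_apply, Submodule.factor_mk, Submodule.mkQ_apply, Submodule.mkQ_apply, Submodule.Quotient.mk_eq_zero]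
        constructor
        · intro h
          obtain ⟨y, hy, z, hz, rfl⟩ := Submodule.mem_sup.1 h
          obtain ⟨w, rfl⟩ := Ideal.mem_span_singleton'.1 hz
          refine ⟨Submodule.Quotient.mk w, ?_⟩
          rw [Submodule.mapQ_apply, Submodule.Quotient.eq]
          have : LinearMap.lsmul S S a w - (y + w * a) = - y := by rw [LinearMap.lsmul_apply, smul_eq_mul]; ring
          rw [this]; exact neg_mem (hle2 hy)
        · rintro ⟨y, hy⟩
          obtain ⟨w, rfl⟩ := Submodule.Quotient.mk_surjective _ y
          rw [Submodule.mapQ_apply, Submodule.Quotient.eq] at hy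
          have : m = - (LinearMap.lsmul S S a w - m) + w * a := by rw [LinearMap.lsmul_apply, smul_eq_mul]; ring
          rw [this]
          exact add_mem (neg_mem (hle1 hy)) (Ideal.mem_sup_right (Ideal.mem_span_singleton'.2 ⟨w, rfl⟩))

theorem tor_final {S : Type u} [CommRing S] [IsLocalRing S] [IsNoetherianRing S]
    (s : Finset S) (hs : Ideal.span (s : Set S) = maximalIdeal S)
    (hs' : ((s.card : ℕ∞) : WithBot ℕ∞) = ringKrullDim S)
    (I : Ideal S) [IsLocalRing (S ⧸ I)]
    (d : ℕ) (hd : ringKrullDim (S ⧸ I) = ((d : ℕ∞) : WithBot ℕ∞))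
    (hdep : ∃ rs : List (S ⧸ I), rs.length = d ∧ (∀ r ∈ rs, r ∈ maximalIdeal (S ⧸ I)) ∧ IsRegular (S ⧸ I) rs)
    (a : Fin d → S)
    (hsop : Order.krullDim (Submodule (S ⧸ I)
      ((S ⧸ I) ⧸ Ideal.span (Set.range fun i => Ideal.Quotient.mk I (a i)))) < ⊤) (j n : ℕ) (hj : 1 ≤ j) :
    Subsingleton (((Tor (ModuleCat.{u} S) j).obj (ModuleCat.of S (S ⧸ (Ideal.span (Set.range a)) ^ n))).obj
        (ModuleCat.of S (S ⧸ I))) := by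
  apply ModuleCat.subsingleton_of_isZero
  obtain ⟨P⟩ : Nonempty (ProjectiveResolution (ModuleCat.of S (S ⧸ I))) := ⟨projectiveResolution _⟩
  rw [← tor_iff P]
  by_cases ham : ∀ i, a i ∈ maximalIdeal S
  · obtain ⟨h1, h2⟩ := a_reg s hs hs' I d hd hdep a ham hsop
    have h := acyc_main (S ⧸ I) P (List.ofFn a) (by
      intro x hx
      obtain ⟨i, rfl⟩ := (List.mem_ofFn' _ _).1 hx
      exact ham i) h2 h1 n j hj
    have e : Ideal.ofList (List.ofFn a) = Ideal.span (Set.range a) := by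
      unfold Ideal.ofList
      congr 1
      ext x
      exact List.mem_ofFn' _ _
    rwa [e] at h
  · push Not at ham
    obtain ⟨i, hi⟩ := ham
    have ht : Ideal.span (Set.range a) = ⊤ := by
      refine Ideal.eq_top_of_isUnit_mem _ (Ideal.subset_span ⟨i, rfl⟩) ?_
      simpa using hi
    haveI : Subsingleton (S ⧸ (Ideal.span (Set.range a)) ^ n) := Ideal.Quotient.subsingleton_iff.2 (by rw [ht, Ideal.top_pow])
    haveI : Module.Flat S (ModuleCat.of S (S ⧸ (Ideal.span (Set.range a)) ^ n)) :=
      inferInstanceAs (Module.Flat S (S ⧸ (Ideal.span (Set.range a)) ^ n))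
    exact TC_free P _ j hj

end PartTR3

/-- If `I` is a Cohen–Macaulay ideal of a regular local ring `S` and `J = (a₁,…,a_d)` with the
images of the `aᵢ` forming a system of parameters of `S/I`, then `Torⱼ^S(S/Jⁿ, S/I) = 0` for
all `j ≥ 1`, `n ≥ 1`. -/
theorem stmt_5 (S : Type u) [CommRing S] [IsLocalRing S] [IsNoetherianRing S]
    (hreg : IsRegularLocal S)
    (I : Ideal S) [IsLocalRing (S ⧸ I)] (hCM : IsCMRing (S ⧸ I))
    (d : ℕ) (hd : ringKrullDim (S ⧸ I) = ((d : ℕ∞) : WithBot ℕ∞))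
    (a : Fin d → S) (J : Ideal S) (hJ : J = Ideal.span (Set.range a))
    (hsop : mlen (S ⧸ I)
      ((S ⧸ I) ⧸ Ideal.span (Set.range fun i => Ideal.Quotient.mk I (a i))) < ⊤) :
    ∀ j n : ℕ, 1 ≤ j → 1 ≤ n →
      Subsingleton (((Tor (ModuleCat.{u} S) j).obj (ModuleCat.of S (S ⧸ J ^ n))).obj
        (ModuleCat.of S (S ⧸ I))) := by
  intro j n hj _
  obtain ⟨s, hs, hs'⟩ := hreg
  subst hJ
  refine tor_final s hs hs' I d hd (cm_reg d ?_) a hsop j n hj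
  have h : (mdepth (S ⧸ I) (S ⧸ I) : WithBot ℕ∞) = ((d : ℕ∞) : WithBot ℕ∞) := Eq.trans hCM hd
  exact WithBot.coe_injective h
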